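/- Transfer coefficients in the Klein paradox case (Section 5): Assume V satisfies assumption (A), m > 0, E is in region III, and m²c⁴ − (V(x)−E)² has exactly two real zeros t₁(E) < t₂(E), both simple. Then there exist classical analytic symbols φ, φ' of non-negative order such that the transfer matrix coefficients satisfy t(E,h) = (1 + hφ(h))·exp{(1/h)(z(t₁(E),−∞) + z(t₂(E),+∞) + S(E))} and r(E,h) = −i(1 + hφ'(h))·exp{(1/h)(−z(t₁(E),−∞) + z(t₂(E),+∞) + S(E))}, where S(E) = ∫_{t₁(E)}^{t₂(E)} √((m²c⁴ − (E−V(t))²)/c²) dt and z(x,±∞) = i∫_{±∞}^{x} (√(((E−V(t))² − m²c⁴)/c²) − √(((E−V^±)² − m²c⁴)/c²)) dt + i√(((E−V^±)² − m²c⁴)/c²)·x. -/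

import Mathlib

open Complex Filter Topology MeasureTheory Set

noncomputable section

/-- The sector `𝒮 = {x ∈ ℂ : |Im x| < ε|Re x| + η}`. -/
def Sector (ε η : ℝ) : Set ℂ := {x : ℂ | |x.im| < ε * |x.re| + η}

/-- Assumption (A): `V` is real on the real axis, analytic in a sector `𝒮`
around the real axis, and tends to constants `V^±` at `±∞` in `𝒮` at rate
`⟨x⟩^{-δ}`, `δ > 1`, with `V⁻ < V⁺`. -/
structure AssumptionA (V : ℂ → ℂ) (Vm Vp : ℝ) : Prop where
  lt : Vm < Vp
  real_on_real : ∀ x : ℝ, (V x).im = 0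
  sector : ∃ ε > (0 : ℝ), ∃ η > (0 : ℝ), ∃ δ > (1 : ℝ),
    AnalyticOnNhd ℂ V (Sector ε η) ∧
    (∃ C R : ℝ, ∀ x ∈ Sector ε η, R ≤ x.re →
      ‖V x - (Vp : ℂ)‖ ≤ C * (1 + ‖x‖ ^ 2) ^ (-(δ / 2))) ∧
    (∃ C R : ℝ, ∀ x ∈ Sector ε η, x.re ≤ -R →
      ‖V x - (Vm : ℂ)‖ ≤ C * (1 + ‖x‖ ^ 2) ^ (-(δ / 2)))

/-- `u = (u₁,u₂)` solves the one-dimensional Dirac equation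
`(-i h c σ₁ d/dx + m c² σ₃ + V(x) I₂) u = E u` on `ℝ`. -/
structure IsDiracSolution (hp m c : ℝ) (V : ℂ → ℂ) (E : ℝ) (u : ℝ → ℂ × ℂ) : Prop where
  diff1 : Differentiable ℝ fun x : ℝ => (u x).1
  diff2 : Differentiable ℝ fun x : ℝ => (u x).2
  eq1 : ∀ x : ℝ,
    -Complex.I * (hp : ℂ) * (c : ℂ) * deriv (fun y : ℝ => (u y).2) x
      + ((m : ℂ) * (c : ℂ) ^ 2 + V x) * (u x).1 = (E : ℂ) * (u x).1
  eq2 : ∀ x : ℝ,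
    -Complex.I * (hp : ℂ) * (c : ℂ) * deriv (fun y : ℝ => (u y).1) x
      + (-((m : ℂ) * (c : ℂ) ^ 2) + V x) * (u x).2 = (E : ℂ) * (u x).2

/-- `Φ(λ) = sgn(λ) √(λ² − m²c⁴)`. -/
def PhiF (m c lam : ℝ) : ℝ := Real.sign lam * Real.sqrt (lam ^ 2 - m ^ 2 * c ^ 4)

/-- `A(λ) = ((λ + mc²)/(λ − mc²))^{1/4}`. -/
def AmpF (m c lam : ℝ) : ℝ := ((lam + m * c ^ 2) / (lam - m * c ^ 2)) ^ ((1 : ℝ) / 4)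

/-- `u(x)` behaves exactly like `e^{θ x} v` along the filter `l`,
i.e. `u(x) e^{-θ x} → v`. -/
def JostAsymp (u : ℝ → ℂ × ℂ) (θ : ℂ) (v : ℂ × ℂ) (l : Filter ℝ) : Prop :=
  Tendsto (fun x : ℝ => (u x).1 * Complex.exp (-(θ * (x : ℂ)))) l (𝓝 v.1) ∧
  Tendsto (fun x : ℝ => (u x).2 * Complex.exp (-(θ * (x : ℂ)))) l (𝓝 v.2)

/-- `u` behaves exactly like `exp(s (i/(hc)) Φ(E−V₀) x) · (A(E−V₀), s' A(E−V₀)⁻¹)`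
along `l`.  The Jost solutions `ω_in^±` correspond to `s = s' = ∓1`, `l = at±∞`,
and `ω_out^±` to `s = s' = ±1`, `l = at±∞`. -/
def JostCond (hp m c E V0 s s' : ℝ) (l : Filter ℝ) (u : ℝ → ℂ × ℂ) : Prop :=
  JostAsymp u ((s : ℂ) * Complex.I / ((hp : ℂ) * (c : ℂ)) * ((PhiF m c (E - V0) : ℝ) : ℂ))
    (((AmpF m c (E - V0) : ℝ) : ℂ), (s' : ℂ) * (((AmpF m c (E - V0) : ℝ) : ℂ))⁻¹) l

/-- `B^± = ((mc² + E − V^±)/(mc² − E + V^±))^{1/4}`. -/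
def Bsym (m c E W : ℝ) : ℝ := ((m * c ^ 2 + E - W) / (m * c ^ 2 - E + W)) ^ ((1 : ℝ) / 4)

/-- The decaying Jost solution `ω_d^±` (for `s = ±1`, `l = at±∞`):
`ω_d^± ~ exp(∓ (1/(hc)) √(m²c⁴ − (V^± − E)²) x) (∓ i B^±, (B^±)⁻¹)`. -/
def DecayCond (hp m c E W s : ℝ) (l : Filter ℝ) (u : ℝ → ℂ × ℂ) : Prop :=
  JostAsymp u (-(s : ℂ) * ((Real.sqrt (m ^ 2 * c ^ 4 - (W - E) ^ 2) : ℝ) : ℂ) / ((hp : ℂ) * (c : ℂ)))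
    (-(s : ℂ) * Complex.I * ((Bsym m c E W : ℝ) : ℂ), (((Bsym m c E W : ℝ) : ℂ))⁻¹) l

/-- The defining relation `(ω_in^−, ω_in^+) = (ω_out^+, ω_out^−) · 𝕊` of the
scattering matrix. -/
def ScatRel (ωinm ωinp ωoutp ωoutm : ℝ → ℂ × ℂ) (S : Matrix (Fin 2) (Fin 2) ℂ) : Prop :=
  (∀ x : ℝ, ωinm x = S 0 0 • ωoutp x + S 1 0 • ωoutm x) ∧
  (∀ x : ℝ, ωinp x = S 0 1 • ωoutp x + S 1 1 • ωoutm x)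

/-- A classical analytic symbol (of non-negative order `mo`) in the semiclassical
parameter `h`: there are coefficients `a j` with `‖a j‖ ≤ C^{j+1} j^j` such that
`f(h) − ∑_{0 ≤ j ≤ h⁻¹/(e C₁)} a j h^{mo+j}` is `O(e^{-ρ/h})` for every `C₁ > C`. -/
def IsCAS (f : ℝ → ℂ) : Prop :=
  ∃ (mo : ℕ) (a : ℕ → ℂ) (C : ℝ), 0 < C ∧
    (∀ j : ℕ, ‖a j‖ ≤ C ^ (j + 1) * (j : ℝ) ^ j) ∧
    ∀ C₁ : ℝ, C < C₁ → ∃ ρ > (0 : ℝ), ∃ M : ℝ,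
      ∀ h : ℝ, 0 < h → h < 1 →
        ‖f h - ∑ j ∈ Finset.range (⌊1 / (h * Real.exp 1 * C₁)⌋₊ + 1), a j * (h : ℂ) ^ (mo + j)‖
          ≤ M * Real.exp (-ρ / h)

/-- `E^± = (−m²c⁴ + (V^± − E)²)/c²`. -/
def Esym (m c E W : ℝ) : ℝ := (-(m ^ 2 * c ^ 4) + (W - E) ^ 2) / c ^ 2

/-- `Q^±(t,E) = √((−m²c⁴ + (V(t) − E)²)/c²) − √(E^±)` (here `W = V^±`). -/
def Qsym (m c E W : ℝ) (V : ℂ → ℂ) (t : ℝ) : ℝ :=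
  Real.sqrt ((-(m ^ 2 * c ^ 4) + ((V t).re - E) ^ 2) / c ^ 2) - Real.sqrt (Esym m c E W)

/-- `Q₋^±(t,E) = √((m²c⁴ − (V(t) − E)²)/c²) − √(−E^±)` (here `W = V^±`). -/
def Qminus (m c E W : ℝ) (V : ℂ → ℂ) (t : ℝ) : ℝ :=
  Real.sqrt ((m ^ 2 * c ^ 4 - ((V t).re - E) ^ 2) / c ^ 2) - Real.sqrt (-(Esym m c E W))

/-- The classical action `S(E)` between the turning points. -/
def SAct (m c E : ℝ) (V : ℂ → ℂ) (t₁ t₂ : ℝ) : ℝ :=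
  ∫ t in t₁..t₂, Real.sqrt ((m ^ 2 * c ^ 4 - ((V t).re - E) ^ 2) / c ^ 2)

/-- The phase `T(E)`. -/
def TPhase (m c E Vm Vp : ℝ) (V : ℂ → ℂ) (t₁ t₂ : ℝ) : ℝ :=
  (∫ t in Set.Iic t₁, Qsym m c E Vm V t) - (∫ t in Set.Ici t₂, Qsym m c E Vp V t)
    + t₁ * Real.sqrt (Esym m c E Vm) + t₂ * Real.sqrt (Esym m c E Vp)

/-- The Wronskian of two vectors in `ℂ²`. -/
def Wron (u v : ℂ × ℂ) : ℂ := u.1 * v.2 - u.2 * v.1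

end

/-- The Taylor coefficient of `f` at the origin. -/
noncomputable def taylorCoeff (f : ℂ → ℂ) (j : ℕ) : ℂ :=
  ((j.factorial : ℂ))⁻¹ * iteratedDeriv j f 0

lemma norm_taylorCoeff_le {f : ℂ → ℂ} {R r M : ℝ} (hf : DifferentiableOn ℂ f (Metric.ball 0 R))
    (hM : ∀ z ∈ Metric.ball (0 : ℂ) R, ‖f z‖ ≤ M) (hr : 0 < r) (hrR : r < R) (j : ℕ) :
    ‖taylorCoeff f j‖ ≤ M / r ^ j := by
  have hsub : Metric.closedBall (0 : ℂ) r ⊆ Metric.ball 0 R := Metric.closedBall_subset_ball hrR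
  have h := norm_iteratedDeriv_le_of_forall_mem_sphere_norm_le (f := f) (c := 0) (C := M) j hr
    ((hf.mono hsub).diffContOnCl_ball subset_rfl)
    (fun z hz => hM z (hsub (Metric.sphere_subset_closedBall hz)))
  have hj : (0 : ℝ) < j.factorial := by exact_mod_cast j.factorial_pos
  rw [taylorCoeff, norm_mul, norm_inv, Complex.norm_natCast]
  calc (j.factorial : ℝ)⁻¹ * ‖iteratedDeriv j f 0‖
      ≤ (j.factorial : ℝ)⁻¹ * (j.factorial * M / r ^ j) := by gcongr
    _ = M / r ^ j := by field_simp

lemma norm_sub_taylor_le {f : ℂ → ℂ} {R r M : ℝ} (hf : DifferentiableOn ℂ f (Metric.ball 0 R))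
    (hM : ∀ z ∈ Metric.ball (0 : ℂ) R, ‖f z‖ ≤ M) (hr : 0 < r) (hrR : r < R) {z : ℂ}
    (hz : ‖z‖ ≤ r / 2) (N : ℕ) :
    ‖f z - ∑ j ∈ Finset.range N, taylorCoeff f j * z ^ j‖ ≤ 2 * M * (‖z‖ / r) ^ N := by
  have hzR : z ∈ Metric.ball (0 : ℂ) R := by
    rw [mem_ball_zero_iff]; linarith
  have hs : HasSum (fun j => taylorCoeff f j * z ^ j) (f z) := by
    have := hasSum_taylorSeries_on_ball hf hzR
    have he : (fun j => taylorCoeff f j * z ^ j) =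
        fun n : ℕ => ((n.factorial : ℂ))⁻¹ • (z - 0) ^ n • iteratedDeriv n f 0 := by
      funext j
      simp only [taylorCoeff, sub_zero, smul_eq_mul]; ring
    rwa [he]
  have hs' := (hasSum_nat_add_iff' N).2 hs
  have hM0 : 0 ≤ M := (norm_nonneg _).trans (hM z hzR)
  set x := ‖z‖ / r with hx
  have hx0 : 0 ≤ x := by positivity
  have hx2 : x ≤ 1 / 2 := by rw [hx, div_le_iff₀ hr]; linarith
  have hg : HasSum (fun j : ℕ => M * x ^ N * x ^ j) (M * x ^ N * (1 - x)⁻¹) :=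
    (hasSum_geometric_of_lt_one hx0 (by linarith)).mul_left _
  have hle : ‖f z - ∑ j ∈ Finset.range N, taylorCoeff f j * z ^ j‖ ≤ M * x ^ N * (1 - x)⁻¹ := by
    rw [← hs'.tsum_eq]
    refine tsum_of_norm_bounded hg fun j => ?_
    rw [norm_mul, norm_pow]
    calc ‖taylorCoeff f (j + N)‖ * ‖z‖ ^ (j + N) ≤ M / r ^ (j + N) * ‖z‖ ^ (j + N) := by
          gcongr; exact norm_taylorCoeff_le hf hM hr hrR _
      _ = M * x ^ N * x ^ j := by rw [hx, div_pow, div_pow, pow_add, pow_add]; field_simp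
  refine hle.trans ?_
  have : (1 - x)⁻¹ ≤ 2 := by
    rw [inv_le_comm₀ (by linarith) (by norm_num)]; linarith
  calc M * x ^ N * (1 - x)⁻¹ ≤ M * x ^ N * 2 := by gcongr
    _ = _ := by ring

lemma taylorCoeff_eq_of_norm_sub_le {f g : ℂ → ℂ} {R R' B ε : ℝ} {n j : ℕ} (hR : 0 < R)
    (hR' : 0 < R') (hf : DifferentiableOn ℂ f (Metric.ball 0 R))
    (hg : DifferentiableOn ℂ g (Metric.ball 0 R')) (hε : 0 < ε) (hj : j ≤ n)
    (hB : ∀ z : ℂ, ‖z‖ < ε → ‖f z - g z‖ ≤ B * ‖z‖ ^ (n + 1)) :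
    taylorCoeff f j = taylorCoeff g j := by
  have hB0 : 0 ≤ B := by
    have h := (norm_nonneg _).trans (hB ((ε / 2 : ℝ) : ℂ) (by
      rw [Complex.norm_real, Real.norm_of_nonneg (by linarith)]; linarith))
    by_contra hneg
    have hp : 0 < ‖((ε / 2 : ℝ) : ℂ)‖ ^ (n + 1) := by
      rw [Complex.norm_real, Real.norm_of_nonneg (by linarith)]; positivity
    nlinarith
  have hcd : ∀ {u : ℂ → ℂ} {r : ℝ}, 0 < r → DifferentiableOn ℂ u (Metric.ball 0 r) →
      ContDiffAt ℂ j u 0 := fun hr hu =>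
    (hu.analyticAt (Metric.ball_mem_nhds 0 hr)).contDiffAt
  have hsub : taylorCoeff f j - taylorCoeff g j = taylorCoeff (f - g) j := by
    rw [taylorCoeff, taylorCoeff, taylorCoeff, iteratedDeriv_sub (hcd hR hf) (hcd hR' hg)]; ring
  rw [← sub_eq_zero, hsub, ← norm_le_zero_iff]
  set r₀ := min ε (min R R') with hr₀
  have hr₀p : 0 < r₀ := by positivity
  have hd : DifferentiableOn ℂ (f - g) (Metric.ball 0 r₀) :=
    (hf.mono (Metric.ball_subset_ball ((min_le_right _ _).trans (min_le_left _ _)))).sub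
      (hg.mono (Metric.ball_subset_ball ((min_le_right _ _).trans (min_le_right _ _))))
  have key : ∀ r : ℝ, 0 < r → r < min r₀ 1 → ‖taylorCoeff (f - g) j‖ ≤ B * (2 * 2 ^ j) * r := by
    intro r hr hrr
    have hb : ∀ z ∈ Metric.ball (0 : ℂ) r, ‖(f - g) z‖ ≤ B * r ^ (n + 1) := by
      intro z hz
      rw [mem_ball_zero_iff] at hz
      refine (hB z (hz.trans (hrr.trans_le ((min_le_left _ _).trans (min_le_left _ _))))).trans ?_
      gcongr
    have h := norm_taylorCoeff_le (hd.mono (Metric.ball_subset_ball (hrr.le.trans (min_le_left _ _))))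
      hb (r := r / 2) (by linarith) (by linarith) j
    refine h.trans ?_
    have hr1 : r ≤ 1 := hrr.le.trans (min_le_right _ _)
    have hpow : r ^ (n + 1) ≤ r ^ (j + 1) := pow_le_pow_of_le_one hr.le hr1 (by omega)
    rw [div_le_iff₀ (by positivity), div_pow]
    calc B * r ^ (n + 1) ≤ B * r ^ (j + 1) := by gcongr
      _ ≤ 2 * (B * r ^ (j + 1)) := by
          have : 0 ≤ B * r ^ (j + 1) := by positivity
          linarith
      _ = B * (2 * 2 ^ j) * r * (r ^ j / 2 ^ j) := by field_simp; ring
  have hlim : Tendsto (fun r : ℝ => B * (2 * 2 ^ j) * r) (𝓝[>] 0) (𝓝 0) := by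
    have : Tendsto (fun r : ℝ => B * (2 * 2 ^ j) * r) (𝓝 0) (𝓝 (B * (2 * 2 ^ j) * 0)) :=
      (continuous_const.mul continuous_id).tendsto 0
    rw [mul_zero] at this
    exact this.mono_left nhdsWithin_le_nhds
  refine ge_of_tendsto hlim ?_
  filter_upwards [Ioo_mem_nhdsGT (show (0 : ℝ) < min r₀ 1 by positivity)] with r hr
  exact key r hr.1 hr.2

set_option maxHeartbeats 2000000 in
/-- A function that is exponentially well approximated, at scale `h ≲ 1 / n`, by functions
holomorphic and bounded in discs of radius `≍ 1 / n` with coherent Taylor expansions is of the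
form `1 + h φ(h)` with `φ` a classical analytic symbol. -/
lemma exists_isCAS_of_approx {F : ℝ → ℂ} {G : ℕ → ℂ → ℂ} {c M h₀ : ℝ} (hc : 0 < c) (hc1 : c ≤ 1)
    (hM : 1 ≤ M) (h₀p : 0 < h₀)
    (hd : ∀ n : ℕ, DifferentiableOn ℂ (G n) (Metric.ball 0 (c / (n + 1))))
    (hb : ∀ n : ℕ, ∀ z ∈ Metric.ball (0 : ℂ) (c / (n + 1)), ‖G n z‖ ≤ M)
    (h1 : ∀ n, G n 0 = 1)
    (hdiff : ∀ n, ∃ B, ∃ ε > 0, ∀ z : ℂ, ‖z‖ < ε → ‖G (n + 1) z - G n z‖ ≤ B * ‖z‖ ^ (n + 1))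
    (happ : ∀ n : ℕ, ∀ h : ℝ, 0 < h → h < c / (n + 1) → h < h₀ →
      ‖F h - G n h‖ ≤ M * Real.exp (-n)) :
    ∃ φ : ℝ → ℂ, IsCAS φ ∧ ∃ h₁ > 0, ∀ h : ℝ, 0 < h → h < h₁ → F h = 1 + h * φ h := by
  have hcn : ∀ n : ℕ, 0 < c / ((n : ℝ) + 1) := fun n => by positivity
  have hcoef : ∀ j k : ℕ, taylorCoeff (G (j + k)) j = taylorCoeff (G j) j := by
    intro j k
    induction k with
    | zero => rfl
    | succ k ih =>
      obtain ⟨B, ε, hε, hB⟩ := hdiff (j + k)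
      rw [← ih]
      exact taylorCoeff_eq_of_norm_sub_le (hcn _) (hcn _) (hd (j + k + 1)) (hd (j + k)) hε
        (Nat.le_add_right j k) hB
  have hcoef' : ∀ j n : ℕ, j ≤ n → taylorCoeff (G n) j = taylorCoeff (G j) j := by
    intro j n hjn
    obtain ⟨k, rfl⟩ := Nat.exists_eq_add_of_le hjn
    exact hcoef j k
  set a : ℕ → ℂ := fun j => taylorCoeff (G (j + 1)) (j + 1) with ha
  set h₁ := min h₀ c with hh₁
  have hh₁p : 0 < h₁ := by positivity
  set φ : ℝ → ℂ := fun h => if h < h₁ then (F h - 1) / h else 0 with hφ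
  refine ⟨φ, ⟨0, a, (1 + M) * (12 / c), by positivity, ?_, ?_⟩, h₁, hh₁p, ?_⟩
  · intro j
    have h := norm_taylorCoeff_le (hd (j + 1)) (hb (j + 1)) (r := c / ((j + 1 : ℕ) + 1) / 2)
      (by positivity) (half_lt_self (hcn _)) (j + 1)
    refine h.trans ?_
    have e : c / (((j + 1 : ℕ) : ℝ) + 1) / 2 = (2 * (j + 2) / c)⁻¹ := by
      push_cast; field_simp; ring
    rw [e, inv_pow, div_inv_eq_mul]
    rcases Nat.eq_zero_or_pos j with rfl | hj
    · have : 0 ≤ (1 + M) * (12 / c) - M * (4 / c) := by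
        have : 0 ≤ 12 / c + 8 * (M / c) := by positivity
        calc (0 : ℝ) ≤ _ := this
          _ = _ := by ring
      norm_num
      linarith
    · have hj1 : (1 : ℝ) ≤ j := by exact_mod_cast hj
      have h2 : (j : ℝ) ≤ 2 ^ (j + 1) := by
        have : j < 2 ^ (j + 1) := (Nat.lt_two_pow_self).trans (Nat.pow_lt_pow_right (by norm_num) (by omega))
        exact_mod_cast this.le
      calc M * (2 * (j + 2) / c) ^ (j + 1) ≤ M * (2 * (3 * j) / c) ^ (j + 1) := by
            gcongr; linarith
        _ = M * (6 / c) ^ (j + 1) * j * (j : ℝ) ^ j := by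
            rw [show 2 * (3 * (j : ℝ)) / c = 6 / c * j by ring, mul_pow, pow_succ (j : ℝ)]; ring
        _ ≤ M * (6 / c) ^ (j + 1) * 2 ^ (j + 1) * (j : ℝ) ^ j := by gcongr
        _ = M * (12 / c) ^ (j + 1) * (j : ℝ) ^ j := by
            rw [show 12 / c = 6 / c * 2 by ring, mul_pow]; ring
        _ ≤ (1 + M) ^ (j + 1) * (12 / c) ^ (j + 1) * (j : ℝ) ^ j := by
            gcongr
            calc M ≤ 1 + M := by linarith
              _ = (1 + M) ^ 1 := (pow_one _).symm
              _ ≤ _ := pow_le_pow_right₀ (by linarith) (by omega)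
        _ = _ := by rw [mul_pow]
  · intro C₁ hC₁
    have he : 2 ≤ Real.exp 1 := by linarith [Real.add_one_le_exp 1]
    have hC12 : 12 / c ≤ C₁ := by
      refine le_trans ?_ hC₁.le
      have : 0 ≤ M * (12 / c) := by positivity
      linarith
    have hC₁p : 0 < C₁ := lt_of_lt_of_le (by positivity) hC12
    set D := Real.exp 1 * C₁ with hD
    have hDp : 0 < D := by positivity
    have hDc : 24 / c ≤ D := by
      calc 24 / c = 2 * (12 / c) := by ring
        _ ≤ _ := mul_le_mul he hC12 (by positivity) (by positivity)
    have hDc' : 24 ≤ D * c := by rwa [div_le_iff₀ hc] at hDc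
    set h₂ := min h₁ (c / 40) with hh₂
    have hh₂p : 0 < h₂ := by positivity
    have hφb : ∀ h : ℝ, h₂ ≤ h → ‖φ h‖ ≤ (2 * M + 1) / h₂ := by
      intro h hh
      simp only [hφ]
      split_ifs with hlt
      · have hp : 0 < h := hh₂p.trans_le hh
        have e1 := happ 0 h hp (by simpa using hlt.trans_le (min_le_right _ _))
          (hlt.trans_le (min_le_left _ _))
        have e2 := hb 0 h (by
          rw [mem_ball_zero_iff, Complex.norm_real, Real.norm_of_nonneg hp.le]
          simpa using hlt.trans_le (min_le_right _ _))
        simp only [Nat.cast_zero, neg_zero, Real.exp_zero, mul_one] at e1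
        rw [norm_div, Complex.norm_real, Real.norm_of_nonneg hp.le]
        gcongr
        calc ‖F h - 1‖ = ‖(F h - G 0 h) + G 0 h - 1‖ := by ring_nf
          _ ≤ ‖(F h - G 0 h) + G 0 h‖ + ‖(1 : ℂ)‖ := norm_sub_le _ _
          _ ≤ ‖F h - G 0 h‖ + ‖G 0 h‖ + 1 := by rw [norm_one]; gcongr; exact norm_add_le _ _
          _ ≤ _ := by linarith
      · rw [norm_zero]; positivity
    set K₁ := (2 * M + 1) / h₂ + ∑ j ∈ Finset.range (⌊1 / (h₂ * D)⌋₊ + 1), ‖a j‖ with hK₁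
    have hK₁p : 0 ≤ K₁ := by positivity
    refine ⟨1 / (2 * D), by positivity,
      K₁ * Real.exp (1 / (2 * D) / h₂) + (M * D + 8 * M / c), ?_⟩
    intro h hp hlt1
    set n := ⌊1 / (h * Real.exp 1 * C₁)⌋₊ with hn
    have hnD : n = ⌊1 / (h * D)⌋₊ := by rw [hn, hD, mul_assoc]
    have hQ : 0 ≤ M * D + 8 * M / c := by positivity
    simp only [zero_add]
    rcases le_or_gt h₂ h with hh | hh
    · have hnn : n ≤ ⌊1 / (h₂ * D)⌋₊ := by rw [hnD]; gcongr
      have hsum : ‖∑ j ∈ Finset.range (n + 1), a j * (h : ℂ) ^ j‖ ≤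
          ∑ j ∈ Finset.range (⌊1 / (h₂ * D)⌋₊ + 1), ‖a j‖ := by
        calc _ ≤ ∑ j ∈ Finset.range (n + 1), ‖a j‖ := by
              refine norm_sum_le_of_le _ fun j _ => ?_
              rw [norm_mul, norm_pow, Complex.norm_real, Real.norm_of_nonneg hp.le]
              exact mul_le_of_le_one_right (norm_nonneg _) (pow_le_one₀ hp.le hlt1.le)
          _ ≤ _ := Finset.sum_le_sum_of_subset_of_nonneg
              (Finset.range_subset_range.2 (by omega)) fun _ _ _ => norm_nonneg _
      calc _ ≤ ‖φ h‖ + ‖∑ j ∈ Finset.range (n + 1), a j * (h : ℂ) ^ j‖ := norm_sub_le _ _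
        _ ≤ K₁ := add_le_add (hφb h hh) hsum
        _ = K₁ * Real.exp (1 / (2 * D) / h₂) * Real.exp (-(1 / (2 * D) / h₂)) := by
            rw [mul_assoc, ← Real.exp_add]; simp
        _ ≤ K₁ * Real.exp (1 / (2 * D) / h₂) * Real.exp (-(1 / (2 * D)) / h) := by
            rw [neg_div]; gcongr
        _ ≤ _ := by gcongr; linarith
    · have hlt : h < h₁ := hh.trans_le (min_le_left _ _)
      have h40 : h < c / 40 := hh.trans_le (min_le_right _ _)
      set N := n + 1 with hN
      have hNlo : 1 / (h * D) < N := by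
        rw [hN, hnD]; push_cast; exact Nat.lt_floor_add_one _
      have hNhi : (N : ℝ) ≤ 1 / (h * D) + 1 := by
        rw [hN, hnD]; push_cast; gcongr; exact Nat.floor_le (by positivity)
      have hhN : h * (N + 1) ≤ c / 10 := by
        have : h * (1 / (h * D)) = 1 / D := by field_simp
        have h3 : 1 / D ≤ c / 24 := by
          rw [div_le_div_iff₀ hDp (by norm_num)]; linarith
        nlinarith
      have hN1 : (0 : ℝ) < N + 1 := by positivity
      set r := c / ((N : ℝ) + 1) / 2 with hr
      have hrp : 0 < r := by positivity
      have hhr : h / r ≤ 1 / 5 := by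
        rw [div_le_iff₀ hrp, hr]
        rw [div_div, ← mul_div_assoc, le_div_iff₀ (by positivity)]
        nlinarith
      have hnorm : ‖(h : ℂ)‖ = h := by rw [Complex.norm_real, Real.norm_of_nonneg hp.le]
      have T := norm_sub_taylor_le (hd N) (hb N) hrp (half_lt_self (hcn N)) (z := (h : ℂ))
        (by rw [hnorm]; rw [div_le_iff₀ hrp] at hhr; linarith) (N + 1)
      rw [hnorm, Finset.sum_range_succ'] at T
      have hc0 : taylorCoeff (G N) 0 = 1 := by simp [taylorCoeff, h1]
      have A := happ N h hp (by
        rw [lt_div_iff₀ hN1]; linarith) (hlt.trans_le (min_le_left _ _))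
      have hsumeq : ∑ j ∈ Finset.range N, taylorCoeff (G N) (j + 1) * (h : ℂ) ^ (j + 1)
          = h * ∑ j ∈ Finset.range N, a j * (h : ℂ) ^ j := by
        rw [Finset.mul_sum]
        refine Finset.sum_congr rfl fun j hj => ?_
        rw [hcoef' (j + 1) N (by have := Finset.mem_range.1 hj; omega), ha]; ring
      rw [hsumeq, hc0, pow_zero, mul_one] at T
      have hne : (h : ℂ) ≠ 0 := by exact_mod_cast hp.ne'
      have hφeq : φ h - ∑ j ∈ Finset.range N, a j * (h : ℂ) ^ j
          = ((F h - G N h) + (G N h - (h * ∑ j ∈ Finset.range N, a j * (h : ℂ) ^ j + 1))) / h := by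
        simp only [hφ, if_pos hlt]; field_simp; ring
      have hNe : Real.exp (-(N : ℝ)) * N ≤ Real.exp (-(N : ℝ) / 2) := by
        have h4 : (N : ℝ) ≤ Real.exp ((N : ℝ) / 2) := by
          have q := Real.quadratic_le_exp_of_nonneg (x := (N : ℝ) / 2) (by positivity)
          nlinarith [sq_nonneg ((N : ℝ) / 2 - 1)]
        calc _ ≤ Real.exp (-(N : ℝ)) * Real.exp ((N : ℝ) / 2) := by gcongr
          _ = _ := by rw [← Real.exp_add]; ring_nf
      have hexp : Real.exp (-(N : ℝ) / 2) ≤ Real.exp (-(1 / (2 * D)) / h) := by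
        rw [Real.exp_le_exp]
        have : 1 / (2 * D) / h = 1 / (h * D) / 2 := by field_simp
        rw [neg_div, neg_div, this]; linarith
      have hinv : 1 / h ≤ D * N := by
        rw [div_le_iff₀ hp]
        rw [div_lt_iff₀ (by positivity)] at hNlo
        nlinarith
      have hpow : (h / r) ^ N ≤ Real.exp (-(N : ℝ)) := by
        calc (h / r) ^ N ≤ (Real.exp (-1)) ^ N := by
              have : (1 : ℝ) / 5 ≤ Real.exp (-1) := by
                rw [Real.exp_neg, one_div]
                exact inv_anti₀ (Real.exp_pos 1) (by linarith [Real.exp_one_lt_d9])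
              gcongr; linarith
          _ = _ := by rw [← Real.exp_nat_mul]; ring_nf
      have h1r : (1 : ℝ) / r ≤ 4 / c * N := by
        have hNge : (1 : ℝ) ≤ N := by rw [hN]; push_cast; linarith [(Nat.cast_nonneg n : (0 : ℝ) ≤ n)]
        rw [hr, one_div, div_div, inv_div, div_mul_eq_mul_div, div_le_div_iff_of_pos_right hc]
        linarith
      rw [hφeq, norm_div, hnorm, div_eq_mul_one_div]
      calc _ ≤ (M * Real.exp (-N) + 2 * M * (h / r) ^ (N + 1)) * (1 / h) := by
            gcongr; exact norm_add_le_of_le A T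
        _ = M * Real.exp (-N) * (1 / h) + 2 * M * (h / r) ^ N * (1 / r) := by
            rw [pow_succ]; field_simp
        _ ≤ M * Real.exp (-N) * (D * N) + 2 * M * Real.exp (-N) * (4 / c * N) := by gcongr
        _ = (M * D + 8 * M / c) * (Real.exp (-N) * N) := by ring
        _ ≤ (M * D + 8 * M / c) * Real.exp (-(1 / (2 * D)) / h) := by
            gcongr; exact hNe.trans hexp
        _ ≤ _ := mul_le_mul_of_nonneg_right
            (le_add_of_nonneg_left (by positivity)) (Real.exp_pos _).le
  · intro h hp hlt
    have hne : (h : ℂ) ≠ 0 := by exact_mod_cast hp.ne'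
    simp only [hφ, if_pos hlt]; field_simp; ring

/-- The formal WKB iteration for the Riccati equation `r' = -(2ℓ/h) r - q + q r²`. -/
noncomputable def riccatiIter (ℓ q : ℂ → ℂ) : ℕ → ℂ × ℂ → ℂ
  | 0 => fun _ => 0
  | n + 1 => fun p => p.2 / (2 * ℓ p.1) * (-q p.1 + q p.1 * riccatiIter ℓ q n p ^ 2
      - fderiv ℂ (riccatiIter ℓ q n) p (1, 0))

lemma analyticOnNhd_riccatiIter {ℓ q : ℂ → ℂ} {U : Set ℂ} (hU : IsOpen U)
    (hℓ : DifferentiableOn ℂ ℓ U) (hq : DifferentiableOn ℂ q U) (h0 : ∀ x ∈ U, ℓ x ≠ 0) (n : ℕ) :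
    AnalyticOnNhd ℂ (riccatiIter ℓ q n) (U ×ˢ univ) := by
  induction n with
  | zero => exact analyticOnNhd_const
  | succ n ih =>
    have hfst : ∀ {f : ℂ → ℂ}, DifferentiableOn ℂ f U →
        AnalyticOnNhd ℂ (fun p : ℂ × ℂ => f p.1) (U ×ˢ univ) := fun hf p hp =>
      ((hf.analyticAt (hU.mem_nhds hp.1)).fun_comp analyticAt_fst)
    have h2 : AnalyticOnNhd ℂ (fun p : ℂ × ℂ => p.2) (U ×ˢ (univ : Set ℂ)) :=
      fun p _ => analyticAt_snd
    have hd : AnalyticOnNhd ℂ (fun p => fderiv ℂ (riccatiIter ℓ q n) p (1, 0))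
        (U ×ˢ (univ : Set ℂ)) := fun p hp =>
      ((ContinuousLinearMap.apply ℂ ℂ ((1, 0) : ℂ × ℂ)).analyticAt _).fun_comp (ih.fderiv p hp)
    exact ((h2.div (analyticOnNhd_const.mul (hfst hℓ)) fun p hp =>
      mul_ne_zero two_ne_zero (h0 _ hp.1))).mul
        (((hfst hq).neg.add ((hfst hq).mul (ih.pow 2))).sub hd)

lemma hasDerivAt_riccatiIter {ℓ q : ℂ → ℂ} {U : Set ℂ} (hU : IsOpen U)
    (hℓ : DifferentiableOn ℂ ℓ U) (hq : DifferentiableOn ℂ q U) (h0 : ∀ x ∈ U, ℓ x ≠ 0) (n : ℕ)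
    (h : ℂ) {x : ℂ} (hx : x ∈ U) :
    HasDerivAt (fun y => riccatiIter ℓ q n (y, h)) (fderiv ℂ (riccatiIter ℓ q n) (x, h) (1, 0)) x :=
  ((analyticOnNhd_riccatiIter hU hℓ hq h0 n (x, h) ⟨hx, trivial⟩).differentiableAt.hasFDerivAt).comp_hasDerivAt
    x ((hasDerivAt_id x).prodMk (hasDerivAt_const x h))

lemma hasDerivAt_riccatiIter_snd {ℓ q : ℂ → ℂ} {U : Set ℂ} (hU : IsOpen U)
    (hℓ : DifferentiableOn ℂ ℓ U) (hq : DifferentiableOn ℂ q U) (h0 : ∀ x ∈ U, ℓ x ≠ 0) (n : ℕ)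
    (h : ℂ) {x : ℂ} (hx : x ∈ U) :
    HasDerivAt (fun y => riccatiIter ℓ q n (x, y)) (fderiv ℂ (riccatiIter ℓ q n) (x, h) (0, 1)) h :=
  ((analyticOnNhd_riccatiIter hU hℓ hq h0 n (x, h) ⟨hx, trivial⟩).differentiableAt.hasFDerivAt).comp_hasDerivAt
    h ((hasDerivAt_const h x).prodMk (hasDerivAt_id h))

/-- Nested Cauchy estimates for the WKB iteration. -/
lemma riccatiIter_bounds {ℓ q : ℂ → ℂ} {U : Set ℂ} (hU : IsOpen U)
    (hℓ : DifferentiableOn ℂ ℓ U) (hq : DifferentiableOn ℂ q U) (h0 : ∀ x ∈ U, ℓ x ≠ 0)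
    {x₀ h : ℂ} {δ P w K : ℝ} (hδ : 0 < δ) (hP : 0 < P) (hw : 0 ≤ w)
    (hball : Metric.ball x₀ δ ⊆ U)
    (hPb : ∀ x ∈ Metric.ball x₀ δ, ‖(ℓ x)⁻¹‖ ≤ P) (hwb : ∀ x ∈ Metric.ball x₀ δ, ‖q x‖ ≤ w)
    (hK : P * (w ^ 2 + 1 / δ + 1) ≤ K) (N : ℕ) (hκ : ‖h‖ * K * (N + 2) ≤ 1 / 2) (n : ℕ)
    (hn : n ≤ N) :
    (∀ x ∈ Metric.ball x₀ (δ * (1 - n / (N + 2))), ‖riccatiIter ℓ q n (x, h)‖ ≤ w * (1 - (1 / 2) ^ n)) ∧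
    ∀ x ∈ Metric.ball x₀ (δ * (1 - (n + 1) / (N + 2))),
      ‖riccatiIter ℓ q (n + 1) (x, h) - riccatiIter ℓ q n (x, h)‖ ≤
        w * (‖h‖ * K * (N + 2)) ^ (n + 1) := by
  set κ := ‖h‖ * K * (N + 2) with hκd
  have hKp : 0 < K := lt_of_lt_of_le (by positivity) hK
  have hκ0 : 0 ≤ κ := by positivity
  have hN2 : (0 : ℝ) < N + 2 := by positivity
  have hPK : P ≤ K := by
    refine le_trans ?_ hK
    have : 0 ≤ P * (w ^ 2 + 1 / δ) := by positivity
    linarith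
  have hsub : ∀ k : ℝ, 0 ≤ k → Metric.ball x₀ (δ * (1 - k / (N + 2))) ⊆ Metric.ball x₀ δ := by
    intro k hk
    apply Metric.ball_subset_ball
    have : 0 ≤ δ * (k / (N + 2)) := by positivity
    linarith
  have hsubk : ∀ k k' : ℝ, k ≤ k' → Metric.ball x₀ (δ * (1 - k' / (N + 2))) ⊆
      Metric.ball x₀ (δ * (1 - k / (N + 2))) := by
    intro k k' hk
    apply Metric.ball_subset_ball
    gcongr
  have hpre : ∀ x ∈ Metric.ball x₀ δ, ‖h / (2 * ℓ x)‖ ≤ ‖h‖ * P / 2 := by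
    intro x hx
    rw [div_eq_mul_inv, mul_inv, norm_mul, norm_mul, norm_inv, RCLike.norm_two]
    calc ‖h‖ * (2⁻¹ * ‖(ℓ x)⁻¹‖) ≤ ‖h‖ * (2⁻¹ * P) := by gcongr; exact hPb x hx
      _ = _ := by ring
  induction n with
  | zero =>
    refine ⟨fun x _ => by simp [riccatiIter], fun x hx => ?_⟩
    have hx' := hsub _ (by positivity) hx
    simp only [riccatiIter, fderiv_const_apply, zero_apply, sub_zero]
    rw [norm_mul]
    calc _ ≤ ‖h‖ * P / 2 * w := by
          refine mul_le_mul (hpre x hx') ?_ (norm_nonneg _) (by positivity)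
          simpa using hwb x hx'
      _ ≤ w * (‖h‖ * K * 2) := by
          have : ‖h‖ * P * w ≤ ‖h‖ * K * w := by gcongr
          have h2 : 0 ≤ ‖h‖ * K * w := by positivity
          linarith
      _ ≤ _ := by
          rw [zero_add, pow_one, hκd]
          gcongr
          linarith [(Nat.cast_nonneg N : (0 : ℝ) ≤ N)]
  | succ n ih =>
    obtain ⟨ih1, ih2⟩ := ih (by omega)
    have hb : ∀ x ∈ Metric.ball x₀ (δ * (1 - ((n + 1 : ℕ) : ℝ) / (N + 2))),
        ‖riccatiIter ℓ q (n + 1) (x, h)‖ ≤ w * (1 - (1 / 2) ^ (n + 1)) := by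
      intro x hx
      have e1 := ih1 x (hsubk _ _ (by push_cast; linarith) hx)
      have e2 := ih2 x (by push_cast at hx; exact hx)
      have e3 : κ ^ (n + 1) ≤ (1 / 2) ^ (n + 1) := by gcongr
      calc _ = ‖(riccatiIter ℓ q (n + 1) (x, h) - riccatiIter ℓ q n (x, h))
              + riccatiIter ℓ q n (x, h)‖ := by rw [sub_add_cancel]
        _ ≤ w * κ ^ (n + 1) + w * (1 - (1 / 2) ^ n) := norm_add_le_of_le e2 e1
        _ ≤ w * (1 / 2) ^ (n + 1) + w * (1 - (1 / 2) ^ n) := by gcongr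
        _ = _ := by rw [pow_succ]; ring
    refine ⟨hb, fun x hx => ?_⟩
    have hx0 := hsub _ (by positivity) hx
    have hx1 := hsubk ((n : ℝ) + 1) _ (by push_cast; linarith) hx
    have hx2 := hsubk (n : ℝ) _ (by linarith) hx1
    set f := riccatiIter ℓ q (n + 1) with hf
    set g := riccatiIter ℓ q n with hg
    have hfx : ‖f (x, h)‖ ≤ w := by
      refine (hb x (by push_cast; exact hx1)).trans (mul_le_of_le_one_right hw ?_)
      linarith [show (0 : ℝ) < (1 / 2) ^ (n + 1) by positivity]
    have hgx : ‖g (x, h)‖ ≤ w := by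
      refine (ih1 x hx2).trans (mul_le_of_le_one_right hw ?_)
      linarith [show (0 : ℝ) < (1 / 2) ^ n by positivity]
    have hder : ∀ y ∈ Metric.ball x₀ δ, HasDerivAt (fun y => f (y, h) - g (y, h))
        (fderiv ℂ f (y, h) (1, 0) - fderiv ℂ g (y, h) (1, 0)) y := fun y hy =>
      (hasDerivAt_riccatiIter hU hℓ hq h0 (n + 1) h (hball hy)).sub
        (hasDerivAt_riccatiIter hU hℓ hq h0 n h (hball hy))
    have hcl : Metric.closedBall x (δ / (2 * (N + 2))) ⊆
        Metric.ball x₀ (δ * (1 - ((n : ℝ) + 1) / (N + 2))) := by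
      intro y hy
      rw [Metric.mem_closedBall] at hy
      rw [Metric.mem_ball] at hx ⊢
      have e : δ * (1 - ((n : ℝ) + 1) / (N + 2)) =
          δ * (1 - (((n + 1 : ℕ) : ℝ) + 1) / (N + 2)) + 2 * (δ / (2 * (N + 2))) := by
        push_cast; field_simp; ring
      have e' : 0 < δ / (2 * ((N : ℝ) + 2)) := by positivity
      linarith [dist_triangle y x x₀]
    have hDd : ‖fderiv ℂ f (x, h) (1, 0) - fderiv ℂ g (x, h) (1, 0)‖ ≤
        w * κ ^ (n + 1) / (δ / (2 * (N + 2))) := by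
      rw [← (hder x hx0).deriv]
      refine norm_deriv_le_of_forall_mem_sphere_norm_le (by positivity) ?_ fun z hz =>
        ih2 z (hcl (Metric.sphere_subset_closedBall hz))
      refine DifferentiableOn.diffContOnCl_ball (U := Metric.ball x₀ δ) (fun y hy =>
        (hder y hy).differentiableAt.differentiableWithinAt) (hcl.trans (hsub _ (by positivity)))
    have heq : riccatiIter ℓ q (n + 1 + 1) (x, h) - f (x, h) = h / (2 * ℓ x) *
        (q x * (f (x, h) + g (x, h)) * (f (x, h) - g (x, h))
          - (fderiv ℂ f (x, h) (1, 0) - fderiv ℂ g (x, h) (1, 0))) := by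
      have e1 : riccatiIter ℓ q (n + 1 + 1) (x, h) = h / (2 * ℓ x) *
        (-q x + q x * f (x, h) ^ 2 - fderiv ℂ f (x, h) (1, 0)) := rfl
      have e2 : f (x, h) = h / (2 * ℓ x) *
        (-q x + q x * g (x, h) ^ 2 - fderiv ℂ g (x, h) (1, 0)) := rfl
      rw [e1]
      nth_rw 2 [e2]
      ring
    rw [heq, norm_mul]
    calc _ ≤ ‖h‖ * P / 2 * (w * (w + w) * (w * κ ^ (n + 1)) +
          w * κ ^ (n + 1) / (δ / (2 * (N + 2)))) := by
          refine mul_le_mul (hpre x hx0) ?_ (norm_nonneg _) (by positivity)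
          refine (norm_sub_le _ _).trans (add_le_add ?_ hDd)
          rw [norm_mul, norm_mul]
          gcongr
          · exact hwb x hx0
          · exact norm_add_le_of_le hfx hgx
          · exact ih2 x hx1
      _ = ‖h‖ * (P * (w ^ 2 + 1 / δ * (N + 2))) * (w * κ ^ (n + 1)) := by field_simp; ring
      _ ≤ ‖h‖ * (P * ((w ^ 2 + 1 / δ + 1) * (N + 2))) * (w * κ ^ (n + 1)) := by
          gcongr
          have : w ^ 2 ≤ w ^ 2 * (N + 2) := le_mul_of_one_le_right (by positivity)
            (by linarith [(Nat.cast_nonneg N : (0 : ℝ) ≤ N)])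
          linarith
      _ = ‖h‖ * (P * (w ^ 2 + 1 / δ + 1)) * (N + 2) * (w * κ ^ (n + 1)) := by ring
      _ ≤ ‖h‖ * K * (N + 2) * (w * κ ^ (n + 1)) := by gcongr
      _ = _ := by rw [← hκd, pow_succ κ (n + 1)]; ring

/-- The integrable weight `⟨s⟩⁻²`. -/
noncomputable def wt (s : ℝ) : ℝ := (1 + s ^ 2)⁻¹

lemma wt_pos (s : ℝ) : 0 < wt s := by unfold wt; positivity

lemma wt_le_one (s : ℝ) : wt s ≤ 1 := inv_le_one_of_one_le₀ (by nlinarith [sq_nonneg s])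

lemma continuous_wt : Continuous wt :=
  Continuous.inv₀ (by fun_prop) fun s => by positivity

lemma integrable_wt : Integrable wt := integrable_inv_one_add_sq

lemma integral_wt : ∫ s, wt s = Real.pi := integral_univ_inv_one_add_sq

lemma hasDerivAt_arctan_wt (s : ℝ) : HasDerivAt Real.arctan (wt s) s := by
  simpa [wt, one_div] using Real.hasDerivAt_arctan s

lemma tendsto_wt_atBot : Tendsto wt atBot (𝓝 0) := by
  refine Tendsto.inv_tendsto_atTop (tendsto_atTop_add_const_left _ _ ?_)
  exact (tendsto_pow_atTop two_ne_zero).comp tendsto_abs_atBot_atTop |>.congr fun x => by simp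

/-- Complex path along which the diagonalized transport system is dissipative. -/
structure TransportPath (U : Set ℂ) (ℓ q : ℂ → ℂ) (γ γ' : ℝ → ℂ) (δ C : ℝ) : Prop where
  isOpen : IsOpen U
  δ_pos : 0 < δ
  one_le : 1 ≤ C
  ball_subset : ∀ s, Metric.ball (γ s) δ ⊆ U
  hasDerivAt : ∀ s, HasDerivAt γ (γ' s) s
  cont : Continuous γ'
  diff_ℓ : DifferentiableOn ℂ ℓ U
  diff_q : DifferentiableOn ℂ q U
  ne : ∀ x ∈ U, ℓ x ≠ 0
  inv_le : ∀ s, ∀ x ∈ Metric.ball (γ s) δ, ‖(ℓ x)⁻¹‖ ≤ C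
  le : ∀ s, ‖ℓ (γ s)‖ ≤ C
  q_le : ∀ s, ∀ x ∈ Metric.ball (γ s) δ, ‖q x‖ ≤ C * wt s
  deriv_le : ∀ s, ‖γ' s‖ ≤ C
  re_nonneg : ∀ s, 0 ≤ (ℓ (γ s) * γ' s).re

/-- Grönwall's inequality with integrable rate `wt`. -/
lemma gronwall_wt {y y' : ℝ → ℝ} {C e y₀ : ℝ} (hy : ∀ s, HasDerivAt y (y' s) s)
    (hb : ∀ s, y' s ≤ C * wt s * (y s + e)) (hlim : Tendsto y atBot (𝓝 y₀)) (s : ℝ) :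
    y s + e ≤ (y₀ + e) * Real.exp (C * (Real.arctan s + Real.pi / 2)) := by
  set z : ℝ → ℝ := fun s => (y s + e) * Real.exp (-(C * Real.arctan s)) with hz
  have hder : ∀ s, HasDerivAt z ((y' s - C * wt s * (y s + e)) * Real.exp (-(C * Real.arctan s))) s := by
    intro s
    have h1 := ((hy s).add_const e).mul (((hasDerivAt_arctan_wt s).const_mul C).neg.exp)
    refine h1.congr_deriv ?_
    simp only [Pi.neg_apply]
    ring
  have hanti : Antitone z := antitone_of_hasDerivAt_nonpos hder fun s =>
    mul_nonpos_of_nonpos_of_nonneg (by linarith [hb s]) (Real.exp_pos _).le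
  have hl : Tendsto z atBot (𝓝 ((y₀ + e) * Real.exp (-(C * -(Real.pi / 2))))) := by
    have h1 : Tendsto Real.arctan atBot (𝓝 (-(Real.pi / 2))) :=
      tendsto_nhds_of_tendsto_nhdsWithin Real.tendsto_arctan_atBot
    exact (hlim.add_const e).mul ((Real.continuous_exp.tendsto _).comp (h1.const_mul C).neg)
  have hle : z s ≤ (y₀ + e) * Real.exp (-(C * -(Real.pi / 2))) := by
    refine ge_of_tendsto hl ?_
    filter_upwards [eventually_le_atBot s] with t ht using hanti ht
  calc y s + e = z s * Real.exp (C * Real.arctan s) := by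
        rw [hz]; simp only; rw [mul_assoc, ← Real.exp_add]; simp
    _ ≤ (y₀ + e) * Real.exp (-(C * -(Real.pi / 2))) * Real.exp (C * Real.arctan s) := by gcongr
    _ = _ := by rw [mul_assoc, ← Real.exp_add]; ring_nf

/-- Energy bound for the dissipative transport system with integrable coupling and source. -/
lemma transport_energy_le {D₁ D₂ Q lam e : ℝ → ℂ} {C η : ℝ} (hC : 0 ≤ C)
    (h1 : ∀ s, HasDerivAt D₁ (-(Q s * D₂ s)) s)
    (h2 : ∀ s, HasDerivAt D₂ (-(lam s * D₂ s) - Q s * D₁ s - e s) s)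
    (hlam : ∀ s, 0 ≤ (lam s).re) (hQ : ∀ s, ‖Q s‖ ≤ C * wt s) (he : ∀ s, ‖e s‖ ≤ C * wt s * η)
    {d₁ d₂ : ℂ} (hl1 : Tendsto D₁ atBot (𝓝 d₁)) (hl2 : Tendsto D₂ atBot (𝓝 d₂)) (s : ℝ) :
    ‖D₁ s‖ ^ 2 + ‖D₂ s‖ ^ 2 ≤
      (‖d₁‖ ^ 2 + ‖d₂‖ ^ 2 + η ^ 2) * Real.exp (3 * C * Real.pi) := by
  set y : ℝ → ℝ := fun s => ‖D₁ s‖ ^ 2 + ‖D₂ s‖ ^ 2 with hy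
  have hder : ∀ s, HasDerivAt y (2 * inner ℝ (D₁ s) (-(Q s * D₂ s)) +
      2 * inner ℝ (D₂ s) (-(lam s * D₂ s) - Q s * D₁ s - e s)) s := fun s =>
    (h1 s).norm_sq.add (h2 s).norm_sq
  have hb : ∀ s, 2 * inner ℝ (D₁ s) (-(Q s * D₂ s)) +
      2 * inner ℝ (D₂ s) (-(lam s * D₂ s) - Q s * D₁ s - e s) ≤ 3 * C * wt s * (y s + η ^ 2) := by
    intro s
    have i1 : inner ℝ (D₁ s) (-(Q s * D₂ s)) ≤ ‖D₁ s‖ * (C * wt s * ‖D₂ s‖) := by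
      refine (real_inner_le_norm _ _).trans ?_
      rw [norm_neg, norm_mul]
      gcongr
      exact hQ s
    have i2 : inner ℝ (D₂ s) (-(Q s * D₁ s)) ≤ ‖D₂ s‖ * (C * wt s * ‖D₁ s‖) := by
      refine (real_inner_le_norm _ _).trans ?_
      rw [norm_neg, norm_mul]
      gcongr
      exact hQ s
    have i3 : inner ℝ (D₂ s) (-e s) ≤ ‖D₂ s‖ * (C * wt s * η) := by
      refine (real_inner_le_norm _ _).trans ?_
      rw [norm_neg]
      gcongr
      exact he s
    have i4 : inner ℝ (D₂ s) (-(lam s * D₂ s)) ≤ 0 := by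
      rw [Complex.inner, neg_mul, mul_assoc, neg_re, Complex.mul_conj, Complex.re_mul_ofReal]
      have := mul_nonneg (hlam s) (Complex.normSq_nonneg (D₂ s))
      linarith
    have e0 : inner ℝ (D₂ s) (-(lam s * D₂ s) - Q s * D₁ s - e s) =
        inner ℝ (D₂ s) (-(lam s * D₂ s)) + inner ℝ (D₂ s) (-(Q s * D₁ s))
          + inner ℝ (D₂ s) (-e s) := by
      rw [← inner_add_right, ← inner_add_right, sub_eq_add_neg, sub_eq_add_neg]
    rw [e0]
    have hw : 0 ≤ C * wt s := mul_nonneg hC (wt_pos s).le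
    have a1 : 2 * (‖D₁ s‖ * ‖D₂ s‖) ≤ y s := by
      simp only [hy]; nlinarith [sq_nonneg (‖D₁ s‖ - ‖D₂ s‖)]
    have a2 : 2 * (‖D₂ s‖ * η) ≤ y s + η ^ 2 := by
      simp only [hy]; nlinarith [sq_nonneg (‖D₂ s‖ - η), sq_nonneg ‖D₁ s‖]
    nlinarith [mul_le_mul_of_nonneg_left a1 hw, mul_le_mul_of_nonneg_left a2 hw,
      mul_nonneg hw (sq_nonneg η)]
  have hlim : Tendsto y atBot (𝓝 (‖d₁‖ ^ 2 + ‖d₂‖ ^ 2)) :=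
    (hl1.norm.pow 2).add (hl2.norm.pow 2)
  have := gronwall_wt (C := 3 * C) hder hb hlim s
  refine (le_add_of_nonneg_right (sq_nonneg η)).trans (this.trans ?_)
  gcongr
  linarith [Real.arctan_lt_pi_div_two s]

namespace TransportPath

variable {U : Set ℂ} {ℓ q : ℂ → ℂ} {γ γ' : ℝ → ℂ} {δ C : ℝ}

/-- The rate constant of the WKB iteration. -/
noncomputable def rate (δ C : ℝ) : ℝ := C * (C ^ 2 + 1 / δ + 1)

/-- The radius constant of the domain of the WKB iteration in the semiclassical parameter. -/
noncomputable def radius (δ C : ℝ) : ℝ := min 1 (Real.exp (-2) / (2 * rate δ C))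

lemma rate_pos (H : TransportPath U ℓ q γ γ' δ C) : 0 < rate δ C := by
  have := H.δ_pos
  have : 0 < C := by linarith [H.one_le]
  unfold rate; positivity

lemma radius_pos (H : TransportPath U ℓ q γ γ' δ C) : 0 < radius δ C := by
  have := H.rate_pos
  unfold radius; positivity

lemma rate_mul_le (H : TransportPath U ℓ q γ γ' δ C) {n : ℕ} {h : ℂ}
    (hh : ‖h‖ < radius δ C / (n + 1)) : ‖h‖ * rate δ C * (n + 2) ≤ Real.exp (-2) := by
  have hK := H.rate_pos
  have h1 : ‖h‖ * (n + 1) ≤ Real.exp (-2) / (2 * rate δ C) :=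
    ((lt_div_iff₀ (by positivity)).1 hh).le.trans (min_le_right _ _)
  rw [le_div_iff₀ (by positivity)] at h1
  refine le_trans ?_ h1
  have h2 : (n : ℝ) + 2 ≤ (n + 1) * 2 := by linarith [(Nat.cast_nonneg n : (0 : ℝ) ≤ n)]
  calc _ ≤ ‖h‖ * rate δ C * ((n + 1) * 2) := by gcongr
    _ = _ := by ring

lemma mem (H : TransportPath U ℓ q γ γ' δ C) (s : ℝ) : γ s ∈ U :=
  H.ball_subset s (Metric.mem_ball_self H.δ_pos)

lemma exp_neg_two_le : Real.exp (-2) ≤ 1 / 2 := by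
  rw [Real.exp_neg, one_div]
  exact inv_anti₀ (by norm_num) (by linarith [Real.add_one_le_exp 2])

lemma iter_bounds (H : TransportPath U ℓ q γ γ' δ C) {n : ℕ} {h : ℂ}
    (hh : ‖h‖ < radius δ C / (n + 1)) (s : ℝ) :
    ‖riccatiIter ℓ q n (γ s, h)‖ ≤ C * wt s ∧
    ‖riccatiIter ℓ q (n + 1) (γ s, h) - riccatiIter ℓ q n (γ s, h)‖ ≤
      C * wt s * (‖h‖ * rate δ C * (n + 2)) ^ (n + 1) := by
  have hC : 0 < C := by linarith [H.one_le]
  have hw := (wt_pos s).le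
  have hδ := H.δ_pos
  have hN : (0 : ℝ) < n + 2 := by positivity
  obtain ⟨h1, h2⟩ := riccatiIter_bounds H.isOpen H.diff_ℓ H.diff_q H.ne (x₀ := γ s) (h := h)
    (w := C * wt s) (K := rate δ C) H.δ_pos hC (by positivity) (H.ball_subset s) (H.inv_le s)
    (H.q_le s)
    (by
      unfold rate
      gcongr
      exact mul_le_of_le_one_right hC.le (wt_le_one s))
    n ((H.rate_mul_le hh).trans exp_neg_two_le) n le_rfl
  refine ⟨(h1 _ (Metric.mem_ball_self ?_)).trans (mul_le_of_le_one_right (by positivity) ?_),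
    h2 _ (Metric.mem_ball_self ?_)⟩
  · have : (n : ℝ) / (n + 2) < 1 := by rw [div_lt_one hN]; linarith
    exact mul_pos hδ (by linarith)
  · linarith [show (0 : ℝ) < (1 / 2) ^ n by positivity]
  · have : ((n : ℝ) + 1) / (n + 2) < 1 := by rw [div_lt_one hN]; linarith
    exact mul_pos hδ (by linarith)

/-- The logarithmic derivative of the approximate amplitude. -/
noncomputable def logAmp (ℓ q : ℂ → ℂ) (γ γ' : ℝ → ℂ) (n : ℕ) (h : ℂ) (s : ℝ) : ℂ :=
  q (γ s) * γ' s * riccatiIter ℓ q n (γ s, h)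

lemma norm_coupling_le (H : TransportPath U ℓ q γ γ' δ C) (s : ℝ) :
    ‖q (γ s) * γ' s‖ ≤ C ^ 2 * wt s := by
  have hC : 0 < C := by linarith [H.one_le]
  have hw := (wt_pos s).le
  rw [norm_mul]
  calc _ ≤ C * wt s * C := mul_le_mul (H.q_le s _ (Metric.mem_ball_self H.δ_pos)) (H.deriv_le s)
        (norm_nonneg _) (by positivity)
    _ = _ := by ring

lemma norm_logAmp_le (H : TransportPath U ℓ q γ γ' δ C) {n : ℕ} {h : ℂ}
    (hh : ‖h‖ < radius δ C / (n + 1)) (s : ℝ) :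
    ‖logAmp ℓ q γ γ' n h s‖ ≤ C ^ 3 * wt s := by
  have hC : 0 < C := by linarith [H.one_le]
  have hw := (wt_pos s).le
  rw [logAmp, norm_mul]
  calc _ ≤ C ^ 2 * wt s * (C * wt s) := mul_le_mul (H.norm_coupling_le s) (H.iter_bounds hh s).1
        (norm_nonneg _) (by positivity)
    _ ≤ C ^ 2 * wt s * (C * 1) := by gcongr; exact wt_le_one s
    _ = _ := by ring

lemma continuous_path (H : TransportPath U ℓ q γ γ' δ C) : Continuous γ :=
  continuous_iff_continuousAt.2 fun s => (H.hasDerivAt s).continuousAt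

lemma continuous_coupling (H : TransportPath U ℓ q γ γ' δ C) :
    Continuous fun s => q (γ s) * γ' s :=
  (H.diff_q.continuousOn.comp_continuous H.continuous_path H.mem).mul H.cont

lemma continuous_logAmp (H : TransportPath U ℓ q γ γ' δ C) (n : ℕ) (h : ℂ) :
    Continuous (logAmp ℓ q γ γ' n h) := by
  have hr := (analyticOnNhd_riccatiIter H.isOpen H.diff_ℓ H.diff_q H.ne n).continuousOn
  exact H.continuous_coupling.mul (hr.comp_continuous
    (H.continuous_path.prodMk continuous_const) fun s => ⟨H.mem s, trivial⟩)

lemma integrable_logAmp (H : TransportPath U ℓ q γ γ' δ C) {n : ℕ} {h : ℂ}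
    (hh : ‖h‖ < radius δ C / (n + 1)) : Integrable (logAmp ℓ q γ γ' n h) :=
  (integrable_wt.const_mul (C ^ 3)).mono' (H.continuous_logAmp n h).aestronglyMeasurable
    (Eventually.of_forall (H.norm_logAmp_le hh))

/-- The approximate transfer amplitude produced by `n` steps of the WKB iteration. -/
noncomputable def approxAmp (ℓ q : ℂ → ℂ) (γ γ' : ℝ → ℂ) (n : ℕ) (h : ℂ) : ℂ :=
  Complex.exp (-∫ s, logAmp ℓ q γ γ' n h s)

lemma norm_integral_logAmp_le (H : TransportPath U ℓ q γ γ' δ C) {n : ℕ} {h : ℂ}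
    (hh : ‖h‖ < radius δ C / (n + 1)) : ‖∫ s, logAmp ℓ q γ γ' n h s‖ ≤ C ^ 3 * Real.pi := by
  have := norm_integral_le_of_norm_le (integrable_wt.const_mul (C ^ 3))
    (Eventually.of_forall (H.norm_logAmp_le hh))
  rwa [integral_const_mul, integral_wt] at this

lemma norm_approxAmp_le (H : TransportPath U ℓ q γ γ' δ C) {n : ℕ} {h : ℂ}
    (hh : ‖h‖ < radius δ C / (n + 1)) :
    ‖approxAmp ℓ q γ γ' n h‖ ≤ Real.exp (C ^ 3 * Real.pi) := by
  refine (Complex.norm_exp_le_exp_norm _).trans ?_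
  rw [norm_neg]
  exact Real.exp_le_exp.2 (H.norm_integral_logAmp_le hh)

lemma differentiableOn_approxAmp (H : TransportPath U ℓ q γ γ' δ C) (n : ℕ) :
    DifferentiableOn ℂ (approxAmp ℓ q γ γ' n) (Metric.ball 0 (radius δ C / (n + 1))) := by
  set R := radius δ C / (n + 1)
  have hR : 0 < R := div_pos H.radius_pos (by positivity)
  intro h hh
  rw [mem_ball_zero_iff] at hh
  set ρ := (R - ‖h‖) / 2 with hρ
  have hρp : 0 < ρ := by rw [hρ]; linarith
  have hr := analyticOnNhd_riccatiIter H.isOpen H.diff_ℓ H.diff_q H.ne n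
  have hder : ∀ s z, HasDerivAt (fun z => logAmp ℓ q γ γ' n z s)
      (q (γ s) * γ' s * fderiv ℂ (riccatiIter ℓ q n) (γ s, z) (0, 1)) z := fun s z =>
    (hasDerivAt_riccatiIter_snd H.isOpen H.diff_ℓ H.diff_q H.ne n z (H.mem s)).const_mul _
  have key := hasDerivAt_integral_of_dominated_loc_of_deriv_le
    (F := fun z s => logAmp ℓ q γ γ' n z s) (μ := volume) (x₀ := h) (s := Metric.ball h ρ)
    (F' := fun z s => q (γ s) * γ' s * fderiv ℂ (riccatiIter ℓ q n) (γ s, z) (0, 1))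
    (bound := fun s => C ^ 3 * wt s / ρ) (Metric.ball_mem_nhds h hρp)
    (Eventually.of_forall fun z => (H.continuous_logAmp n z).aestronglyMeasurable)
    (H.integrable_logAmp hh)
    (by
      refine (H.continuous_coupling.mul ?_).aestronglyMeasurable
      have : Continuous fun s => fderiv ℂ (riccatiIter ℓ q n) (γ s, h) :=
        hr.fderiv.continuousOn.comp_continuous
          (H.continuous_path.prodMk continuous_const) fun s => ⟨H.mem s, trivial⟩
      exact this.clm_apply continuous_const)
    (Eventually.of_forall fun s z hz => by
      rw [← (hder s z).deriv]
      refine norm_deriv_le_of_forall_mem_sphere_norm_le hρp ?_ fun y hy => H.norm_logAmp_le ?_ s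
      · exact Differentiable.diffContOnCl fun y => (hder s y).differentiableAt
      · rw [mem_sphere_iff_norm] at hy
        rw [mem_ball_iff_norm] at hz
        have e : y = (y - z) + (z - h) + h := by ring
        rw [e]
        refine (norm_add₃_le).trans_lt ?_
        rw [hy]
        change _ < R
        linarith)
    ((integrable_wt.const_mul _).div_const _)
    (Eventually.of_forall fun s z _ => hder s z)
  exact key.2.neg.cexp.differentiableAt.differentiableWithinAt

lemma approxAmp_zero (n : ℕ) : approxAmp ℓ q γ γ' n 0 = 1 := by
  have : ∀ x, riccatiIter ℓ q n (x, 0) = 0 := fun x => by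
    cases n with
    | zero => rfl
    | succ n => simp [riccatiIter]
  simp [approxAmp, logAmp, this]

lemma norm_approxAmp_succ_sub_le (H : TransportPath U ℓ q γ γ' δ C) (n : ℕ) :
    ∃ B, ∃ ε > 0, ∀ z : ℂ, ‖z‖ < ε →
      ‖approxAmp ℓ q γ γ' (n + 1) z - approxAmp ℓ q γ γ' n z‖ ≤ B * ‖z‖ ^ (n + 1) := by
  have hC : 0 < C := by linarith [H.one_le]
  have hR := H.radius_pos
  have hK := H.rate_pos
  set A := C ^ 3 * Real.pi * (rate δ C * (n + 2)) ^ (n + 1) with hA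
  have hAp : 0 < A := by have := Real.pi_pos; positivity
  refine ⟨Real.exp (C ^ 3 * Real.pi) * (2 * A), min (radius δ C / ((n + 1 : ℕ) + 1)) (min 1 A⁻¹),
    by positivity, fun z hz => ?_⟩
  have hz1 := hz.trans_le (min_le_left _ _)
  have hz1' : ‖z‖ < radius δ C / (n + 1) := hz1.trans_le (by push_cast; gcongr; linarith)
  have hz2 : ‖z‖ < 1 := hz.trans_le ((min_le_right _ _).trans (min_le_left _ _))
  have hz3 : ‖z‖ < A⁻¹ := hz.trans_le ((min_le_right _ _).trans (min_le_right _ _))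
  set I₁ := ∫ s, logAmp ℓ q γ γ' (n + 1) z s with hI₁
  set I₀ := ∫ s, logAmp ℓ q γ γ' n z s with hI₀
  have hdiff : ‖I₁ - I₀‖ ≤ A * ‖z‖ ^ (n + 1) := by
    rw [hI₁, hI₀, ← integral_sub (H.integrable_logAmp hz1) (H.integrable_logAmp hz1')]
    have := norm_integral_le_of_norm_le
      (integrable_wt.const_mul (C ^ 3 * (‖z‖ * rate δ C * (n + 2)) ^ (n + 1)))
      (f := fun s => logAmp ℓ q γ γ' (n + 1) z s - logAmp ℓ q γ γ' n z s)
      (Eventually.of_forall fun s => by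
        have hw := (wt_pos s).le
        rw [logAmp, logAmp, ← mul_sub, norm_mul]
        calc _ ≤ C ^ 2 * wt s * (C * wt s * (‖z‖ * rate δ C * (n + 2)) ^ (n + 1)) :=
              mul_le_mul (H.norm_coupling_le s) (H.iter_bounds hz1' s).2 (norm_nonneg _)
                (by positivity)
          _ ≤ C ^ 2 * wt s * (C * 1 * (‖z‖ * rate δ C * (n + 2)) ^ (n + 1)) := by
              gcongr; exact wt_le_one s
          _ = _ := by ring)
    rw [integral_const_mul, integral_wt] at this
    refine this.trans (le_of_eq ?_)
    rw [hA, mul_assoc ‖z‖, mul_pow ‖z‖]; ring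
  have hsmall : ‖-(I₁ - I₀)‖ ≤ 1 := by
    rw [norm_neg]
    refine hdiff.trans ?_
    calc A * ‖z‖ ^ (n + 1) ≤ A * ‖z‖ ^ 1 := by
          have := pow_le_pow_of_le_one (norm_nonneg z) hz2.le (show 1 ≤ n + 1 by omega)
          gcongr
      _ ≤ A * A⁻¹ := by rw [pow_one]; gcongr
      _ = 1 := mul_inv_cancel₀ hAp.ne'
  have e : approxAmp ℓ q γ γ' (n + 1) z - approxAmp ℓ q γ γ' n z =
      approxAmp ℓ q γ γ' n z * (Complex.exp (-(I₁ - I₀)) - 1) := by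
    rw [approxAmp, approxAmp, mul_sub, ← Complex.exp_add, mul_one]
    congr 2
    ring
  rw [e, norm_mul]
  calc _ ≤ Real.exp (C ^ 3 * Real.pi) * (2 * ‖-(I₁ - I₀)‖) := by
        gcongr
        · exact H.norm_approxAmp_le hz1'
        · exact Complex.norm_exp_sub_one_le hsmall
    _ ≤ Real.exp (C ^ 3 * Real.pi) * (2 * (A * ‖z‖ ^ (n + 1))) := by rw [norm_neg]; gcongr
    _ = _ := by ring

end TransportPath

/-- Solutions of the rescaled transport system along a path, normalized at `-∞`. -/
structure TransportSolution (ℓ q : ℂ → ℂ) (γ γ' : ℝ → ℂ) (h : ℝ) (F : ℂ) (w₁ w₂ : ℝ → ℂ) :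
    Prop where
  hasDerivAt₁ : ∀ s, HasDerivAt w₁ (-(q (γ s) * γ' s * w₂ s)) s
  hasDerivAt₂ : ∀ s, HasDerivAt w₂
    (-(2 / h * (ℓ (γ s) * γ' s) * w₂ s) - q (γ s) * γ' s * w₁ s) s
  tendsto_atBot₁ : Tendsto w₁ atBot (𝓝 1)
  tendsto_atBot₂ : Tendsto w₂ atBot (𝓝 0)
  tendsto_atTop : Tendsto w₁ atTop (𝓝 F)

namespace TransportPath

variable {U : Set ℂ} {ℓ q : ℂ → ℂ} {γ γ' : ℝ → ℂ} {δ C : ℝ}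

lemma hasDerivAt_integral_Iic {f : ℝ → ℂ} (hf : Continuous f) (hi : Integrable f) (s : ℝ) :
    HasDerivAt (fun s => ∫ t in Iic s, f t) (f s) s := by
  have e : (fun s => ∫ t in Iic s, f t) = fun s => (∫ t in Iic (0 : ℝ), f t) + ∫ t in (0 : ℝ)..s, f t := by
    funext s
    rw [← intervalIntegral.integral_Iic_sub_Iic hi.integrableOn hi.integrableOn]; ring
  rw [e]
  exact (intervalIntegral.integral_hasDerivAt_right (hf.intervalIntegrable _ _)
    (hf.stronglyMeasurableAtFilter _ _) hf.continuousAt).const_add _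

lemma tendsto_integral_Iic_atBot {f : ℝ → ℂ} (hi : Integrable f) :
    Tendsto (fun s => ∫ t in Iic s, f t) atBot (𝓝 0) := by
  have e : (fun s => ∫ t in Iic s, f t) = fun s => (∫ t in Iic (0 : ℝ), f t) - ∫ t in s..(0 : ℝ), f t := by
    funext s
    rw [← intervalIntegral.integral_Iic_sub_Iic hi.integrableOn hi.integrableOn]; ring
  rw [e]
  simpa using (intervalIntegral_tendsto_integral_Iic 0 hi.integrableOn tendsto_id).const_sub
    (∫ t in Iic (0 : ℝ), f t)

lemma tendsto_integral_Iic_atTop {f : ℝ → ℂ} (hi : Integrable f) :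
    Tendsto (fun s => ∫ t in Iic s, f t) atTop (𝓝 (∫ t, f t)) := by
  have e : (fun s => ∫ t in Iic s, f t) = fun s => (∫ t in Iic (0 : ℝ), f t) + ∫ t in (0 : ℝ)..s, f t := by
    funext s
    rw [← intervalIntegral.integral_Iic_sub_Iic hi.integrableOn hi.integrableOn]; ring
  rw [e, ← intervalIntegral.integral_Iic_add_Ioi (b := 0) hi.integrableOn hi.integrableOn]
  exact (intervalIntegral_tendsto_integral_Ioi 0 hi.integrableOn tendsto_id).const_add _

lemma norm_sub_approxAmp_le (H : TransportPath U ℓ q γ γ' δ C) {h : ℝ} {F : ℂ} {w₁ w₂ : ℝ → ℂ}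
    (hp : 0 < h) (hw : TransportSolution ℓ q γ γ' h F w₁ w₂) {n : ℕ}
    (hh : h < radius δ C / (n + 1)) :
    ‖F - approxAmp ℓ q γ γ' n h‖ ≤
      Real.exp (3 * (C ^ 2 + 4 * C ^ 3 * rate δ C * Real.exp (C ^ 3 * Real.pi)) * Real.pi)
        * Real.exp (-n) := by
  have hC : 0 < C := by linarith [H.one_le]
  have hK := H.rate_pos
  have hnorm : ‖(h : ℂ)‖ = h := by rw [Complex.norm_real, Real.norm_of_nonneg hp.le]
  have hne : (h : ℂ) ≠ 0 := by exact_mod_cast hp.ne'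
  have hh' : ‖(h : ℂ)‖ < radius δ C / (n + 1) := by rwa [hnorm]
  set κ := ‖(h : ℂ)‖ * rate δ C * (n + 2) with hκ
  have hκ2 : κ ≤ Real.exp (-2) := H.rate_mul_le hh'
  have hκ0 : 0 ≤ κ := by positivity
  set B := C ^ 2 + 4 * C ^ 3 * rate δ C * Real.exp (C ^ 3 * Real.pi) with hB
  have hBp : 0 ≤ B := by positivity
  set f := logAmp ℓ q γ γ' n h with hf
  have hfc : Continuous f := H.continuous_logAmp n h
  have hfi : Integrable f := H.integrable_logAmp hh'
  set r : ℝ → ℂ := fun s => riccatiIter ℓ q n (γ s, h) with hr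
  set r' : ℝ → ℂ := fun s => riccatiIter ℓ q (n + 1) (γ s, h) with hr'
  set A : ℝ → ℂ := fun s => Complex.exp (-∫ t in Iic s, f t) with hA
  have hAder : ∀ s, HasDerivAt A (-(f s * A s)) s := fun s =>
    (hasDerivAt_integral_Iic hfc hfi s).neg.cexp.congr_deriv (by simp only [hA, Pi.neg_apply]; ring)
  have hAn : ∀ s, ‖A s‖ ≤ Real.exp (C ^ 3 * Real.pi) := by
    intro s
    refine (Complex.norm_exp_le_exp_norm _).trans (Real.exp_le_exp.2 ?_)
    rw [norm_neg]
    have h1 := norm_integral_le_of_norm_le (μ := volume.restrict (Iic s))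
      (integrable_wt.const_mul (C ^ 3)).integrableOn (Eventually.of_forall (H.norm_logAmp_le hh'))
    refine h1.trans ?_
    have h2 := setIntegral_le_integral (s := Iic s) (integrable_wt.const_mul (C ^ 3))
      (Eventually.of_forall fun s => by have := (wt_pos s).le; simp only [Pi.zero_apply]; positivity)
    rwa [integral_const_mul, integral_const_mul, integral_wt, ← integral_const_mul] at h2
  have hrder : ∀ s, HasDerivAt r (fderiv ℂ (riccatiIter ℓ q n) (γ s, h) (1, 0) * γ' s) s := fun s =>
    (hasDerivAt_riccatiIter H.isOpen H.diff_ℓ H.diff_q H.ne n h (H.mem s)).comp s (H.hasDerivAt s)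
  have hrel : ∀ s, fderiv ℂ (riccatiIter ℓ q n) (γ s, h) (1, 0) =
      -q (γ s) + q (γ s) * r s ^ 2 - 2 * ℓ (γ s) / h * r' s := by
    intro s
    have hℓ := H.ne _ (H.mem s)
    have e : r' s = h / (2 * ℓ (γ s)) * (-q (γ s) + q (γ s) * r s ^ 2
      - fderiv ℂ (riccatiIter ℓ q n) (γ s, h) (1, 0)) := rfl
    rw [e]; field_simp; ring
  set e : ℝ → ℂ := fun s => 2 / h * (ℓ (γ s) * γ' s) * (r s - r' s) * A s with he
  have heb : ∀ s, ‖e s‖ ≤ B * wt s * Real.exp (-n) := by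
    intro s
    have hw0 := (wt_pos s).le
    have hexp : κ ^ n * (n + 2) ≤ 2 * Real.exp (-n) := by
      have e1 : ((n : ℝ) + 2) ≤ 2 * Real.exp n := by linarith [Real.add_one_le_exp (n : ℝ)]
      have e2 : κ ^ n ≤ Real.exp (-(2 * n)) := by
        calc κ ^ n ≤ Real.exp (-2) ^ n := by gcongr
          _ = _ := by rw [← Real.exp_nat_mul]; ring_nf
      calc _ ≤ Real.exp (-(2 * n)) * (2 * Real.exp n) := by gcongr
        _ = 2 * (Real.exp (-(2 * n)) * Real.exp n) := by ring
        _ = _ := by rw [← Real.exp_add]; ring_nf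
    have hd : ‖r s - r' s‖ ≤ C * wt s * κ ^ (n + 1) := by
      rw [norm_sub_rev]; exact (H.iter_bounds hh' s).2
    simp only [he]
    rw [norm_mul, norm_mul, norm_mul, norm_mul, norm_div, hnorm, RCLike.norm_two]
    calc _ ≤ 2 / h * (C * C) * (C * wt s * κ ^ (n + 1)) * Real.exp (C ^ 3 * Real.pi) := by
          gcongr
          · exact H.le s
          · exact H.deriv_le s
          · exact hAn s
      _ = 2 * C ^ 3 * rate δ C * Real.exp (C ^ 3 * Real.pi) * wt s * (κ ^ n * (n + 2)) := by
          rw [pow_succ, hκ, hnorm]; field_simp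
      _ ≤ 2 * C ^ 3 * rate δ C * Real.exp (C ^ 3 * Real.pi) * wt s * (2 * Real.exp (-n)) := by
          gcongr
      _ = (4 * C ^ 3 * rate δ C * Real.exp (C ^ 3 * Real.pi)) * wt s * Real.exp (-n) := by ring
      _ ≤ _ := by
          gcongr
          rw [hB]
          exact le_add_of_nonneg_left (by positivity)
  have hrlim : Tendsto r atBot (𝓝 0) := by
    refine squeeze_zero_norm (fun s => (H.iter_bounds hh' s).1) ?_
    simpa using tendsto_wt_atBot.const_mul C
  have hAlim : Tendsto A atBot (𝓝 1) := by
    have := (tendsto_integral_Iic_atBot hfi).neg.cexp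
    simpa using this
  have key := transport_energy_le (D₁ := fun s => w₁ s - A s) (D₂ := fun s => w₂ s - r s * A s)
    (Q := fun s => q (γ s) * γ' s) (lam := fun s => 2 / h * (ℓ (γ s) * γ' s)) (e := e)
    (η := Real.exp (-n)) hBp
    (fun s => ((hw.hasDerivAt₁ s).sub (hAder s)).congr_deriv (by
      simp only [hf, logAmp, hr]; ring))
    (fun s => ((hw.hasDerivAt₂ s).sub ((hrder s).mul (hAder s))).congr_deriv (by
      rw [hrel]
      simp only [he, hf, logAmp, hr]; ring))
    (fun s => by
      have : (2 / (h : ℂ)) = ((2 / h : ℝ) : ℂ) := by push_cast; rfl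
      rw [this, Complex.re_ofReal_mul]
      exact mul_nonneg (by positivity) (H.re_nonneg s))
    (fun s => (H.norm_coupling_le s).trans (by
      have := (wt_pos s).le
      gcongr
      exact le_add_of_nonneg_right (by positivity)))
    heb (hw.tendsto_atBot₁.sub hAlim) (hw.tendsto_atBot₂.sub (hrlim.mul hAlim))
  have hlim : Tendsto (fun s => ‖w₁ s - A s‖ ^ 2) atTop (𝓝 (‖F - approxAmp ℓ q γ γ' n h‖ ^ 2)) :=
    ((hw.tendsto_atTop.sub (tendsto_integral_Iic_atTop hfi).neg.cexp).norm.pow 2)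
  have hsq : ‖F - approxAmp ℓ q γ γ' n h‖ ^ 2 ≤ (Real.exp (3 * B * Real.pi) * Real.exp (-n)) ^ 2 := by
    refine le_of_tendsto hlim (Eventually.of_forall fun s => ?_)
    have h1 := key s
    have h2 : (1 : ℝ) ≤ Real.exp (3 * B * Real.pi) :=
      Real.one_le_exp (by have := Real.pi_pos; positivity)
    simp only [sub_self, zero_mul, norm_zero] at h1
    calc _ ≤ ‖w₁ s - A s‖ ^ 2 + ‖w₂ s - r s * A s‖ ^ 2 := le_add_of_nonneg_right (sq_nonneg _)
      _ ≤ _ := h1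
      _ = Real.exp (-n) ^ 2 * Real.exp (3 * B * Real.pi) := by ring
      _ ≤ Real.exp (-n) ^ 2 * Real.exp (3 * B * Real.pi) ^ 2 := by
          gcongr
          exact le_self_pow₀ h2 two_ne_zero
      _ = _ := by ring
  exact le_of_sq_le_sq hsq (by positivity)

/-- The transfer amplitude along a dissipative path is `1 + h φ(h)` for a classical analytic
symbol `φ`. -/
theorem exists_symbol (H : TransportPath U ℓ q γ γ' δ C) {F : ℝ → ℂ} {h₀ : ℝ} (h₀p : 0 < h₀)
    (hsys : ∀ h, 0 < h → h < h₀ → ∃ w₁ w₂, TransportSolution ℓ q γ γ' h (F h) w₁ w₂) :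
    ∃ φ : ℝ → ℂ, IsCAS φ ∧ ∃ h₁ > 0, ∀ h : ℝ, 0 < h → h < h₁ → F h = 1 + h * φ h := by
  set M := Real.exp (3 * (C ^ 2 + 4 * C ^ 3 * rate δ C * Real.exp (C ^ 3 * Real.pi)) * Real.pi)
    + Real.exp (C ^ 3 * Real.pi) with hM
  have hC : 0 < C := by linarith [H.one_le]
  have hpi := Real.pi_pos
  refine exists_isCAS_of_approx (G := approxAmp ℓ q γ γ') (c := radius δ C) (M := M) H.radius_pos
    (min_le_left _ _) ?_ h₀p H.differentiableOn_approxAmp ?_ approxAmp_zero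
    H.norm_approxAmp_succ_sub_le ?_
  · have h1 : 1 ≤ Real.exp (C ^ 3 * Real.pi) := Real.one_le_exp (by positivity)
    rw [hM]
    linarith [Real.exp_pos
      (3 * (C ^ 2 + 4 * C ^ 3 * rate δ C * Real.exp (C ^ 3 * Real.pi)) * Real.pi)]
  · intro n z hz
    exact (H.norm_approxAmp_le (mem_ball_zero_iff.1 hz)).trans
      (le_add_of_nonneg_left (Real.exp_pos _).le)
  · intro n h hp hh hh0
    obtain ⟨w₁, w₂, hw⟩ := hsys h hp hh0
    refine (H.norm_sub_approxAmp_le hp hw hh).trans ?_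
    gcongr
    exact le_add_of_nonneg_right (Real.exp_pos _).le

end TransportPath

/-- The radial primitive of `f` based at `c`. -/
noncomputable def starPrim (c : ℂ) (f : ℂ → ℂ) (x : ℂ) : ℂ :=
  ∫ t in (0 : ℝ)..1, (x - c) * f (c + t * (x - c))

lemma StarConvex.add_mul_sub_mem {c x : ℂ} {U : Set ℂ} (hU : StarConvex ℝ c U) (hx : x ∈ U)
    {t : ℝ} (h0 : 0 ≤ t) (h1 : t ≤ 1) : c + t * (x - c) ∈ U := by
  simpa [smul_eq_mul] using hU.add_smul_sub_mem hx h0 h1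

lemma hasDerivAt_starPrim {c : ℂ} {f : ℂ → ℂ} {U : Set ℂ} (hU : IsOpen U) (hs : StarConvex ℝ c U)
    (hf : DifferentiableOn ℂ f U) {x : ℂ} (hx : x ∈ U) : HasDerivAt (starPrim c f) (f x) x := by
  obtain ⟨ε, hε, hball⟩ := Metric.nhds_basis_closedBall.mem_iff.1 (hU.mem_nhds hx)
  set k : ℂ × ℝ → ℂ := fun p => c + p.2 * (p.1 - c) with hk
  have hkc : Continuous k := by fun_prop
  have hmaps : ∀ p ∈ Metric.closedBall x ε ×ˢ Icc (0 : ℝ) 1, k p ∈ U := fun p hp =>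
    hs.add_mul_sub_mem (hball hp.1) hp.2.1 hp.2.2
  have hcomp : IsCompact (Metric.closedBall x ε ×ˢ Icc (0 : ℝ) 1) :=
    (isCompact_closedBall x ε).prod isCompact_Icc
  have hf' : ContinuousOn (deriv f) U := (hf.deriv hU).continuousOn
  set F' : ℂ → ℝ → ℂ := fun y t => f (k (y, t)) + (y - c) * (t * deriv f (k (y, t))) with hF'
  have hF'c : ContinuousOn (fun p : ℂ × ℝ => F' p.1 p.2) (Metric.closedBall x ε ×ˢ Icc (0 : ℝ) 1) := by
    have h1 := hf.continuousOn.comp hkc.continuousOn hmaps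
    have h2 := hf'.comp hkc.continuousOn hmaps
    exact h1.add (ContinuousOn.mul (by fun_prop) (ContinuousOn.mul (by fun_prop) h2))
  obtain ⟨B, hB⟩ := hcomp.exists_bound_of_continuousOn hF'c
  have hsub : uIoc (0 : ℝ) 1 ⊆ Icc 0 1 := by
    rw [uIoc_of_le zero_le_one]; exact Ioc_subset_Icc_self
  have hslice : ∀ y ∈ Metric.closedBall x ε, ContinuousOn (fun t : ℝ => (y - c) * f (c + t * (y - c)))
      (Icc 0 1) := fun y hy => by
    have := hf.continuousOn.comp (s := Icc (0 : ℝ) 1) (f := fun t : ℝ => k (y, t))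
      (by fun_prop) fun t ht => hmaps (y, t) ⟨hy, ht⟩
    exact continuousOn_const.mul this
  have hslice' : ContinuousOn (F' x) (Icc 0 1) := hF'c.comp (f := fun t : ℝ => (x, t))
    (by fun_prop) fun t ht => ⟨Metric.mem_closedBall_self hε.le, ht⟩
  have key := intervalIntegral.hasDerivAt_integral_of_dominated_loc_of_deriv_le (μ := volume)
    (F := fun y (t : ℝ) => (y - c) * f (c + t * (y - c))) (F' := F') (x₀ := x) (a := 0) (b := 1)
    (s := Metric.closedBall x ε) (bound := fun _ => B) (Metric.closedBall_mem_nhds x hε)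
    (by
      filter_upwards [Metric.closedBall_mem_nhds x hε] with y hy
      exact ((hslice y hy).mono hsub).aestronglyMeasurable measurableSet_uIoc)
    ((hslice x (Metric.mem_closedBall_self hε.le)).intervalIntegrable_of_Icc zero_le_one)
    ((hslice'.mono hsub).aestronglyMeasurable measurableSet_uIoc)
    (Eventually.of_forall fun t ht y hy => hB (y, t) ⟨hy, hsub ht⟩)
    (by simp)
    (Eventually.of_forall fun t ht y hy => by
      have hd := (hf.differentiableAt (hU.mem_nhds (hmaps (y, t) ⟨hy, hsub ht⟩))).hasDerivAt
      have h1 : HasDerivAt (fun y : ℂ => c + t * (y - c)) (t : ℂ) y := by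
        simpa using (((hasDerivAt_id y).sub_const c).const_mul (t : ℂ)).const_add c
      have h2 := ((hasDerivAt_id y).sub_const c).mul (HasDerivAt.comp y hd h1)
      refine h2.congr_deriv ?_
      simp only [hF', hk, id, Function.comp]; ring)
  refine key.2.congr_deriv ?_
  have hFTC : ∀ t ∈ uIcc (0 : ℝ) 1, HasDerivAt (fun t : ℝ => (t : ℂ) * f (c + t * (x - c))) (F' x t) t := by
    intro t ht
    rw [uIcc_of_le zero_le_one] at ht
    have hd := (hf.differentiableAt (hU.mem_nhds
      (hmaps (x, t) ⟨Metric.mem_closedBall_self hε.le, ht⟩))).hasDerivAt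
    have h0 : HasDerivAt (fun t : ℝ => (t : ℂ)) 1 t := Complex.ofRealCLM.hasDerivAt
    have h1 : HasDerivAt (fun t : ℝ => c + t * (x - c)) (x - c) t := by
      simpa using (h0.mul_const (x - c)).const_add c
    refine (h0.mul (HasDerivAt.comp t hd h1)).congr_deriv ?_
    simp only [hF', hk, Function.comp]; ring
  rw [intervalIntegral.integral_eq_sub_of_hasDerivAt hFTC
    (hslice'.intervalIntegrable_of_Icc zero_le_one)]
  simp

lemma norm_starPrim_zero_le {f : ℂ → ℂ} {U : Set ℂ} (hs : StarConvex ℝ 0 U)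
    {A : ℝ} {n : ℕ}
    (hA : ∀ x ∈ U, ‖f x‖ ≤ A * ‖x‖ ^ n) {x : ℂ} (hx : x ∈ U) :
    ‖starPrim 0 f x‖ ≤ A / (n + 1) * ‖x‖ ^ (n + 1) := by
  have h1 : ∀ t ∈ Icc (0 : ℝ) 1, ‖(x - 0) * f (0 + t * (x - 0))‖ ≤ A * ‖x‖ ^ (n + 1) * t ^ n := by
    intro t ht
    have := hA _ (hs.add_mul_sub_mem hx ht.1 ht.2)
    simp only [sub_zero, zero_add] at this ⊢
    rw [norm_mul]
    calc _ ≤ ‖x‖ * (A * ‖(t : ℂ) * x‖ ^ n) := by gcongr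
      _ = _ := by rw [norm_mul, Complex.norm_real, Real.norm_of_nonneg ht.1]; ring
  have h2 := intervalIntegral.norm_integral_le_of_norm_le (μ := volume) (zero_le_one' ℝ)
    (f := fun t : ℝ => (x - 0) * f (0 + t * (x - 0))) (g := fun t => A * ‖x‖ ^ (n + 1) * t ^ n)
    (Eventually.of_forall fun t ht => h1 t (Ioc_subset_Icc_self ht))
    (Continuous.intervalIntegrable (by fun_prop) _ _)
  refine h2.trans (le_of_eq ?_)
  rw [intervalIntegral.integral_const_mul, integral_pow]
  simp; ring

/-- Picard iterates for the system `u₁' = f₁ u₂`, `u₂' = f₂ u₁` with data `v` at the origin. -/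
noncomputable def picardIter (f₁ f₂ : ℂ → ℂ) (v : ℂ × ℂ) : ℕ → ℂ → ℂ × ℂ
  | 0 => fun _ => v
  | n + 1 => fun x => (starPrim 0 (fun y => f₁ y * (picardIter f₁ f₂ v n y).2) x,
      starPrim 0 (fun y => f₂ y * (picardIter f₁ f₂ v n y).1) x)

/-- The horizontal strip `|Im x| < η`. -/
def strip (η : ℝ) : Set ℂ := {x : ℂ | |x.im| < η}

lemma isOpen_strip (η : ℝ) : IsOpen (strip η) :=
  isOpen_lt (continuous_abs.comp Complex.continuous_im) continuous_const

lemma convex_strip (η : ℝ) : Convex ℝ (strip η) := by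
  have : strip η = Complex.imCLM ⁻¹' Metric.ball 0 η := by
    ext x; simp [strip]
  rw [this]
  exact (convex_ball (0 : ℝ) η).linear_preimage Complex.imCLM.toLinearMap

lemma ofReal_mem_strip {η : ℝ} (hη : 0 < η) (s : ℝ) : (s : ℂ) ∈ strip η := by simpa [strip] using hη

section

variable {f₁ f₂ : ℂ → ℂ} {η K : ℝ}

lemma differentiableOn_picardIter (hη : 0 < η) (h1 : DifferentiableOn ℂ f₁ (strip η))
    (h2 : DifferentiableOn ℂ f₂ (strip η)) (v : ℂ × ℂ) (n : ℕ) :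
    DifferentiableOn ℂ (fun x => (picardIter f₁ f₂ v n x).1) (strip η) ∧
    DifferentiableOn ℂ (fun x => (picardIter f₁ f₂ v n x).2) (strip η) := by
  have hs : StarConvex ℝ 0 (strip η) :=
    (convex_strip η).starConvex (by simpa using ofReal_mem_strip hη 0)
  induction n with
  | zero => exact ⟨differentiableOn_const (c := v.1), differentiableOn_const (c := v.2)⟩
  | succ n ih =>
    exact ⟨fun x hx => (hasDerivAt_starPrim (isOpen_strip η) hs (h1.mul ih.2)
        hx).differentiableAt.differentiableWithinAt,
      fun x hx => (hasDerivAt_starPrim (isOpen_strip η) hs (h2.mul ih.1)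
        hx).differentiableAt.differentiableWithinAt⟩

lemma norm_picardIter_le (hη : 0 < η) (hK : 0 ≤ K)
    (hb1 : ∀ x ∈ strip η, ‖f₁ x‖ ≤ K) (hb2 : ∀ x ∈ strip η, ‖f₂ x‖ ≤ K) (v : ℂ × ℂ) (n : ℕ) :
    ∀ x ∈ strip η, ‖picardIter f₁ f₂ v n x‖ ≤ ‖v‖ * K ^ n / n.factorial * ‖x‖ ^ n := by
  have hs : StarConvex ℝ 0 (strip η) :=
    (convex_strip η).starConvex (by simpa using ofReal_mem_strip hη 0)
  induction n with
  | zero => intro x _; simp [picardIter]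
  | succ n ih =>
    intro x hx
    have e : ‖v‖ * K ^ (n + 1) / (n + 1).factorial = K * (‖v‖ * K ^ n / n.factorial) / (n + 1) := by
      rw [Nat.factorial_succ]; push_cast; field_simp; ring
    rw [e, picardIter, norm_prod_le_iff]
    refine ⟨norm_starPrim_zero_le hs (fun y hy => ?_) hx,
      norm_starPrim_zero_le hs (fun y hy => ?_) hx⟩
    · rw [norm_mul, mul_assoc K]
      exact mul_le_mul (hb1 y hy) ((norm_snd_le _).trans (ih y hy)) (norm_nonneg _) hK
    · rw [norm_mul, mul_assoc K]
      exact mul_le_mul (hb2 y hy) ((norm_fst_le _).trans (ih y hy)) (norm_nonneg _) hK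

/-- Linear holomorphic systems with bounded coefficients on a strip are solvable. -/
lemma exists_holomorphic_solution (hη : 0 < η) (h1 : DifferentiableOn ℂ f₁ (strip η))
    (h2 : DifferentiableOn ℂ f₂ (strip η)) (hK : 0 ≤ K)
    (hb1 : ∀ x ∈ strip η, ‖f₁ x‖ ≤ K) (hb2 : ∀ x ∈ strip η, ‖f₂ x‖ ≤ K) (v : ℂ × ℂ) :
    ∃ u₁ u₂ : ℂ → ℂ, u₁ 0 = v.1 ∧ u₂ 0 = v.2 ∧
      (∀ x ∈ strip η, HasDerivAt u₁ (f₁ x * u₂ x) x) ∧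
      ∀ x ∈ strip η, HasDerivAt u₂ (f₂ x * u₁ x) x := by
  have hs : StarConvex ℝ 0 (strip η) :=
    (convex_strip η).starConvex (by simpa using ofReal_mem_strip hη 0)
  set p := picardIter f₁ f₂ v with hp
  have hzero : ∀ n, p (n + 1) 0 = 0 := by intro n; simp [hp, picardIter, starPrim]
  have hsum : ∀ R : ℝ, Summable fun n : ℕ => ‖v‖ * K ^ n / n.factorial * R ^ n := by
    intro R
    have := (Real.summable_pow_div_factorial (K * R)).mul_left ‖v‖
    refine this.congr fun n => ?_
    rw [mul_pow]; ring
  have hdiff := differentiableOn_picardIter hη h1 h2 v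
  have hnorm := norm_picardIter_le hη hK hb1 hb2 v
  have main : ∀ (g : ℕ → ℂ → ℂ) (c : ℂ) (f : ℂ → ℂ) (w : ℕ → ℂ → ℂ), g 0 = (fun _ => c) →
      (∀ n, g (n + 1) = starPrim 0 fun y => f y * w n y) →
      DifferentiableOn ℂ f (strip η) → (∀ x ∈ strip η, ‖f x‖ ≤ K) →
      (∀ n, DifferentiableOn ℂ (w n) (strip η)) →
      (∀ n, ∀ x ∈ strip η, ‖w n x‖ ≤ ‖v‖ * K ^ n / n.factorial * ‖x‖ ^ n) →
      (∑' n, g n 0 = c) ∧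
      ∀ x ∈ strip η, HasDerivAt (fun x => ∑' n, g n x) (f x * ∑' n, w n x) x := by
    intro g c f w hg0 hgs hf hfb hw hwb
    have hg00 : ∀ n, g (n + 1) 0 = 0 := fun n => by rw [hgs]; simp [starPrim]
    have hs0 : Summable fun n => g n 0 := by
      rw [← summable_nat_add_iff 1]
      simp [hg00]
    refine ⟨?_, fun x hx => ?_⟩
    · rw [hs0.tsum_eq_zero_add]; simp [hg00, hg0]
    set R := ‖x‖ + 1 with hR
    have hRp : 0 ≤ R := by positivity
    set t := strip η ∩ Metric.ball 0 R with ht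
    have hto : IsOpen t := (isOpen_strip η).inter Metric.isOpen_ball
    have htc : IsPreconnected t := ((convex_strip η).inter (convex_ball 0 R)).isPreconnected
    have hxt : x ∈ t := ⟨hx, by simp [hR]⟩
    have h0t : (0 : ℂ) ∈ t := ⟨by simpa using ofReal_mem_strip hη 0, by simp [hR]; positivity⟩
    set g' : ℕ → ℂ → ℂ := fun n => Nat.casesOn n (fun _ => 0) fun n y => f y * w n y with hg'
    set ub : ℕ → ℝ := fun n => Nat.casesOn n 0 fun n => K * (‖v‖ * K ^ n / n.factorial * R ^ n)
      with hub
    have hubs : Summable ub := by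
      rw [← summable_nat_add_iff 1]
      exact (hsum R).mul_left K
    have key := hasDerivAt_tsum_of_isPreconnected (g := g) (g' := g') hubs hto htc
      (fun n y hy => by
        cases n with
        | zero => rw [hg0]; exact hasDerivAt_const y c
        | succ n =>
          rw [hgs]
          exact hasDerivAt_starPrim (isOpen_strip η) hs (hf.mul (hw n)) hy.1)
      (fun n y hy => by
        cases n with
        | zero => simp [hg', hub]
        | succ n =>
          simp only [hg', hub, norm_mul]
          have hyR : ‖y‖ ≤ R := (mem_ball_zero_iff.1 hy.2).le
          refine mul_le_mul (hfb y hy.1) ((hwb n y hy.1).trans ?_) (norm_nonneg _) hK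
          gcongr)
      h0t hs0 hxt
    refine key.congr_deriv ?_
    have hs' : Summable fun n => g' n x := Summable.of_norm_bounded hubs fun n => by
      cases n with
      | zero => simp [hg', hub]
      | succ n =>
        simp only [hg', hub, norm_mul]
        refine mul_le_mul (hfb x hx) ((hwb n x hx).trans ?_) (norm_nonneg _) hK
        gcongr
        simp [hR]
    rw [hs'.tsum_eq_zero_add, ← tsum_mul_left]
    simp [hg']
  obtain ⟨a1, a2⟩ := main (fun n x => (p n x).1) v.1 f₁ (fun n x => (p n x).2) rfl (fun n => rfl) h1
    hb1 (fun n => (hdiff n).2) fun n x hx => (norm_snd_le _).trans (hnorm n x hx)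
  obtain ⟨b1, b2⟩ := main (fun n x => (p n x).2) v.2 f₂ (fun n x => (p n x).1) rfl (fun n => rfl) h2
    hb2 (fun n => (hdiff n).1) fun n x hx => (norm_fst_le _).trans (hnorm n x hx)
  exact ⟨_, _, a1, b1, a2, b2⟩

/-- Solutions on the real line extend holomorphically to the strip. -/
lemma exists_holomorphic_extension (hη : 0 < η) (h1 : DifferentiableOn ℂ f₁ (strip η))
    (h2 : DifferentiableOn ℂ f₂ (strip η)) (hK : 0 ≤ K)
    (hb1 : ∀ x ∈ strip η, ‖f₁ x‖ ≤ K) (hb2 : ∀ x ∈ strip η, ‖f₂ x‖ ≤ K) {ω₁ ω₂ : ℝ → ℂ}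
    (hω1 : ∀ s : ℝ, HasDerivAt ω₁ (f₁ s * ω₂ s) s) (hω2 : ∀ s : ℝ, HasDerivAt ω₂ (f₂ s * ω₁ s) s) :
    ∃ u₁ u₂ : ℂ → ℂ, (∀ s : ℝ, u₁ s = ω₁ s) ∧ (∀ s : ℝ, u₂ s = ω₂ s) ∧
      (∀ x ∈ strip η, HasDerivAt u₁ (f₁ x * u₂ x) x) ∧
      ∀ x ∈ strip η, HasDerivAt u₂ (f₂ x * u₁ x) x := by
  obtain ⟨u₁, u₂, e1, e2, d1, d2⟩ :=
    exists_holomorphic_solution hη h1 h2 hK hb1 hb2 (ω₁ 0, ω₂ 0)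
  have heq : (fun s : ℝ => (u₁ s, u₂ s)) = fun s : ℝ => (ω₁ s, ω₂ s) := by
    refine ODE_solution_unique_univ (v := fun s p => (f₁ (s : ℝ) * p.2, f₂ (s : ℝ) * p.1))
      (s := fun _ => univ) (K := ⟨K, hK⟩) (t₀ := 0) (fun t => ?_) (fun t => ⟨?_, trivial⟩)
      (fun t => ⟨(hω1 t).prodMk (hω2 t), trivial⟩) ?_
    · refine LipschitzOnWith.of_dist_le_mul fun p _ p' _ => ?_
      rw [dist_eq_norm, dist_eq_norm]
      change _ ≤ K * _
      rw [norm_prod_le_iff]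
      simp only [Prod.fst_sub, Prod.snd_sub, ← mul_sub, norm_mul]
      exact ⟨mul_le_mul (hb1 _ (ofReal_mem_strip hη t)) (norm_snd_le (p - p')) (norm_nonneg _) hK,
        mul_le_mul (hb2 _ (ofReal_mem_strip hη t)) (norm_fst_le (p - p')) (norm_nonneg _) hK⟩
    · exact ((d1 _ (ofReal_mem_strip hη t)).comp_ofReal).prodMk
        (d2 _ (ofReal_mem_strip hη t)).comp_ofReal
    · simp [e1, e2]
  exact ⟨u₁, u₂, fun s => congrArg Prod.fst (congrFun heq s),
    fun s => congrArg Prod.snd (congrFun heq s), d1, d2⟩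

/-- Exponential asymptotics of solutions persist under bounded vertical shifts. -/
lemma tendsto_vertical_shift (hη : 0 < η) (hK : 0 ≤ K)
    (hb1 : ∀ x ∈ strip η, ‖f₁ x‖ ≤ K) (hb2 : ∀ x ∈ strip η, ‖f₂ x‖ ≤ K) {u₁ u₂ : ℂ → ℂ}
    (d1 : ∀ x ∈ strip η, HasDerivAt u₁ (f₁ x * u₂ x) x)
    (d2 : ∀ x ∈ strip η, HasDerivAt u₂ (f₂ x * u₁ x) x) {l : Filter ℝ} {θ f₁₀ f₂₀ v₁ v₂ : ℂ}
    (hf1 : ∀ ε > 0, ∀ᶠ s : ℝ in l, ∀ t : ℝ, |t| < η → ‖f₁ (s + t * I) - f₁₀‖ ≤ ε)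
    (hf2 : ∀ ε > 0, ∀ᶠ s : ℝ in l, ∀ t : ℝ, |t| < η → ‖f₂ (s + t * I) - f₂₀‖ ≤ ε)
    (hθ1 : f₁₀ * v₂ = θ * v₁) (hθ2 : f₂₀ * v₁ = θ * v₂)
    (hl1 : Tendsto (fun s : ℝ => u₁ s * Complex.exp (-(θ * s))) l (𝓝 v₁))
    (hl2 : Tendsto (fun s : ℝ => u₂ s * Complex.exp (-(θ * s))) l (𝓝 v₂))
    {g : ℝ → ℝ} (hg : ∀ s, |g s| < η) :
    Tendsto (fun s : ℝ => u₁ (s + g s * I) * Complex.exp (-(θ * (s + g s * I)))) l (𝓝 v₁) ∧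
    Tendsto (fun s : ℝ => u₂ (s + g s * I) * Complex.exp (-(θ * (s + g s * I)))) l (𝓝 v₂) := by
  set G : ℝ → ℝ → ℂ × ℂ := fun s t =>
    (u₁ (s + t * g s * I) * Complex.exp (-(θ * (s + t * g s * I))) - v₁,
     u₂ (s + t * g s * I) * Complex.exp (-(θ * (s + t * g s * I))) - v₂) with hG
  set L := η * (K + ‖θ‖) + 1 with hL
  have hLp : 0 < L := by positivity
  have hmem : ∀ s t : ℝ, t ∈ Icc (0 : ℝ) 1 → (s + t * g s * I : ℂ) ∈ strip η := by
    intro s t ht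
    have : |t * g s| < η := by
      rw [abs_mul, abs_of_nonneg ht.1]
      exact (mul_le_of_le_one_left (abs_nonneg _) ht.2).trans_lt (hg s)
    simpa [strip] using this
  have hder : ∀ s t : ℝ, t ∈ Icc (0 : ℝ) 1 → HasDerivAt (G s)
      (g s * I * (f₁ (s + t * g s * I) * (G s t).2 - θ * (G s t).1
          + (f₁ (s + t * g s * I) - f₁₀) * v₂),
       g s * I * (f₂ (s + t * g s * I) * (G s t).1 - θ * (G s t).2
          + (f₂ (s + t * g s * I) - f₂₀) * v₁)) t := by
    intro s t ht
    have hx : HasDerivAt (fun t : ℝ => (s + t * g s * I : ℂ)) (g s * I) t := by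
      have := (((Complex.ofRealCLM.hasDerivAt (x := t)).mul_const ((g s : ℂ) * I))).const_add (s : ℂ)
      simpa [mul_assoc] using this
    have he : HasDerivAt (fun t : ℝ => Complex.exp (-(θ * (s + t * g s * I))))
        (Complex.exp (-(θ * (s + t * g s * I))) * (-(θ * (g s * I)))) t :=
      (hx.const_mul θ).neg.cexp
    have a1 := (((d1 _ (hmem s t ht)).comp t hx).mul he).sub_const v₁
    have a2 := (((d2 _ (hmem s t ht)).comp t hx).mul he).sub_const v₂
    refine (a1.prodMk a2).congr_deriv ?_
    simp only [hG, Function.comp, Prod.mk.injEq]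
    constructor
    · linear_combination ((g s : ℂ) * I) * hθ1
    · linear_combination ((g s : ℂ) * I) * hθ2
  have hG0 : Tendsto (fun s => ‖G s 0‖) l (𝓝 0) := by
    have : Tendsto (fun s => G s 0) l (𝓝 (v₁ - v₁, v₂ - v₂)) := by
      simp only [hG, Complex.ofReal_zero, zero_mul, add_zero]
      exact (hl1.sub_const v₁).prodMk_nhds (hl2.sub_const v₂)
    simpa using this.norm
  have hG1 : Tendsto (fun s => G s 1) l (𝓝 0) := by
    rw [Metric.tendsto_nhds]
    intro ε hε
    set A := Real.exp L with hA
    have hAp : 0 < A := Real.exp_pos _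
    set B := η * (‖v₁‖ + ‖v₂‖) + 1 with hB
    have hBp : 0 < B := by positivity
    set e := ε * L / (2 * A * B) with hed
    have hep : 0 < e := by positivity
    filter_upwards [hf1 e hep, hf2 e hep, (tendsto_order.1 hG0).2 (ε / (2 * A)) (by positivity)]
      with s hs1 hs2 hs0
    have hgb := norm_le_gronwallBound_of_norm_deriv_right_le (f := G s) (δ := ε / (2 * A)) (K := L)
      (ε := B * e) (a := 0) (b := 1)
      (fun t ht => (hder s t ht).continuousAt.continuousWithinAt)
      (fun t ht => (hder s t (Ico_subset_Icc_self ht)).hasDerivWithinAt) hs0.le (by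
        intro t ht
        have hx := hmem s t (Ico_subset_Icc_self ht)
        have hgs := (hg s).le
        have ht' : |t * g s| < η := by simpa [strip] using hx
        have p1 := hs1 _ ht'
        have p2 := hs2 _ ht'
        push_cast at p1 p2
        have q1 := norm_fst_le (G s t)
        have q2 := norm_snd_le (G s t)
        have hgn : ‖(g s : ℂ) * I‖ ≤ η := by
          rw [norm_mul, Complex.norm_I, mul_one, Complex.norm_real]; exact hgs
        have aux : ∀ a b c d z w : ℂ, ‖a‖ ≤ K → ‖b‖ ≤ ‖G s t‖ → ‖c‖ ≤ ‖G s t‖ → ‖d‖ ≤ e →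
            ‖w‖ ≤ ‖v₁‖ + ‖v₂‖ →
            ‖(g s : ℂ) * I * (a * b - θ * c + d * w)‖ ≤ L * ‖G s t‖ + B * e := by
          intro a b c d z w ha hb hc hd hw
          rw [norm_mul]
          calc _ ≤ η * (K * ‖G s t‖ + ‖θ‖ * ‖G s t‖ + e * (‖v₁‖ + ‖v₂‖)) := by
                refine mul_le_mul hgn ?_ (norm_nonneg _) hη.le
                refine norm_add_le_of_le (norm_sub_le_of_le ?_ ?_) ?_ <;> rw [norm_mul] <;> gcongr
            _ = (L - 1) * ‖G s t‖ + (B - 1) * e := by rw [hL, hB]; ring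
            _ ≤ _ := by nlinarith [norm_nonneg (G s t)]
        rw [norm_prod_le_iff]
        exact ⟨aux _ _ _ _ 0 _ (hb1 _ hx) q2 q1 p1 (by linarith [norm_nonneg v₁]),
          aux _ _ _ _ 0 _ (hb2 _ hx) q1 q2 p2 (by linarith [norm_nonneg v₂])⟩) 1
      (by simp)
    rw [dist_zero_right]
    refine hgb.trans_lt ?_
    rw [gronwallBound_of_K_ne_0 hLp.ne']
    simp only [sub_zero, mul_one, ← hA]
    have e1 : ε / (2 * A) * A = ε / 2 := by field_simp
    have e2 : B * e / L * (A - 1) = ε / 2 - ε / (2 * A) := by rw [hed]; field_simp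
    rw [e1, e2]
    have : 0 < ε / (2 * A) := by positivity
    linarith
  have h1 : Tendsto (fun s => (G s 1).1 + v₁) l (𝓝 (0 + v₁)) :=
    ((continuous_fst.tendsto _).comp hG1).add_const v₁
  have h2 : Tendsto (fun s => (G s 1).2 + v₂) l (𝓝 (0 + v₂)) :=
    ((continuous_snd.tendsto _).comp hG1).add_const v₂
  simp only [hG, sub_add_cancel, zero_add, Complex.ofReal_one, one_mul] at h1 h2
  exact ⟨h1, h2⟩

end

/-- Decay in a half-sector, with Cauchy estimates for the derivative. -/
lemma sector_deriv_decay {V : ℂ → ℂ} {ε η δ C R : ℝ} {V₀ : ℂ} (hε : 0 < ε) (hη : 0 < η)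
    (hδ : 1 < δ) (hV : AnalyticOnNhd ℂ V (Sector ε η))
    (hd : ∀ x ∈ Sector ε η, R ≤ x.re → ‖V x - V₀‖ ≤ C * (1 + ‖x‖ ^ 2) ^ (-(δ / 2))) :
    ∃ C' R' : ℝ, 0 ≤ C' ∧ 0 ≤ R' ∧ ∀ x : ℂ, |x.im| ≤ η / 4 → R' ≤ x.re →
      ‖V x - V₀‖ ≤ C' / (1 + x.re) ∧ ‖deriv V x‖ ≤ C' / (1 + x.re) ^ 2 := by
  set κ := min (ε / (2 * (1 + ε))) (η / (2 * (1 + ε))) with hκ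
  have hκp : 0 < κ := by rw [hκ]; positivity
  have hκ1 : κ * (1 + ε) ≤ ε / 2 := by
    have := min_le_left (ε / (2 * (1 + ε))) (η / (2 * (1 + ε)))
    rw [← hκ, le_div_iff₀ (by positivity)] at this
    linarith
  have hκ2 : κ * (1 + ε) ≤ η / 2 := by
    have := min_le_right (ε / (2 * (1 + ε))) (η / (2 * (1 + ε)))
    rw [← hκ, le_div_iff₀ (by positivity)] at this
    linarith
  have hκ3 : κ ≤ 1 / 2 := by nlinarith
  have hball : ∀ x : ℂ, |x.im| ≤ η / 4 → max (2 * R + 1) 0 ≤ x.re →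
      ∀ y ∈ Metric.closedBall x (κ * (1 + x.re)), y ∈ Sector ε η ∧ (x.re - 1) / 2 ≤ y.re := by
    intro x hx hR y hy
    have hx0 : 0 ≤ x.re := (le_max_right _ _).trans hR
    rw [mem_closedBall_iff_norm] at hy
    have h1 := (abs_le.1 ((Complex.abs_re_le_norm (y - x)).trans hy))
    have h2 := (abs_le.1 ((Complex.abs_im_le_norm (y - x)).trans hy))
    simp only [Complex.sub_re, Complex.sub_im] at h1 h2
    have h3 := abs_le.1 hx
    have hre : x.re - κ * (1 + x.re) ≤ |y.re| := le_trans (by linarith) (le_abs_self _)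
    refine ⟨?_, by nlinarith⟩
    change |y.im| < ε * |y.re| + η
    have : ε * (x.re - κ * (1 + x.re)) ≤ ε * |y.re| := mul_le_mul_of_nonneg_left hre hε.le
    rw [abs_lt]
    constructor <;> nlinarith
  have hdec : ∀ x : ℂ, |x.im| ≤ η / 4 → max (2 * R + 1) 0 ≤ x.re →
      ∀ y ∈ Metric.closedBall x (κ * (1 + x.re)), ‖V y - V₀‖ ≤ |C| * 4 / (1 + x.re) := by
    intro x hx hR y hy
    have hx0 : 0 ≤ x.re := (le_max_right _ _).trans hR
    have hxR : 2 * R + 1 ≤ x.re := (le_max_left _ _).trans hR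
    obtain ⟨hyS, hyre⟩ := hball x hx hR y hy
    refine (hd y hyS (by linarith)).trans ?_
    rw [mul_div_assoc]
    refine mul_le_mul (le_abs_self C) ?_ (by positivity) (abs_nonneg C)
    have hn : 1 ≤ 1 + ‖y‖ ^ 2 := by nlinarith [sq_nonneg ‖y‖]
    calc (1 + ‖y‖ ^ 2) ^ (-(δ / 2)) ≤ (1 + ‖y‖ ^ 2) ^ (-(1 / 2) : ℝ) :=
          Real.rpow_le_rpow_of_exponent_le hn (by linarith)
      _ = (Real.sqrt (1 + ‖y‖ ^ 2))⁻¹ := by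
          rw [Real.rpow_neg (by positivity), Real.sqrt_eq_rpow]
      _ ≤ ((1 + x.re) / 4)⁻¹ := by
          refine inv_anti₀ (by positivity) (Real.le_sqrt_of_sq_le ?_)
          have h5 : 1 + y.re ^ 2 ≤ 1 + ‖y‖ ^ 2 := by
            have := Complex.abs_re_le_norm y
            nlinarith [sq_abs y.re, abs_nonneg y.re]
          refine le_trans ?_ h5
          by_cases h6 : 1 ≤ x.re
          · nlinarith [mul_self_le_mul_self (by linarith : 0 ≤ (x.re - 1) / 2) hyre,
              sq_nonneg (3 * x.re - 5)]
          · nlinarith [sq_nonneg y.re]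
      _ = 4 / (1 + x.re) := by rw [inv_div]
  refine ⟨|C| * 4 / κ, max (2 * R + 1) 0, by positivity, le_max_right _ _, fun x hx hR => ?_⟩
  have hx0 : 0 ≤ x.re := (le_max_right _ _).trans hR
  constructor
  · refine (hdec x hx hR x (Metric.mem_closedBall_self (by positivity))).trans ?_
    gcongr
    rw [le_div_iff₀ hκp]
    nlinarith [abs_nonneg C]
  · have hdc : DiffContOnCl ℂ (fun y => V y - V₀) (Metric.ball x (κ * (1 + x.re))) := by
      refine DifferentiableOn.diffContOnCl fun y hy => ?_
      refine (((hV y (hball x hx hR y ?_).1).differentiableAt).sub_const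
        V₀).differentiableWithinAt
      exact Metric.closure_ball_subset_closedBall hy
    have := Complex.norm_deriv_le_of_forall_mem_sphere_norm_le (by positivity : 0 < κ * (1 + x.re)) hdc
      (C := |C| * 4 / (1 + x.re)) fun y hy => hdec x hx hR y (Metric.sphere_subset_closedBall hy)
    rw [deriv_sub_const] at this
    refine this.trans (le_of_eq ?_)
    field_simp

lemma one_add_sq_le_shift (s μ : ℝ) : 1 + (s - μ) ^ 2 ≤ 2 * (1 + μ ^ 2) * (1 + s ^ 2) := by
  nlinarith [sq_nonneg (s + μ), mul_nonneg (sq_nonneg s) (sq_nonneg μ), sq_nonneg s, sq_nonneg μ]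

lemma wt_le_shift (s μ : ℝ) : wt s ≤ 2 * (1 + μ ^ 2) * wt (s - μ) := by
  unfold wt
  rw [← div_eq_mul_inv, inv_eq_one_div, div_le_div_iff₀ (by positivity) (by positivity)]
  linarith [one_add_sq_le_shift s μ]

/-- What assumption (A) provides on a horizontal strip. -/
structure StripPotential (V : ℂ → ℂ) (Vm Vp μ η C : ℝ) : Prop where
  η_pos : 0 < η
  C_pos : 0 < C
  diff : DifferentiableOn ℂ V (strip η)
  norm_le : ∀ x ∈ strip η, ‖V x‖ ≤ C
  deriv_le : ∀ x ∈ strip η, ‖deriv V x‖ ≤ C * wt (x.re - μ)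
  tendsto_right : ∀ ε > 0, ∃ R : ℝ, ∀ x ∈ strip η, R ≤ x.re → ‖V x - Vp‖ ≤ ε
  tendsto_left : ∀ ε > 0, ∃ R : ℝ, ∀ x ∈ strip η, x.re ≤ -R → ‖V x - Vm‖ ≤ ε

lemma StripPotential.mono {V : ℂ → ℂ} {Vm Vp μ η η' C : ℝ} (H : StripPotential V Vm Vp μ η C)
    (h0 : 0 < η') (h : η' ≤ η) : StripPotential V Vm Vp μ η' C := by
  have hs : strip η' ⊆ strip η := fun x hx => lt_of_lt_of_le hx h
  exact ⟨h0, H.C_pos, H.diff.mono hs, fun x hx => H.norm_le x (hs hx),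
    fun x hx => H.deriv_le x (hs hx),
    fun e he => (H.tendsto_right e he).imp fun R hR x hx => hR x (hs hx),
    fun e he => (H.tendsto_left e he).imp fun R hR x hx => hR x (hs hx)⟩

lemma AssumptionA.exists_stripPotential {V : ℂ → ℂ} {Vm Vp : ℝ} (hA : AssumptionA V Vm Vp)
    (μ : ℝ) : ∃ η C, StripPotential V Vm Vp μ η C := by
  obtain ⟨ε, hε, η, hη, δ, hδ, hV, ⟨C₁, R₁, h₁⟩, C₂, R₂, h₂⟩ := hA.sector
  obtain ⟨Cr, Rr, hCr, hRr, hr⟩ := sector_deriv_decay hε hη hδ hV h₁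
  have hneg : ∀ x : ℂ, x ∈ Sector ε η → -x ∈ Sector ε η := by
    intro x hx; simpa [Sector] using hx
  obtain ⟨Cl, Rl, hCl, hRl, hl'⟩ := sector_deriv_decay (V := fun x => V (-x)) (V₀ := (Vm : ℂ))
    (R := R₂) (C := C₂) hε hη hδ
    (fun x hx => (hV _ (hneg x hx)).comp (analyticAt_id.neg))
    (fun x hx hR => by simpa using h₂ (-x) (hneg x hx) (by simpa using hR))
  have hl : ∀ x : ℂ, |x.im| ≤ η / 4 → x.re ≤ -Rl →
      ‖V x - Vm‖ ≤ Cl / (1 - x.re) ∧ ‖deriv V x‖ ≤ Cl / (1 - x.re) ^ 2 := by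
    intro x hx hR
    have := hl' (-x) (by simpa using hx) (by simp; linarith)
    rw [deriv_comp_neg] at this
    simpa [sub_eq_add_neg] using this
  set Q : Set ℂ := Icc (-Rl) Rr ×ℂ Icc (-(η / 4)) (η / 4) with hQ
  have hQc : IsCompact Q := isCompact_Icc.reProdIm isCompact_Icc
  have hstrip : ∀ x : ℂ, |x.im| ≤ η / 4 → x ∈ Sector ε η := by
    intro x hx
    have : 0 ≤ ε * |x.re| := by positivity
    change |x.im| < ε * |x.re| + η
    linarith
  have hQs : Q ⊆ Sector ε η := fun x hx => hstrip x (abs_le.2 hx.2)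
  obtain ⟨M₁, hM₁⟩ := hQc.exists_bound_of_continuousOn (hV.continuousOn.mono hQs)
  obtain ⟨M₂, hM₂⟩ := hQc.exists_bound_of_continuousOn (hV.deriv.continuousOn.mono hQs)
  set B := max (1 + Rl ^ 2) (1 + Rr ^ 2) with hB
  have hB0 : 0 < B := lt_of_lt_of_le (by positivity) (le_max_left _ _)
  set D := 2 * (1 + μ ^ 2) with hD
  have hDp : 2 ≤ D := by nlinarith [sq_nonneg μ]
  have hder : ∀ x : ℂ, |x.im| ≤ η / 4 → ‖deriv V x‖ ≤ (Cr + Cl + |M₂| * B) * wt x.re := by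
    intro x hx
    have e : (Cr + Cl + |M₂| * B) * wt x.re = Cr * wt x.re + Cl * wt x.re + |M₂| * B * wt x.re := by
      ring
    have hw := wt_pos x.re
    have p1 : 0 ≤ Cr * wt x.re := by positivity
    have p2 : 0 ≤ Cl * wt x.re := by positivity
    have p3 : 0 ≤ |M₂| * B * wt x.re := by positivity
    rw [e]
    rcases le_total Rr x.re with h | h
    · refine ((hr x hx h).2.trans ?_).trans (by linarith : Cr * wt x.re ≤ _)
      rw [wt, ← div_eq_mul_inv]
      gcongr
      nlinarith
    rcases le_total x.re (-Rl) with h' | h'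
    · refine ((hl x hx h').2.trans ?_).trans (by linarith : Cl * wt x.re ≤ _)
      rw [wt, ← div_eq_mul_inv]
      gcongr
      nlinarith
    · refine ((hM₂ x ⟨⟨h', h⟩, abs_le.1 hx⟩).trans ?_).trans
        (by linarith : |M₂| * B * wt x.re ≤ _)
      rw [mul_assoc]
      have : 1 ≤ B * wt x.re := by
        rw [wt, ← div_eq_mul_inv, one_le_div (by positivity)]
        rcases le_total 0 x.re with h0 | h0
        · exact le_trans (by nlinarith) (le_max_right _ _)
        · exact le_trans (by nlinarith) (le_max_left _ _)
      exact (le_abs_self _).trans (le_mul_of_one_le_right (abs_nonneg _) this)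
  have hnorm : ∀ x : ℂ, |x.im| ≤ η / 4 → ‖V x‖ ≤ |Vp| + |Vm| + Cr + Cl + |M₁| := by
    intro x hx
    have := abs_nonneg Vp
    have := abs_nonneg Vm
    have := abs_nonneg M₁
    have hn : ∀ W : ℝ, ‖V x‖ ≤ ‖V x - W‖ + |W| := fun W => by
      have := norm_add_le (V x - W) W
      rwa [sub_add_cancel, Complex.norm_real] at this
    rcases le_total Rr x.re with h | h
    · have h1 := (hr x hx h).1
      have : Cr / (1 + x.re) ≤ Cr := div_le_self hCr (by linarith)
      linarith [hn Vp]
    rcases le_total x.re (-Rl) with h' | h'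
    · have h1 := (hl x hx h').1
      have : Cl / (1 - x.re) ≤ Cl := div_le_self hCl (by linarith)
      linarith [hn Vm]
    · linarith [hM₁ x ⟨⟨h', h⟩, abs_le.1 hx⟩, le_abs_self M₁]
  set X := (Cr + Cl + |M₂| * B) * D with hX
  set Y := |Vp| + |Vm| + Cr + Cl + |M₁| with hY
  have hX0 : 0 ≤ X := by positivity
  have hY0 : 0 ≤ Y := by positivity
  have hs : ∀ x ∈ strip (η / 4), |x.im| ≤ η / 4 := fun x hx => le_of_lt hx
  refine ⟨η / 4, X + Y + 1, by positivity, by positivity, fun x hx =>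
    (hV x (hstrip x (hs x hx))).differentiableAt.differentiableWithinAt,
    fun x hx => (hnorm x (hs x hx)).trans (by linarith), fun x hx => ?_, fun e he => ?_,
    fun e he => ?_⟩
  · refine (hder x (hs x hx)).trans ?_
    have hw := wt_pos (x.re - μ)
    calc _ ≤ (Cr + Cl + |M₂| * B) * (D * wt (x.re - μ)) := by
          gcongr; exact wt_le_shift _ _
      _ = X * wt (x.re - μ) := by rw [hX]; ring
      _ ≤ _ := by gcongr; linarith
  · refine ⟨max Rr (Cr / e), fun x hx hR => ?_⟩
    have h1 : Rr ≤ x.re := (le_max_left _ _).trans hR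
    have h2 : Cr / e ≤ x.re := (le_max_right _ _).trans hR
    refine (hr x (hs x hx) h1).1.trans ?_
    rw [div_le_iff₀ he] at h2
    rw [div_le_iff₀ (by linarith)]
    nlinarith
  · refine ⟨max Rl (Cl / e), fun x hx hR => ?_⟩
    have h1 : Rl ≤ -x.re := (le_max_left _ _).trans (by linarith)
    have h2 : Cl / e ≤ -x.re := (le_max_right _ _).trans (by linarith)
    refine (hl x (hs x hx) (by linarith)).1.trans ?_
    rw [div_le_iff₀ he] at h2
    rw [div_le_iff₀ (by linarith)]
    nlinarith

/-- A continuous function taking a level exactly once stays on the sides prescribed by its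
limits. -/
lemma lt_of_level_once_left {v : ℝ → ℝ} {t L E : ℝ} (hv : Continuous v)
    (hlim : Tendsto v atBot (𝓝 L)) (hL : L < E) (h1 : ∀ s < t, v s ≠ E) :
    ∀ s < t, v s < E := by
  intro s hs
  by_contra! hcon
  have hev := (hlim.eventually_lt_const hL).and (eventually_le_atBot s)
  obtain ⟨a, ha, has⟩ := hev.exists
  obtain ⟨x, hx, hxE⟩ := intermediate_value_Icc has hv.continuousOn ⟨ha.le, hcon⟩
  exact h1 x (hx.2.trans_lt hs) hxE

lemma lt_of_level_once_right {v : ℝ → ℝ} {t L E : ℝ} (hv : Continuous v)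
    (hlim : Tendsto v atTop (𝓝 L)) (hL : E < L) (h1 : ∀ s, t < s → v s ≠ E) :
    ∀ s, t < s → E < v s := by
  intro s hs
  by_contra! hcon
  have hev := (hlim.eventually_const_lt hL).and (eventually_ge_atTop s)
  obtain ⟨a, ha, has⟩ := hev.exists
  obtain ⟨x, hx, hxE⟩ := intermediate_value_Icc has hv.continuousOn ⟨hcon, ha.le⟩
  exact h1 x (hs.trans_le hx.1) hxE

/-- A monotone crossing of the level `E` at `t` by the real trace of `V`. -/
structure Crossing (V : ℂ → ℂ) (E t : ℝ) : Prop where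
  lt : ∀ s < t, (V (s : ℝ)).re < E
  gt : ∀ s : ℝ, t < s → E < (V s).re
  eq : V (t : ℝ) = E
  deriv_pos : 0 < (deriv V (t : ℝ)).re

/-- Uniform control of `V` in a thin strip around a crossing. -/
structure CrossingBox (V : ℂ → ℂ) (E t r e v η : ℝ) : Prop where
  near : ∀ x ∈ strip η, |x.re - t| ≤ r → v * x.im ^ 2 ≤ (V x).im * x.im ∧ ‖V x - E‖ ≤ e
  left : ∀ x ∈ strip η, x.re ≤ t - r → v ≤ E - (V x).re
  right : ∀ x ∈ strip η, t + r ≤ x.re → v ≤ (V x).re - E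

lemma CrossingBox.mono {V : ℂ → ℂ} {E t r e v v' η η' : ℝ} (H : CrossingBox V E t r e v η)
    (h : η' ≤ η) (hv : v' ≤ v) : CrossingBox V E t r e v' η' := by
  have hs : strip η' ⊆ strip η := fun x hx => lt_of_lt_of_le hx h
  exact ⟨fun x hx hr => ⟨(mul_le_mul_of_nonneg_right hv (sq_nonneg _)).trans
      (H.near x (hs hx) hr).1, (H.near x (hs hx) hr).2⟩,
    fun x hx hr => hv.trans (H.left x (hs hx) hr), fun x hx hr => hv.trans (H.right x (hs hx) hr)⟩

section

variable {V : ℂ → ℂ} {Vm Vp μ η C E t : ℝ}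

lemma StripPotential.continuous_re (H : StripPotential V Vm Vp μ η C) :
    Continuous fun s : ℝ => (V s).re := by
  refine Complex.continuous_re.comp ?_
  rw [continuous_iff_continuousAt]
  intro s
  have := (H.diff.differentiableAt
    ((isOpen_strip η).mem_nhds (ofReal_mem_strip H.η_pos s))).continuousAt
  exact this.comp Complex.continuous_ofReal.continuousAt

lemma StripPotential.tendsto_atTop (H : StripPotential V Vm Vp μ η C) :
    Tendsto (fun s : ℝ => V s) atTop (𝓝 Vp) := by
  rw [Metric.tendsto_nhds]
  intro e he
  obtain ⟨R, hR⟩ := H.tendsto_right (e / 2) (by positivity)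
  filter_upwards [eventually_ge_atTop R] with s hs
  rw [dist_eq_norm]
  exact (hR s (ofReal_mem_strip H.η_pos s) (by simpa using hs)).trans_lt (by linarith)

lemma StripPotential.tendsto_atBot (H : StripPotential V Vm Vp μ η C) :
    Tendsto (fun s : ℝ => V s) atBot (𝓝 Vm) := by
  rw [Metric.tendsto_nhds]
  intro e he
  obtain ⟨R, hR⟩ := H.tendsto_left (e / 2) (by positivity)
  filter_upwards [eventually_le_atBot (-R)] with s hs
  rw [dist_eq_norm]
  exact (hR s (ofReal_mem_strip H.η_pos s) (by simpa using hs)).trans_lt (by linarith)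

lemma StripPotential.norm_sub_re_le (H : StripPotential V Vm Vp μ η C) {x : ℂ}
    (hx : x ∈ strip η) : ‖V x - V x.re‖ ≤ C * wt (x.re - μ) * |x.im| := by
  have hsub : segment ℝ (x.re : ℂ) x ⊆ {y | y ∈ strip η ∧ y.re = x.re} := by
    intro y hy
    refine ⟨(convex_strip η).segment_subset (ofReal_mem_strip H.η_pos _) hx hy, ?_⟩
    obtain ⟨a, b, -, -, hab, rfl⟩ := hy
    simp only [Complex.add_re, Complex.real_smul, Complex.re_ofReal_mul, Complex.ofReal_re]
    rw [← add_mul, hab, one_mul]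
  have := (convex_segment (x.re : ℂ) x).norm_image_sub_le_of_norm_deriv_le (𝕜 := ℂ) (f := V)
    (C := C * wt (x.re - μ))
    (fun y hy => H.diff.differentiableAt ((isOpen_strip η).mem_nhds (hsub hy).1))
    (fun y hy => by have := H.deriv_le y (hsub hy).1; rwa [(hsub hy).2] at this)
    (left_mem_segment ℝ _ _) (right_mem_segment ℝ _ _)
  refine this.trans (le_of_eq ?_)
  congr 1
  have : x - x.re = x.im * I := by apply Complex.ext <;> simp
  rw [this]; simp

lemma StripPotential.exists_crossingBox (H : StripPotential V Vm Vp μ η C)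
    (hreal : ∀ x : ℝ, (V x).im = 0) (hX : Crossing V E t) (hm : Vm < E) (hp : E < Vp)
    {e : ℝ} (he : 0 < e) :
    ∃ r₀ > 0, ∀ r, 0 < r → r ≤ r₀ → ∃ v > 0, ∃ η' > 0, CrossingBox V E t r e v η' := by
  have hη := H.η_pos
  have hC := H.C_pos
  set d := (deriv V (t : ℝ)).re with hd
  have hdp : 0 < d := hX.deriv_pos
  have htn : strip η ∈ 𝓝 ((t : ℝ) : ℂ) := (isOpen_strip η).mem_nhds (ofReal_mem_strip hη t)
  have hdiffat : ∀ x ∈ strip η, DifferentiableAt ℂ V x := fun x hx =>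
    H.diff.differentiableAt ((isOpen_strip η).mem_nhds hx)
  have hdim : (deriv V (t : ℝ)).im = 0 := by
    have h1 : HasDerivAt (fun s : ℝ => V s) (deriv V (t : ℝ)) t :=
      (hdiffat _ (ofReal_mem_strip hη t)).hasDerivAt.comp_ofReal
    have h2 : HasDerivAt (fun s : ℝ => (V s).im) ((deriv V (t : ℝ)).im) t :=
      Complex.imCLM.hasFDerivAt.comp_hasDerivAt t h1
    have h3 : (fun s : ℝ => (V s).im) = fun _ => 0 := funext hreal
    rw [h3] at h2
    exact h2.unique (hasDerivAt_const t 0)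
  have hdV : deriv V (t : ℝ) = (d : ℂ) := Complex.ext (by simp [hd]) (by simp [hdim])
  have hcd : ContinuousAt (deriv V) (t : ℝ) :=
    ((H.diff.analyticAt htn).deriv).continuousAt
  have hcV : ContinuousAt V (t : ℝ) := (hdiffat _ (ofReal_mem_strip hη t)).continuousAt
  obtain ⟨ρ, hρ, hball⟩ : ∃ ρ > 0, ∀ x ∈ Metric.ball ((t : ℝ) : ℂ) ρ,
      x ∈ strip η ∧ ‖deriv V x - d‖ ≤ d / 2 ∧ ‖V x - E‖ ≤ e := by
    have h1 : ∀ᶠ x in 𝓝 ((t : ℝ) : ℂ), ‖deriv V x - d‖ ≤ d / 2 := by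
      have := ((hcd.tendsto.sub_const (d : ℂ))).norm
      have h := this.eventually_lt_const (u := d / 2) (by simpa [hdV] using hdp)
      exact h.mono fun x hx => hx.le
    have h2 : ∀ᶠ x in 𝓝 ((t : ℝ) : ℂ), ‖V x - E‖ ≤ e := by
      have := ((hcV.tendsto.sub_const (E : ℂ))).norm
      have h := this.eventually_lt_const (by simpa [hX.eq] using he)
      exact h.mono fun x hx => hx.le
    obtain ⟨ρ, hρ, h⟩ := Metric.eventually_nhds_iff_ball.1
      (Filter.Eventually.and (show ∀ᶠ x in 𝓝 ((t : ℝ) : ℂ), x ∈ strip η from htn) (h1.and h2))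
    exact ⟨ρ, hρ, fun x hx => ⟨(h x hx).1, (h x hx).2⟩⟩
  refine ⟨ρ / 2, by positivity, fun r hr hrρ => ?_⟩
  have hcr := H.continuous_re
  have hleft : ∃ a > 0, ∀ s ≤ t - r, a ≤ E - (V (s : ℝ)).re := by
    have hl : Tendsto (fun s : ℝ => (V s).re) atBot (𝓝 Vm) :=
      (Complex.continuous_re.tendsto _).comp H.tendsto_atBot
    obtain ⟨s₀, hs₀⟩ := eventually_atBot.1
      (hl.eventually_lt_const (by linarith : Vm < (Vm + E) / 2))
    have hcomp : IsCompact (Icc (min s₀ (t - r)) (t - r)) := isCompact_Icc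
    obtain ⟨z, hz, hzm⟩ := hcomp.exists_isMaxOn
      ⟨t - r, ⟨min_le_right _ _, le_rfl⟩⟩ hcr.continuousOn
    have hzE := hX.lt z (by linarith [hz.2])
    refine ⟨min ((E - Vm) / 2) (E - (V (z : ℝ)).re), lt_min (by linarith) (by linarith),
      fun s hs => ?_⟩
    rcases le_total s s₀ with h | h
    · exact (min_le_left _ _).trans (by linarith [hs₀ s h])
    · have h3 : (V (s : ℝ)).re ≤ (V (z : ℝ)).re := hzm ⟨(min_le_left _ _).trans h, hs⟩
      exact (min_le_right _ _).trans (by linarith)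
  have hright : ∃ a > 0, ∀ s, t + r ≤ s → a ≤ (V (s : ℝ)).re - E := by
    have hl : Tendsto (fun s : ℝ => (V s).re) atTop (𝓝 Vp) :=
      (Complex.continuous_re.tendsto _).comp H.tendsto_atTop
    obtain ⟨s₀, hs₀⟩ := eventually_atTop.1
      (hl.eventually_const_lt (by linarith : (Vp + E) / 2 < Vp))
    have hcomp : IsCompact (Icc (t + r) (max s₀ (t + r))) := isCompact_Icc
    obtain ⟨z, hz, hzm⟩ := hcomp.exists_isMinOn
      ⟨t + r, ⟨le_rfl, le_max_right _ _⟩⟩ hcr.continuousOn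
    have hzE := hX.gt z (by linarith [hz.1])
    refine ⟨min ((Vp - E) / 2) ((V (z : ℝ)).re - E), lt_min (by linarith) (by linarith),
      fun s hs => ?_⟩
    rcases le_total s s₀ with h | h
    · have h3 : (V (z : ℝ)).re ≤ (V (s : ℝ)).re := hzm ⟨hs, h.trans (le_max_left _ _)⟩
      exact (min_le_right _ _).trans (by linarith)
    · exact (min_le_left _ _).trans (by linarith [hs₀ s h])
  obtain ⟨a₁, ha₁, hl⟩ := hleft
  obtain ⟨a₂, ha₂, hr2⟩ := hright
  set a := min a₁ a₂ with ha
  have hap : 0 < a := lt_min ha₁ ha₂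
  have hfar : ∀ x ∈ strip (min (min η (ρ / 2)) (a / (2 * C))),
      x ∈ strip η ∧ |x.im| < ρ / 2 ∧ |(V x).re - (V x.re).re| ≤ a / 2 := by
    intro x hx
    have hx' : |x.im| < min (min η (ρ / 2)) (a / (2 * C)) := hx
    have h1 : |x.im| < η := hx'.trans_le ((min_le_left _ _).trans (min_le_left _ _))
    have h2 : |x.im| < ρ / 2 := hx'.trans_le ((min_le_left _ _).trans (min_le_right _ _))
    have h3 : |x.im| < a / (2 * C) := hx'.trans_le (min_le_right _ _)
    refine ⟨h1, h2, ?_⟩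
    rw [← Complex.sub_re]
    refine (Complex.abs_re_le_norm _).trans ((H.norm_sub_re_le h1).trans ?_)
    rw [lt_div_iff₀ (by positivity)] at h3
    have := wt_le_one (x.re - μ)
    have := wt_pos (x.re - μ)
    calc C * wt (x.re - μ) * |x.im| ≤ C * 1 * |x.im| := by gcongr
      _ ≤ _ := by linarith
  have hη'p : 0 < min (min η (ρ / 2)) (a / (2 * C)) := by positivity
  refine ⟨min (d / 2) (a / 2), by positivity, _, hη'p, ⟨fun x hx hxr => ?_,
    fun x hx hxr => ?_, fun x hx hxr => ?_⟩⟩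
  · obtain ⟨h1, h2, -⟩ := hfar x hx
    have hin : ∀ y : ℂ, y.re = x.re → |y.im| < ρ / 2 → y ∈ Metric.ball ((t : ℝ) : ℂ) ρ := by
      intro y hy hyi
      rw [mem_ball_iff_norm]
      refine (Complex.norm_le_abs_re_add_abs_im _).trans_lt ?_
      simp only [Complex.sub_re, Complex.ofReal_re, Complex.sub_im, Complex.ofReal_im, sub_zero, hy]
      linarith
    have hxB := hin x rfl h2
    have hrB := hin x.re (by simp) (by simpa using by positivity)
    refine ⟨?_, (hball x hxB).2.2⟩
    have key := (convex_ball ((t : ℝ) : ℂ) ρ).norm_image_sub_le_of_norm_hasDerivWithin_le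
      (𝕜 := ℂ) (f := fun y => V y - d * y) (f' := fun y => deriv V y - d) (C := d / 2)
      (fun y hy => (((hdiffat y (hball y hy).1).hasDerivAt.sub
        (by simpa using (hasDerivAt_id y).const_mul (d : ℂ)))).hasDerivWithinAt)
      (fun y hy => (hball y hy).2.1) hrB hxB
    have h4 := (Complex.abs_im_le_norm _).trans key
    have h5 : x - x.re = x.im * I := by apply Complex.ext <;> simp
    rw [h5] at h4
    simp only [Complex.sub_im, Complex.im_ofReal_mul, Complex.ofReal_im, hreal, mul_zero, sub_zero,
      norm_mul, Complex.norm_I, mul_one, Complex.norm_real, Real.norm_eq_abs] at h4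
    have h6 : |((V x).im - d * x.im) * x.im| ≤ d / 2 * x.im ^ 2 := by
      rw [abs_mul, ← sq_abs x.im]
      nlinarith [abs_nonneg x.im]
    have h7 := (abs_le.1 h6).1
    have h8 := min_le_left (d / 2) (a / 2)
    nlinarith [sq_nonneg x.im]
  · obtain ⟨-, -, h3⟩ := hfar x hx
    have h4 := hl x.re hxr
    have := min_le_right (d / 2) (a / 2)
    have := min_le_left a₁ a₂
    linarith [(abs_le.1 h3).2]
  · obtain ⟨-, -, h3⟩ := hfar x hx
    have h4 := hr2 x.re hxr
    have := min_le_right (d / 2) (a / 2)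
    have := min_le_right a₁ a₂
    linarith [(abs_le.1 h3).1]

/-- The two simple zeros are transversal crossings of the levels `E ∓ M`. -/
lemma StripPotential.crossings (H : StripPotential V Vm Vp μ η C)
    (hreal : ∀ x : ℝ, (V x).im = 0) {M D t₁ t₂ : ℝ} (hM : 0 < M) (hD : D = M ^ 2)
    (h1 : Vm + M < E) (h2 : E < Vp - M) (ht : t₁ < t₂)
    (hzeros : ∀ x : ℝ, D - ((V x).re - E) ^ 2 = 0 ↔ x = t₁ ∨ x = t₂)
    (hsimp1 : deriv (fun x : ℝ => D - ((V x).re - E) ^ 2) t₁ ≠ 0)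
    (hsimp2 : deriv (fun x : ℝ => D - ((V x).re - E) ^ 2) t₂ ≠ 0) :
    Crossing V (E - M) t₁ ∧ Crossing V (E + M) t₂ := by
  subst hD
  set v : ℝ → ℝ := fun s => (V s).re with hv
  have hvc : Continuous v := H.continuous_re
  have hlb : Tendsto v atBot (𝓝 Vm) := (Complex.continuous_re.tendsto _).comp H.tendsto_atBot
  have hlt : Tendsto v atTop (𝓝 Vp) := (Complex.continuous_re.tendsto _).comp H.tendsto_atTop
  have hz : ∀ x : ℝ, (v x = E - M ∨ v x = E + M) ↔ x = t₁ ∨ x = t₂ := by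
    intro x
    rw [← hzeros x]
    have e : M ^ 2 - (v x - E) ^ 2 = (M - (v x - E)) * (M + (v x - E)) := by ring
    change _ ↔ M ^ 2 - (v x - E) ^ 2 = 0
    rw [e, mul_eq_zero]
    constructor
    · rintro (h | h)
      · right; linarith
      · left; linarith
    · rintro (h | h)
      · right; linarith
      · left; linarith
  have hex : ∀ {a L : ℝ}, L < v a → Vm < L → ∃ x ≤ a, v x = L := by
    intro a L ha hL
    obtain ⟨b, hb, hba⟩ := ((hlb.eventually_lt_const hL).and (eventually_le_atBot a)).exists
    obtain ⟨x, hx, hxe⟩ := intermediate_value_Icc hba hvc.continuousOn ⟨hb.le, ha.le⟩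
    exact ⟨x, hx.2, hxe⟩
  have hex' : ∀ {a L : ℝ}, v a < L → L < Vp → ∃ x ≥ a, v x = L := by
    intro a L ha hL
    obtain ⟨b, hb, hba⟩ := ((hlt.eventually_const_lt hL).and (eventually_ge_atTop a)).exists
    obtain ⟨x, hx, hxe⟩ := intermediate_value_Icc hba hvc.continuousOn ⟨ha.le, hb.le⟩
    exact ⟨x, hx.1, hxe⟩
  have e1 : v t₁ = E - M := by
    rcases (hz t₁).2 (Or.inl rfl) with h | h
    · exact h
    · exfalso
      obtain ⟨x, hx, hxe⟩ := hex (a := t₁) (L := E - M) (by linarith) (by linarith)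
      rcases (hz x).1 (Or.inl hxe) with h' | h'
      · rw [h'] at hxe; linarith
      · linarith
  have e2 : v t₂ = E + M := by
    rcases (hz t₂).2 (Or.inr rfl) with h | h
    · exfalso
      obtain ⟨x, hx, hxe⟩ := hex' (a := t₂) (L := E + M) (by linarith) (by linarith)
      rcases (hz x).1 (Or.inr hxe) with h' | h'
      · rw [h'] at hx; linarith
      · rw [h'] at hxe; linarith
    · exact h
  have n1 : ∀ s, v s = E - M → s = t₁ := by
    intro s hs
    rcases (hz s).1 (Or.inl hs) with h | h
    · exact h
    · rw [h] at hs; linarith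
  have n2 : ∀ s, v s = E + M → s = t₂ := by
    intro s hs
    rcases (hz s).1 (Or.inr hs) with h | h
    · rw [h] at hs; linarith
    · exact h
  have hder : ∀ s : ℝ, HasDerivAt v ((deriv V (s : ℝ)).re) s := by
    intro s
    have h1 : HasDerivAt (fun s : ℝ => V s) (deriv V (s : ℝ)) s :=
      (H.diff.differentiableAt ((isOpen_strip η).mem_nhds
        (ofReal_mem_strip H.η_pos s))).hasDerivAt.comp_ofReal
    exact Complex.reCLM.hasFDerivAt.comp_hasDerivAt s h1
  have main : ∀ (t L : ℝ), (∀ s, v s = L → s = t) → v t = L → Vm < L → L < Vp →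
      deriv (fun x : ℝ => M ^ 2 - ((V x).re - E) ^ 2) t ≠ 0 → Crossing V L t := by
    intro t L hn he hm hp hs
    have hl := lt_of_level_once_left (t := t) hvc hlb hm fun s hs h => hs.ne (hn s h)
    have hr := lt_of_level_once_right (t := t) hvc hlt hp fun s hs h => hs.ne' (hn s h)
    refine ⟨hl, hr, Complex.ext (by simpa using he) (by simp [hreal]), ?_⟩
    have hne : (deriv V (t : ℝ)).re ≠ 0 := by
      intro h0
      apply hs
      have := (((hder t).sub_const E).pow 2).const_sub (M ^ 2)
      rw [h0] at this
      simpa using this.deriv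
    refine lt_of_le_of_ne ?_ (Ne.symm hne)
    have hslope := (hasDerivAt_iff_tendsto_slope.1 (hder t))
    refine ge_of_tendsto hslope (eventually_nhdsWithin_of_forall fun s hs => ?_)
    rw [slope_def_field]
    rcases lt_or_gt_of_ne (show s ≠ t from hs) with h | h
    · exact div_nonneg_of_nonpos (by linarith [hl s h]) (by linarith)
    · exact div_nonneg (by linarith [hr s h]) (by linarith)
  exact ⟨main t₁ _ n1 e1 (by linarith) (by linarith) hsimp1,
    main t₂ _ n2 e2 (by linarith) (by linarith) hsimp2⟩

end

/-- The pair `a = (E - V + mc²)/c`, `b = (E - V - mc²)/c` on a strip adapted to the turning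
points, in the Klein regime. -/
structure KleinPair (a b : ℂ → ℂ) (t₁ t₂ μ M am ap η r v C : ℝ) : Prop where
  η_pos : 0 < η
  r_pos : 0 < r
  v_pos : 0 < v
  C_pos : 0 < C
  M_pos : 0 < M
  gap : t₁ + 8 * r ≤ t₂
  mid : μ = (t₁ + t₂) / 2
  am_gt : M < am
  ap_neg : ap < 0
  eq_add : ∀ x, a x = b x + M
  diff_a : DifferentiableOn ℂ a (strip η)
  real : ∀ s : ℝ, (a s).im = 0
  norm_a_le : ∀ x ∈ strip η, ‖a x‖ ≤ C
  norm_b_le : ∀ x ∈ strip η, ‖b x‖ ≤ C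
  deriv_le : ∀ x ∈ strip η, ‖deriv a x‖ ≤ C * wt (x.re - μ)
  im_le : ∀ x ∈ strip η, |(a x).im| ≤ C * wt (x.re - μ) * |x.im|
  near_a : ∀ x ∈ strip η, |x.re - t₂| ≤ r → (a x).im * x.im ≤ -(v * x.im ^ 2) ∧ ‖a x‖ ≤ M / 4
  near_b : ∀ x ∈ strip η, |x.re - t₁| ≤ r → (b x).im * x.im ≤ -(v * x.im ^ 2) ∧ ‖b x‖ ≤ M / 4
  left_a : ∀ x ∈ strip η, x.re ≤ t₂ - r → v ≤ (a x).re
  right_a : ∀ x ∈ strip η, t₂ + r ≤ x.re → (a x).re ≤ -v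
  left_b : ∀ x ∈ strip η, x.re ≤ t₁ - r → v ≤ (b x).re
  right_b : ∀ x ∈ strip η, t₁ + r ≤ x.re → (b x).re ≤ -v
  pos_a : ∀ s < t₂, 0 < (a (s : ℝ)).re
  neg_a : ∀ s : ℝ, t₂ < s → (a s).re < 0
  pos_b : ∀ s < t₁, 0 < (b (s : ℝ)).re
  neg_b : ∀ s : ℝ, t₁ < s → (b s).re < 0
  tendsto_right : ∀ ε > 0, ∃ R : ℝ, ∀ x ∈ strip η, R ≤ x.re → ‖a x - ap‖ ≤ ε
  tendsto_left : ∀ ε > 0, ∃ R : ℝ, ∀ x ∈ strip η, x.re ≤ -R → ‖a x - am‖ ≤ ε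

lemma StripPotential.exists_kleinPair {V : ℂ → ℂ} {Vm Vp μ η C E m c t₁ t₂ : ℝ}
    (H : StripPotential V Vm Vp μ η C) (hreal : ∀ x : ℝ, (V x).im = 0) (hm : 0 < m) (hc : 0 < c)
    (hμ : μ = (t₁ + t₂) / 2) (ht : t₁ < t₂)
    (hE1 : Vm + m * c ^ 2 < E) (hE2 : E < Vp - m * c ^ 2)
    (hX1 : Crossing V (E - m * c ^ 2) t₁) (hX2 : Crossing V (E + m * c ^ 2) t₂) :
    ∃ η' r v C', KleinPair (fun x => (E - V x + m * c ^ 2) / c) (fun x => (E - V x - m * c ^ 2) / c)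
      t₁ t₂ μ (2 * (m * c)) ((E - Vm + m * c ^ 2) / c) ((E - Vp + m * c ^ 2) / c) η' r v C' := by
  have hmc : 0 < m * c ^ 2 := by positivity
  have hC := H.C_pos
  obtain ⟨ra, hra, Ha⟩ := H.exists_crossingBox hreal hX2 (by linarith) (by linarith)
    (e := m * c ^ 2 / 2) (by positivity)
  obtain ⟨rb, hrb, Hb⟩ := H.exists_crossingBox hreal hX1 (by linarith) (by linarith)
    (e := m * c ^ 2 / 2) (by positivity)
  have hgap : 0 < (t₂ - t₁) / 8 := by linarith
  set r := min (min ra rb) ((t₂ - t₁) / 8) with hr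
  have hrp : 0 < r := by positivity
  obtain ⟨va, hva, ηa, hηa, Ka'⟩ := Ha r hrp ((min_le_left _ _).trans (min_le_left _ _))
  obtain ⟨vb, hvb, ηb, hηb, Kb'⟩ := Hb r hrp ((min_le_left _ _).trans (min_le_right _ _))
  set v := min va vb with hv
  have hvp : 0 < v := lt_min hva hvb
  set η' := min η (min ηa ηb) with hη'
  have hη'p : 0 < η' := lt_min H.η_pos (lt_min hηa hηb)
  have Ka := Ka'.mono (η' := η') (v' := v) ((min_le_right _ _).trans (min_le_left _ _)) (min_le_left _ _)
  have Kb := Kb'.mono (η' := η') (v' := v) ((min_le_right _ _).trans (min_le_right _ _)) (min_le_right _ _)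
  have K := H.mono hη'p (min_le_left _ _)
  have hcn : (c : ℂ) ≠ 0 := by exact_mod_cast hc.ne'
  have hnc : ‖(c : ℂ)‖ = c := by rw [Complex.norm_real, Real.norm_of_nonneg hc.le]
  have hare : ∀ x, ((E - V x + m * c ^ 2) / c : ℂ).re = -((V x).re - (E + m * c ^ 2)) / c := by
    intro x
    rw [Complex.div_ofReal_re]; congr 1
    rw [← Complex.ofReal_pow, ← Complex.ofReal_mul]
    simp only [Complex.add_re, Complex.sub_re, Complex.ofReal_re]; ring
  have hbre : ∀ x, ((E - V x - m * c ^ 2) / c : ℂ).re = -((V x).re - (E - m * c ^ 2)) / c := by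
    intro x
    rw [Complex.div_ofReal_re]; congr 1
    rw [← Complex.ofReal_pow, ← Complex.ofReal_mul]
    simp only [Complex.sub_re, Complex.ofReal_re]; ring
  have haim : ∀ x, ((E - V x + m * c ^ 2) / c : ℂ).im = -(V x).im / c := by
    intro x
    rw [Complex.div_ofReal_im]; congr 1
    rw [← Complex.ofReal_pow, ← Complex.ofReal_mul]
    simp only [Complex.add_im, Complex.sub_im, Complex.ofReal_im]; ring
  have hbim : ∀ x, ((E - V x - m * c ^ 2) / c : ℂ).im = -(V x).im / c := by
    intro x
    rw [Complex.div_ofReal_im]; congr 1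
    rw [← Complex.ofReal_pow, ← Complex.ofReal_mul]
    simp only [Complex.sub_im, Complex.ofReal_im]; ring
  set C' := (|E| + C + m * c ^ 2) / c + C / c with hC'
  have hC1 : (|E| + C + m * c ^ 2) / c ≤ C' := by rw [hC']; linarith [div_pos hC hc]
  have hC2 : C / c ≤ C' := by rw [hC']; linarith [show 0 < (|E| + C + m * c ^ 2) / c by positivity]
  have hmn : ‖(m * c ^ 2 : ℂ)‖ = m * c ^ 2 := by
    rw [← Complex.ofReal_pow, ← Complex.ofReal_mul, Complex.norm_real, Real.norm_of_nonneg hmc.le]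
  have hder : ∀ x ∈ strip η', HasDerivAt (fun x => (E - V x + m * c ^ 2) / c : ℂ → ℂ)
      (-(deriv V x) / c) x := fun x hx => by
    have := ((((K.diff.differentiableAt ((isOpen_strip η').mem_nhds hx)).hasDerivAt).const_sub
      (E : ℂ)).add_const (m * c ^ 2 : ℂ)).div_const (c : ℂ)
    exact this
  have h1 : ∀ x : ℂ, ‖V x - (E + m * c ^ 2 : ℝ)‖ / c = ‖((E - V x + m * c ^ 2) / c : ℂ)‖ := by
    intro x
    rw [norm_div, hnc, ← norm_neg]; congr 2; push_cast; ring
  have h2 : ∀ x : ℂ, ‖V x - (E - m * c ^ 2 : ℝ)‖ / c = ‖((E - V x - m * c ^ 2) / c : ℂ)‖ := by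
    intro x
    rw [norm_div, hnc, ← norm_neg]; congr 2; push_cast; ring
  have hM4 : m * c ^ 2 / 2 / c = 2 * (m * c) / 4 := by field_simp; ring
  refine ⟨η', r, v / c, C', hη'p, hrp, by positivity, by positivity, by positivity, ?_, hμ, ?_, ?_,
    fun x => ?_, fun x hx => (hder x hx).differentiableAt.differentiableWithinAt, fun s => ?_,
    fun x hx => ?_, fun x hx => ?_, fun x hx => ?_, fun x hx => ?_, fun x hx hxr => ⟨?_, ?_⟩,
    fun x hx hxr => ⟨?_, ?_⟩, fun x hx hxr => ?_, fun x hx hxr => ?_, fun x hx hxr => ?_,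
    fun x hx hxr => ?_, fun s hs => ?_, fun s hs => ?_, fun s hs => ?_, fun s hs => ?_,
    fun e he => ?_, fun e he => ?_⟩
  · linarith [min_le_right (min ra rb) ((t₂ - t₁) / 8)]
  · rw [lt_div_iff₀ hc]; nlinarith
  · rw [div_lt_iff₀ hc]; linarith
  · push_cast; field_simp; ring
  · rw [haim, hreal]; simp
  · rw [norm_div, hnc]
    refine le_trans ?_ hC1
    gcongr
    refine norm_add_le_of_le (norm_sub_le_of_le (by simp) (K.norm_le x hx)) hmn.le
  · rw [norm_div, hnc]
    refine le_trans ?_ hC1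
    gcongr
    refine norm_sub_le_of_le (norm_sub_le_of_le (by simp) (K.norm_le x hx)) hmn.le
  · rw [(hder x hx).deriv, norm_div, norm_neg, hnc]
    have hw := wt_pos (x.re - μ)
    calc ‖deriv V x‖ / c ≤ C * wt (x.re - μ) / c := by gcongr; exact K.deriv_le x hx
      _ = C / c * wt (x.re - μ) := by ring
      _ ≤ _ := by gcongr
  · rw [haim, abs_div, abs_neg, abs_of_pos hc]
    have hw := wt_pos (x.re - μ)
    have h3 : |(V x).im| ≤ C * wt (x.re - μ) * |x.im| := by
      have := (Complex.abs_im_le_norm _).trans (K.norm_sub_re_le hx)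
      rwa [Complex.sub_im, hreal, sub_zero] at this
    calc |(V x).im| / c ≤ C * wt (x.re - μ) * |x.im| / c := by gcongr
      _ = C / c * wt (x.re - μ) * |x.im| := by ring
      _ ≤ _ := by gcongr
  · rw [haim]
    have := div_le_div_of_nonneg_right (Ka.near x hx hxr).1 hc.le
    calc _ = -((V x).im * x.im / c) := by ring
      _ ≤ -(v * x.im ^ 2 / c) := neg_le_neg this
      _ = _ := by ring
  · rw [← h1, ← hM4]
    exact div_le_div_of_nonneg_right (Ka.near x hx hxr).2 hc.le
  · rw [hbim]
    have := div_le_div_of_nonneg_right (Kb.near x hx hxr).1 hc.le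
    calc _ = -((V x).im * x.im / c) := by ring
      _ ≤ -(v * x.im ^ 2 / c) := neg_le_neg this
      _ = _ := by ring
  · rw [← h2, ← hM4]
    exact div_le_div_of_nonneg_right (Kb.near x hx hxr).2 hc.le
  · rw [hare]; gcongr; linarith [Ka.left x hx hxr]
  · rw [hare, ← neg_div]; gcongr; linarith [Ka.right x hx hxr]
  · rw [hbre]; gcongr; linarith [Kb.left x hx hxr]
  · rw [hbre, ← neg_div]; gcongr; linarith [Kb.right x hx hxr]
  · rw [hare]; exact div_pos (by linarith [hX2.lt s hs]) hc
  · rw [hare]; exact div_neg_of_neg_of_pos (by linarith [hX2.gt s hs]) hc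
  · rw [hbre]; exact div_pos (by linarith [hX1.lt s hs]) hc
  · rw [hbre]; exact div_neg_of_neg_of_pos (by linarith [hX1.gt s hs]) hc
  · obtain ⟨R, hR⟩ := K.tendsto_right (e * c) (by positivity)
    refine ⟨R, fun x hx hxR => ?_⟩
    have e1 : (E - V x + m * c ^ 2) / c - ((E - Vp + m * c ^ 2) / c : ℝ) = -(V x - Vp) / c := by
      push_cast; ring
    rw [e1, norm_div, norm_neg, hnc, div_le_iff₀ hc]
    exact hR x hx hxR
  · obtain ⟨R, hR⟩ := K.tendsto_left (e * c) (by positivity)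
    refine ⟨R, fun x hx hxR => ?_⟩
    have e1 : (E - V x + m * c ^ 2) / c - ((E - Vm + m * c ^ 2) / c : ℝ) = -(V x - Vm) / c := by
      push_cast; ring
    rw [e1, norm_div, norm_neg, hnc, div_le_iff₀ hc]
    exact hR x hx hxR

/-- Vertical displacement of the integration path. -/
structure Profile (g g' : ℝ → ℝ) (σ s₀ N ρ g₀ : ℝ) : Prop where
  g₀_pos : 0 < g₀
  hasDerivAt : ∀ s, HasDerivAt g (g' s) s
  cont : Continuous g'
  abs_le : ∀ s, |g s| ≤ ρ
  abs_deriv_le : ∀ s, |g' s| ≤ ρ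
  right : ∀ s, s₀ ≤ s → g₀ ≤ g s ∧ N * wt s * g s ≤ g' s
  left : ∀ s, s ≤ -s₀ → g₀ ≤ σ * g s ∧ σ * g' s ≤ -(N * wt s * (σ * g s))
  zero : g 0 = 0 ∨ g' 0 = 0

lemma exists_profile {σ s₀ N ρ : ℝ} (hσ : σ = 1 ∨ σ = -1) (hs₀ : 0 < s₀) (hN : 0 < N)
    (hρ : 0 < ρ) : ∃ g g' g₀, Profile g g' σ s₀ N ρ g₀ := by
  set q := Real.exp (-(2 * Real.arctan s₀)) with hq
  have hθ₀ : 0 < Real.arctan s₀ := by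
    have := Real.arctan_strictMono hs₀
    rwa [Real.arctan_zero] at this
  have hq0 : 0 < q := Real.exp_pos _
  have hq1 : q < 1 := by rw [hq, Real.exp_lt_one_iff]; linarith
  set K := N * (1 + q) / (1 - q) + 1 with hK
  have h1q : 0 < 1 - q := by linarith
  have hK1 : 1 ≤ K := by
    have : 0 < N * (1 + q) / (1 - q) := by positivity
    linarith
  have hKN : N * (1 + q) ≤ K * (1 - q) := by
    rw [hK, add_mul, div_mul_cancel₀ _ h1q.ne']; linarith
  set B := Real.exp (K * Real.pi) with hB
  have hσa : |σ| = 1 := by rcases hσ with h | h <;> simp [h]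
  set α := ρ / (2 * K * B) with hα
  have hB0 : 0 < B := Real.exp_pos _
  have hαp : 0 < α := by positivity
  set p : ℝ → ℝ := fun s => Real.exp (K * Real.arctan s) with hp
  set n : ℝ → ℝ := fun s => Real.exp (-(K * Real.arctan s)) with hn
  have hpp : ∀ s, 0 < p s := fun s => Real.exp_pos _
  have hnp : ∀ s, 0 < n s := fun s => Real.exp_pos _
  have hpB : ∀ s, p s ≤ B := fun s => Real.exp_le_exp.2 (by
    have := Real.arctan_lt_pi_div_two s
    have := Real.pi_pos
    gcongr
    linarith)
  have hnB : ∀ s, n s ≤ B := fun s => Real.exp_le_exp.2 (by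
    have := Real.neg_pi_div_two_lt_arctan s
    have := Real.pi_pos
    rw [← mul_neg]
    gcongr
    linarith)
  have hdp : ∀ s, HasDerivAt p (K * wt s * p s) s := fun s => by
    have := ((hasDerivAt_arctan_wt s).const_mul K).exp
    exact this.congr_deriv (by simp only [hp]; ring)
  have hdn : ∀ s, HasDerivAt n (-(K * wt s * n s)) s := fun s => by
    have := ((hasDerivAt_arctan_wt s).const_mul K).neg.exp
    exact this.congr_deriv (by simp only [hn, Pi.neg_apply]; ring)
  have hbd : ∀ s τ, |τ| = 1 → |p s + τ * n s| ≤ 2 * B := fun s τ hτ => by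
    refine (abs_add_le _ _).trans ?_
    rw [abs_mul, hτ, one_mul, abs_of_pos (hpp s), abs_of_pos (hnp s)]
    linarith [hpB s, hnB s]
  have hrat : ∀ s, s₀ ≤ s → n s ≤ q * p s ∧ 1 ≤ p s := by
    intro s hs
    have hθ : Real.arctan s₀ ≤ Real.arctan s := Real.arctan_strictMono.monotone hs
    constructor
    · simp only [hn, hq, hp, ← Real.exp_add]
      refine Real.exp_le_exp.2 ?_
      nlinarith
    · exact Real.one_le_exp (by nlinarith)
  have hrat' : ∀ s, s ≤ -s₀ → p s ≤ q * n s ∧ 1 ≤ n s := by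
    intro s hs
    have := hrat (-s) (by linarith)
    simpa [hp, hn, Real.arctan_neg] using this
  have hgc : Continuous fun s => α * (K * wt s * (p s + -σ * n s)) := by
    have c1 : Continuous p := continuous_iff_continuousAt.2 fun s => (hdp s).continuousAt
    have c2 : Continuous n := continuous_iff_continuousAt.2 fun s => (hdn s).continuousAt
    have c3 := continuous_wt
    fun_prop
  have hα2 : α * (2 * K * B) = ρ := by rw [hα]; field_simp
  refine ⟨fun s => α * (p s + σ * n s), fun s => α * (K * wt s * (p s + -σ * n s)), α * (1 - q), 
    by positivity, fun s => ?_, hgc, fun s => ?_, fun s => ?_, fun s hs => ⟨?_, ?_⟩,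
    fun s hs => ⟨?_, ?_⟩, ?_⟩
  · exact (((hdp s).add ((hdn s).const_mul σ)).const_mul α).congr_deriv (by ring)
  · rw [abs_mul, abs_of_pos hαp]
    calc α * |p s + σ * n s| ≤ α * (2 * B) := by gcongr; exact hbd s σ hσa
      _ ≤ α * (2 * K * B) := by gcongr; linarith
      _ = ρ := hα2
  · have hw := wt_pos s
    have hw1 := wt_le_one s
    rw [abs_mul, abs_of_pos hαp, abs_mul, abs_of_pos (by positivity)]
    calc α * (K * wt s * |p s + -σ * n s|) ≤ α * (K * 1 * (2 * B)) := by
          gcongr; exact hbd s _ (by rwa [abs_neg])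
      _ = ρ := by rw [← hα2]; ring
  · obtain ⟨h1, h2⟩ := hrat s hs
    gcongr
    rcases hσ with rfl | rfl <;> nlinarith [hnp s]
  · obtain ⟨h1, h2⟩ := hrat s hs
    have hw := wt_pos s
    have key : N * (p s + σ * n s) ≤ K * (p s + -σ * n s) := by
      have e1 : p s + σ * n s ≤ (1 + q) * p s := by rcases hσ with rfl | rfl <;> nlinarith [hnp s, hpp s]
      have e2 : (1 - q) * p s ≤ p s + -σ * n s := by rcases hσ with rfl | rfl <;> nlinarith [hnp s, hpp s]
      calc _ ≤ N * ((1 + q) * p s) := by gcongr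
        _ = N * (1 + q) * p s := by ring
        _ ≤ K * (1 - q) * p s := by gcongr
        _ = K * ((1 - q) * p s) := by ring
        _ ≤ _ := by gcongr
    calc _ = α * wt s * (N * (p s + σ * n s)) := by ring
      _ ≤ α * wt s * (K * (p s + -σ * n s)) := by gcongr
      _ = _ := by ring
  · obtain ⟨h1, h2⟩ := hrat' s hs
    have : σ * (α * (p s + σ * n s)) = α * (n s + σ * p s) := by
      rcases hσ with rfl | rfl <;> ring
    rw [this]
    gcongr
    rcases hσ with rfl | rfl <;> nlinarith [hpp s]
  · obtain ⟨h1, h2⟩ := hrat' s hs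
    have hw := wt_pos s
    have key : N * (n s + σ * p s) ≤ K * (n s + -σ * p s) := by
      have e1 : n s + σ * p s ≤ (1 + q) * n s := by rcases hσ with rfl | rfl <;> nlinarith [hnp s, hpp s]
      have e2 : (1 - q) * n s ≤ n s + -σ * p s := by rcases hσ with rfl | rfl <;> nlinarith [hnp s, hpp s]
      calc _ ≤ N * ((1 + q) * n s) := by gcongr
        _ = N * (1 + q) * n s := by ring
        _ ≤ K * (1 - q) * n s := by gcongr
        _ = K * ((1 - q) * n s) := by ring
        _ ≤ _ := by gcongr
    have e3 : σ * (α * (K * wt s * (p s + -σ * n s))) = -(α * wt s * (K * (n s + -σ * p s))) := by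
      rcases hσ with rfl | rfl <;> ring
    have e4 : N * wt s * (σ * (α * (p s + σ * n s))) = α * wt s * (N * (n s + σ * p s)) := by
      rcases hσ with rfl | rfl <;> ring
    rw [e3, e4]
    gcongr
  · rcases hσ with rfl | rfl
    · right; simp [hp, hn]
    · left; simp [hp, hn]

lemma Complex.log_I_mul {z : ℂ} (hz : 0 < z.re) : log (I * z) = log z + Real.pi / 2 * I := by
  have h := abs_lt.1 (Complex.abs_arg_lt_pi_div_two_iff.2 (Or.inl hz))
  have hz0 : z ≠ 0 := fun h0 => by simp [h0] at hz
  rw [Complex.log_mul I_ne_zero hz0 (by rw [Complex.arg_I]; constructor <;> linarith),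
    Complex.log_I, add_comm]

lemma Complex.log_neg_I_mul {z : ℂ} (hz : 0 < z.re) :
    log (-I * z) = log z - Real.pi / 2 * I := by
  have h := abs_lt.1 (Complex.abs_arg_lt_pi_div_two_iff.2 (Or.inl hz))
  have hz0 : z ≠ 0 := fun h0 => by simp [h0] at hz
  rw [Complex.log_mul (neg_ne_zero.2 I_ne_zero) hz0
    (by rw [Complex.arg_neg_I]; constructor <;> linarith), Complex.log_neg_I]
  ring

/-- The branch of `√(zw)` cut along the rays adapted to the sign `σ`. -/
noncomputable def branchP (σ : ℝ) (z w : ℂ) : ℂ :=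
  Complex.exp (-(Real.pi / 4 * I) * (1 + σ)) *
    Complex.exp ((Complex.log (I * z) + Complex.log (I * σ * w)) / 2)

/-- The branch of `(z/w)^{1/4}` matching `branchP`. -/
noncomputable def branchA (σ : ℝ) (z w : ℂ) : ℂ :=
  Complex.exp (Real.pi / 8 * I * (σ - 1)) *
    Complex.exp ((Complex.log (I * z) - Complex.log (I * σ * w)) / 4)

section

variable {σ : ℝ} {z w : ℂ}

lemma exp_neg_half_pi_mul_I : Complex.exp (-(Real.pi / 2 * I)) = -I := by
  rw [Complex.exp_neg, Complex.exp_pi_div_two_mul_I, Complex.inv_I]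

lemma ofReal_sign_ne_zero (hσ : σ = 1 ∨ σ = -1) : (σ : ℂ) ≠ 0 := by
  rcases hσ with rfl | rfl <;> norm_num

lemma ofReal_sign_mul_self (hσ : σ = 1 ∨ σ = -1) : (σ : ℂ) * σ = 1 := by
  rcases hσ with rfl | rfl <;> norm_num

lemma branchP_sq (hσ : σ = 1 ∨ σ = -1) (hz : z ≠ 0) (hw : w ≠ 0) : branchP σ z w ^ 2 = z * w := by
  have hz' : I * z ≠ 0 := mul_ne_zero I_ne_zero hz
  have hw' : I * σ * w ≠ 0 := mul_ne_zero (mul_ne_zero I_ne_zero (ofReal_sign_ne_zero hσ)) hw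
  rw [branchP, mul_pow, ← Complex.exp_nat_mul, ← Complex.exp_nat_mul]
  rw [show ((2 : ℕ) : ℂ) * ((Complex.log (I * z) + Complex.log (I * σ * w)) / 2) =
    Complex.log (I * z) + Complex.log (I * σ * w) by push_cast; ring, Complex.exp_add,
    Complex.exp_log hz', Complex.exp_log hw']
  rcases hσ with rfl | rfl
  · rw [show ((2 : ℕ) : ℂ) * (-(Real.pi / 4 * I) * (1 + (1 : ℝ))) = -(Real.pi * I) by
      push_cast; ring, Complex.exp_neg, Complex.exp_pi_mul_I]
    push_cast
    linear_combination (-z * w) * Complex.I_sq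
  · push_cast
    simp only [add_neg_cancel, mul_zero, Complex.exp_zero]
    linear_combination (-z * w) * Complex.I_sq

lemma branchA_sq_mul (hz : z ≠ 0) : branchA σ z w ^ 2 * branchP σ z w = z := by
  have hz' : I * z ≠ 0 := mul_ne_zero I_ne_zero hz
  rw [branchA, branchP, mul_pow, ← Complex.exp_nat_mul, ← Complex.exp_nat_mul, ← Complex.exp_add,
    ← Complex.exp_add, ← Complex.exp_add]
  rw [show ((2 : ℕ) : ℂ) * (Real.pi / 8 * I * (σ - 1)) +
      (2 : ℕ) * ((Complex.log (I * z) - Complex.log (I * σ * w)) / 4) +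
      (-(Real.pi / 4 * I) * (1 + σ) + (Complex.log (I * z) + Complex.log (I * σ * w)) / 2)
      = -(Real.pi / 2 * I) + Complex.log (I * z) by push_cast; ring, Complex.exp_add,
      exp_neg_half_pi_mul_I, Complex.exp_log hz']
  linear_combination (-z) * Complex.I_sq

lemma branchA_ne_zero : branchA σ z w ≠ 0 := mul_ne_zero (Complex.exp_ne_zero _) (Complex.exp_ne_zero _)

lemma branchP_ne_zero : branchP σ z w ≠ 0 := mul_ne_zero (Complex.exp_ne_zero _) (Complex.exp_ne_zero _)

lemma log_sign_mul_of_pos (hσ : σ = 1 ∨ σ = -1) (hw : 0 < w.re) :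
    Complex.log (I * σ * w) = Complex.log w + σ * (Real.pi / 2 * I) := by
  rcases hσ with rfl | rfl
  · simpa using Complex.log_I_mul hw
  · have := Complex.log_neg_I_mul hw
    push_cast
    rw [show I * -1 * w = -I * w by ring, this]; ring

lemma log_sign_mul_of_neg (hσ : σ = 1 ∨ σ = -1) (hw : w.re < 0) :
    Complex.log (I * σ * w) = Complex.log (-w) - σ * (Real.pi / 2 * I) := by
  have := log_sign_mul_of_pos (σ := -σ) (w := -w) (by rcases hσ with rfl | rfl <;> simp) (by simpa)
  push_cast at this
  rw [show I * -(σ : ℂ) * -w = I * σ * w by ring] at this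
  rw [this]; ring

lemma Complex.log_I_mul_of_neg (hz : z.re < 0) :
    Complex.log (I * z) = Complex.log (-z) - Real.pi / 2 * I := by
  simpa using log_sign_mul_of_neg (σ := 1) (Or.inl rfl) hz

lemma branchP_pos_pos (hσ : σ = 1 ∨ σ = -1) (hz : 0 < z.re) (hw : 0 < w.re) :
    branchP σ z w = Complex.exp ((Complex.log z + Complex.log w) / 2) := by
  rw [branchP, Complex.log_I_mul hz, log_sign_mul_of_pos hσ hw, ← Complex.exp_add]
  congr 1; ring

lemma branchP_pos_neg (hσ : σ = 1 ∨ σ = -1) (hz : 0 < z.re) (hw : w.re < 0) :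
    branchP σ z w = -(σ * I) * Complex.exp ((Complex.log z + Complex.log (-w)) / 2) := by
  rw [branchP, Complex.log_I_mul hz, log_sign_mul_of_neg hσ hw, ← Complex.exp_add]
  rw [show -(Real.pi / 4 * I) * (1 + (σ : ℂ)) + (Complex.log z + Real.pi / 2 * I +
    (Complex.log (-w) - σ * (Real.pi / 2 * I))) / 2 =
    -(σ * (Real.pi / 2 * I)) + (Complex.log z + Complex.log (-w)) / 2 by ring, Complex.exp_add]
  congr 1
  rcases hσ with rfl | rfl
  · simpa using exp_neg_half_pi_mul_I
  · simp

lemma branchP_neg_neg (hσ : σ = 1 ∨ σ = -1) (hz : z.re < 0) (hw : w.re < 0) :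
    branchP σ z w = -σ * Complex.exp ((Complex.log (-z) + Complex.log (-w)) / 2) := by
  rw [branchP, Complex.log_I_mul_of_neg hz, log_sign_mul_of_neg hσ hw, ← Complex.exp_add]
  rw [show -(Real.pi / 4 * I) * (1 + (σ : ℂ)) + (Complex.log (-z) - Real.pi / 2 * I +
    (Complex.log (-w) - σ * (Real.pi / 2 * I))) / 2 =
    -((1 + σ) * (Real.pi / 2 * I)) + (Complex.log (-z) + Complex.log (-w)) / 2 by ring,
    Complex.exp_add]
  congr 1
  rcases hσ with rfl | rfl
  · rw [show -((1 + ((1 : ℝ) : ℂ)) * (Real.pi / 2 * I)) = -(Real.pi * I) by push_cast; ring,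
      Complex.exp_neg, Complex.exp_pi_mul_I]; simp
  · simp

lemma branchA_pos_pos (hσ : σ = 1 ∨ σ = -1) (hz : 0 < z.re) (hw : 0 < w.re) :
    branchA σ z w = Complex.exp ((Complex.log z - Complex.log w) / 4) := by
  rw [branchA, Complex.log_I_mul hz, log_sign_mul_of_pos hσ hw, ← Complex.exp_add]
  congr 1; ring

lemma branchA_neg_neg (hσ : σ = 1 ∨ σ = -1) (hz : z.re < 0) (hw : w.re < 0) :
    branchA σ z w = Complex.exp (Real.pi / 4 * I * (σ - 1)) *
      Complex.exp ((Complex.log (-z) - Complex.log (-w)) / 4) := by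
  rw [branchA, Complex.log_I_mul_of_neg hz, log_sign_mul_of_neg hσ hw, ← Complex.exp_add,
    ← Complex.exp_add]
  congr 1; ring

lemma norm_branchP_sq (hσ : σ = 1 ∨ σ = -1) (hz : z ≠ 0) (hw : w ≠ 0) :
    ‖branchP σ z w‖ ^ 2 = ‖z‖ * ‖w‖ := by
  rw [← norm_pow, branchP_sq hσ hz hw, norm_mul]

end

/-- The star-shaped domain containing the path and the segment between the turning points. -/
def kleinDom (σ t₁ t₂ η r : ℝ) : Set ℂ :=
  {x | x ∈ strip η ∧ (0 < x.im ∨ x.re < t₂ - r) ∧ (0 < σ * x.im ∨ t₁ + r < x.re)}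

lemma isOpen_kleinDom (σ t₁ t₂ η r : ℝ) : IsOpen (kleinDom σ t₁ t₂ η r) := by
  refine (isOpen_strip η).inter (IsOpen.inter ?_ ?_)
  · exact (isOpen_lt continuous_const Complex.continuous_im).union
      (isOpen_lt Complex.continuous_re continuous_const)
  · exact (isOpen_lt continuous_const (continuous_const.mul Complex.continuous_im)).union
      (isOpen_lt continuous_const Complex.continuous_re)

namespace KleinPair

variable {a b : ℂ → ℂ} {t₁ t₂ μ M am ap η r v C σ : ℝ}

lemma mid_lt (H : KleinPair a b t₁ t₂ μ M am ap η r v C) : μ + 4 * r ≤ t₂ := by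
  have := H.gap; have := H.mid; linarith

lemma lt_mid (H : KleinPair a b t₁ t₂ μ M am ap η r v C) : t₁ + 4 * r ≤ μ := by
  have := H.gap; have := H.mid; linarith

lemma starConvex_dom (H : KleinPair a b t₁ t₂ μ M am ap η r v C) :
    StarConvex ℝ (μ : ℂ) (kleinDom σ t₁ t₂ η r) := by
  intro x hx p q hp hq hpq
  have hre : (p • (μ : ℂ) + q • x).re = p * μ + q * x.re := by simp
  have him : (p • (μ : ℂ) + q • x).im = q * x.im := by simp
  have hr := H.r_pos
  have h1 := H.mid_lt
  have h2 := H.lt_mid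
  refine ⟨(convex_strip η) (ofReal_mem_strip H.η_pos μ) hx.1 hp hq hpq, ?_, ?_⟩
  · rw [hre, him]
    rcases eq_or_lt_of_le hq with h0 | h0
    · right; rw [← h0] at hpq ⊢; rw [add_zero] at hpq; rw [hpq]; linarith
    · rcases hx.2.1 with h | h
      · left; positivity
      · right
        have : p = 1 - q := by linarith
        subst this
        nlinarith
  · rw [hre, him]
    rcases eq_or_lt_of_le hq with h0 | h0
    · right; rw [← h0] at hpq ⊢; rw [add_zero] at hpq; rw [hpq]; linarith
    · rcases hx.2.2 with h | h
      · left; rw [mul_left_comm]; positivity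
      · right
        have : p = 1 - q := by linarith
        subst this
        nlinarith

lemma b_im (H : KleinPair a b t₁ t₂ μ M am ap η r v C) (x : ℂ) : (b x).im = (a x).im := by
  rw [H.eq_add]; simp

lemma a_re (H : KleinPair a b t₁ t₂ μ M am ap η r v C) (x : ℂ) : (a x).re = (b x).re + M := by
  rw [H.eq_add]; simp

lemma slit_a (H : KleinPair a b t₁ t₂ μ M am ap η r v C) {x : ℂ}
    (hx : x ∈ kleinDom σ t₁ t₂ η r) : I * a x ∈ Complex.slitPlane := by
  have hv := H.v_pos
  rw [Complex.mem_slitPlane_iff]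
  simp only [Complex.mul_re, Complex.I_re, Complex.I_im, Complex.mul_im, zero_mul, one_mul,
    zero_sub, zero_add]
  rcases le_total x.re (t₂ - r) with h | h
  · right; linarith [H.left_a x hx.1 h]
  rcases le_total (t₂ + r) x.re with h' | h'
  · right; linarith [H.right_a x hx.1 h']
  · left
    have him : 0 < x.im := hx.2.1.resolve_right (not_lt.2 h)
    have := (H.near_a x hx.1 (abs_le.2 ⟨by linarith, by linarith⟩)).1
    have h3 : 0 < v * x.im ^ 2 := by positivity
    nlinarith

lemma slit_b (H : KleinPair a b t₁ t₂ μ M am ap η r v C) (hσ : σ = 1 ∨ σ = -1) {x : ℂ}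
    (hx : x ∈ kleinDom σ t₁ t₂ η r) : I * σ * b x ∈ Complex.slitPlane := by
  have hv := H.v_pos
  have e1 : (I * σ * b x).re = -σ * (b x).im := by simp [Complex.mul_re]
  have e2 : (I * σ * b x).im = σ * (b x).re := by simp [Complex.mul_im]
  rw [Complex.mem_slitPlane_iff, e1, e2]
  have hσ0 : σ ≠ 0 := by rcases hσ with rfl | rfl <;> norm_num
  rcases le_total (t₁ + r) x.re with h | h
  · right; exact mul_ne_zero hσ0 (by linarith [H.right_b x hx.1 h])
  rcases le_total x.re (t₁ - r) with h' | h'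
  · right; exact mul_ne_zero hσ0 (by linarith [H.left_b x hx.1 h'])
  · left
    have him : 0 < σ * x.im := hx.2.2.resolve_right (not_lt.2 h)
    have := (H.near_b x hx.1 (abs_le.2 ⟨by linarith, by linarith⟩)).1
    have h0 : x.im ≠ 0 := by rintro h0; simp [h0] at him
    have h3 : 0 < v * x.im ^ 2 := by positivity
    rcases hσ with rfl | rfl <;> nlinarith

lemma a_ne_zero (H : KleinPair a b t₁ t₂ μ M am ap η r v C) {x : ℂ}
    (hx : x ∈ kleinDom σ t₁ t₂ η r) : a x ≠ 0 := by
  have := Complex.slitPlane_ne_zero (H.slit_a hx)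
  exact right_ne_zero_of_mul this

lemma b_ne_zero (H : KleinPair a b t₁ t₂ μ M am ap η r v C) (hσ : σ = 1 ∨ σ = -1) {x : ℂ}
    (hx : x ∈ kleinDom σ t₁ t₂ η r) : b x ≠ 0 := by
  have := Complex.slitPlane_ne_zero (H.slit_b hσ hx)
  exact right_ne_zero_of_mul this

lemma hasDerivAt_a (H : KleinPair a b t₁ t₂ μ M am ap η r v C) {x : ℂ} (hx : x ∈ strip η) :
    HasDerivAt a (deriv a x) x :=
  (H.diff_a.differentiableAt ((isOpen_strip η).mem_nhds hx)).hasDerivAt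

lemma hasDerivAt_b (H : KleinPair a b t₁ t₂ μ M am ap η r v C) {x : ℂ} (hx : x ∈ strip η) :
    HasDerivAt b (deriv a x) x := by
  have e : b = fun x => a x - M := funext fun x => by rw [H.eq_add]; ring
  rw [e]
  exact (H.hasDerivAt_a hx).sub_const _

end KleinPair

/-- The coupling `A'/A` of the diagonalised system. -/
noncomputable def kleinQ (a b : ℂ → ℂ) (x : ℂ) : ℂ := deriv a x * ((a x)⁻¹ - (b x)⁻¹) / 4

namespace KleinPair

variable {a b : ℂ → ℂ} {t₁ t₂ μ M am ap η r v C σ : ℝ}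

lemma hasDerivAt_branchA (H : KleinPair a b t₁ t₂ μ M am ap η r v C) (hσ : σ = 1 ∨ σ = -1) {x : ℂ}
    (hx : x ∈ kleinDom σ t₁ t₂ η r) :
    HasDerivAt (fun x => branchA σ (a x) (b x)) (kleinQ a b x * branchA σ (a x) (b x)) x := by
  have h1 := ((H.hasDerivAt_a hx.1).const_mul I).clog (H.slit_a hx)
  have h2 := ((H.hasDerivAt_b hx.1).const_mul (I * σ)).clog (H.slit_b hσ hx)
  have ha := H.a_ne_zero hx
  have hb := H.b_ne_zero hσ hx
  have hs := ofReal_sign_ne_zero hσ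
  refine ((((h1.sub h2).div_const 4).cexp).const_mul _).congr_deriv ?_
  rw [branchA, kleinQ]
  have e1 : I * deriv a x / (I * a x) = deriv a x * (a x)⁻¹ := by field_simp
  have e2 : I * σ * deriv a x / (I * σ * b x) = deriv a x * (b x)⁻¹ := by field_simp
  rw [e1, e2]
  simp only [Pi.sub_apply]
  ring

lemma differentiableOn_branchP (H : KleinPair a b t₁ t₂ μ M am ap η r v C) (hσ : σ = 1 ∨ σ = -1) :
    DifferentiableOn ℂ (fun x => branchP σ (a x) (b x)) (kleinDom σ t₁ t₂ η r) := by
  intro x hx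
  have h1 := ((H.hasDerivAt_a hx.1).const_mul I).clog (H.slit_a hx)
  have h2 := ((H.hasDerivAt_b hx.1).const_mul (I * σ)).clog (H.slit_b hσ hx)
  exact ((((h1.add h2).div_const 2).cexp).const_mul _).differentiableAt.differentiableWithinAt

lemma differentiableOn_kleinQ (H : KleinPair a b t₁ t₂ μ M am ap η r v C)
    (hσ : σ = 1 ∨ σ = -1) :
    DifferentiableOn ℂ (kleinQ a b) (kleinDom σ t₁ t₂ η r) := by
  have hs : kleinDom σ t₁ t₂ η r ⊆ strip η := fun x hx => hx.1
  have hd : DifferentiableOn ℂ (deriv a) (kleinDom σ t₁ t₂ η r) :=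
    (H.diff_a.deriv (isOpen_strip η)).mono hs
  have hb : DifferentiableOn ℂ b (kleinDom σ t₁ t₂ η r) := fun x hx =>
    (H.hasDerivAt_b hx.1).differentiableAt.differentiableWithinAt
  exact (hd.mul (((H.diff_a.mono hs).inv fun x hx => H.a_ne_zero hx).sub
    (hb.inv fun x hx => H.b_ne_zero hσ hx))).div_const 4

lemma re_im_ne_zero_of_far {R J d K v : ℝ} (hK : 0 < K) (hR : v ^ 2 / 2 ≤ R) (hJ : |J| ≤ K)
    (hd : 2 * K ≤ v ^ 2 * d) (hd2 : d ^ 2 ≤ 1 / 4) (h : R * (2 * d) + J * (1 - d ^ 2) = 0) :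
    False := by
  have hd0 : 0 < d := by
    by_contra! h0
    have := mul_nonpos_of_nonneg_of_nonpos (sq_nonneg v) h0
    linarith
  have h1 : v ^ 2 / 2 * (2 * d) ≤ R * (2 * d) := by gcongr
  have h2 : |J * (1 - d ^ 2)| ≤ K * 1 := by
    rw [abs_mul]
    refine mul_le_mul hJ ?_ (abs_nonneg _) hK.le
    rw [abs_of_nonneg (by linarith)]
    linarith [sq_nonneg d]
  have h3 := (abs_le.1 h2).1
  linarith

lemma re_neg_of_neg {R J d : ℝ} (hR : R < 0) (hd2 : d ^ 2 ≤ 1 / 4)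
    (h : R * (2 * d) + J * (1 - d ^ 2) = 0) : R * (1 - d ^ 2) - J * (2 * d) < 0 := by
  have h1 : 0 < 1 - d ^ 2 := by linarith
  have e : (R * (1 - d ^ 2) - J * (2 * d)) * (1 - d ^ 2) = R * ((1 - d ^ 2) ^ 2 + (2 * d) ^ 2) := by
    linear_combination -(2 * d) * h
  have h2 : R * ((1 - d ^ 2) ^ 2 + (2 * d) ^ 2) < 0 := mul_neg_of_neg_of_pos hR (by positivity)
  by_contra! h0
  have := mul_nonneg h0 h1.le
  linarith

/-- Along the path, `F γ'²` avoids the nonnegative real axis. -/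
lemma re_neg_of_im_eq_zero (H : KleinPair a b t₁ t₂ μ M am ap η r v C) (hσ : σ = 1 ∨ σ = -1)
    {x : ℂ} (hx : x ∈ strip η) {d : ℝ} (hd : |d| ≤ 1 / 2) (hy : C * |x.im| ≤ v / 2)
    (hright : t₂ - r ≤ x.re → 0 < x.im ∧ 4 * C ^ 2 / v ^ 2 * wt (x.re - μ) * x.im ≤ d)
    (hleft : x.re ≤ t₁ + r →
      0 < σ * x.im ∧ σ * d ≤ -(4 * C ^ 2 / v ^ 2 * wt (x.re - μ) * (σ * x.im)))
    (him : (a x * b x * (1 + d * I) ^ 2).im = 0) : (a x * b x * (1 + d * I) ^ 2).re < 0 := by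
  have hv := H.v_pos
  have hC := H.C_pos
  have hM := H.M_pos
  have hw := wt_pos (x.re - μ)
  have hw1 := wt_le_one (x.re - μ)
  have hgap := H.gap
  have hr := H.r_pos
  set A := (a x).re with hA
  set Y := (a x).im with hY
  set B := (b x).re with hB
  have hAB : A = B + M := H.a_re x
  have hbY : (b x).im = Y := H.b_im x
  set R := A * B - Y ^ 2 with hR
  set J := Y * (A + B) with hJ
  have hFre : (a x * b x).re = R := by
    rw [Complex.mul_re, hbY, hR]; ring
  have hFim : (a x * b x).im = J := by
    rw [Complex.mul_im, hbY, hJ]; ring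
  have e1 : (a x * b x * (1 + d * I) ^ 2).re = R * (1 - d ^ 2) - J * (2 * d) := by
    rw [Complex.mul_re, hFre, hFim]
    simp only [pow_two, Complex.mul_re, Complex.mul_im, Complex.add_re, Complex.add_im,
      Complex.one_re, Complex.one_im, Complex.ofReal_re, Complex.ofReal_im, Complex.I_re,
      Complex.I_im]
    ring
  have e2 : (a x * b x * (1 + d * I) ^ 2).im = R * (2 * d) + J * (1 - d ^ 2) := by
    rw [Complex.mul_im, hFre, hFim]
    simp only [pow_two, Complex.mul_re, Complex.mul_im, Complex.add_re, Complex.add_im,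
      Complex.one_re, Complex.one_im, Complex.ofReal_re, Complex.ofReal_im, Complex.I_re,
      Complex.I_im]
    ring
  rw [e2] at him
  rw [e1]
  have hd2 : d ^ 2 ≤ 1 / 4 := by
    have := abs_le.1 hd
    nlinarith
  have hid : (R * (1 - d ^ 2) - J * (2 * d)) * (2 * d)
      = -J * ((2 * d) ^ 2 + (1 - d ^ 2) ^ 2) := by
    linear_combination (1 - d ^ 2) * him
  have hpos : 0 < (2 * d) ^ 2 + (1 - d ^ 2) ^ 2 := by nlinarith [sq_nonneg (2 * d)]
  have hYle : |Y| ≤ C * wt (x.re - μ) * |x.im| := H.im_le x hx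
  have hYv : |Y| ≤ v / 2 := by
    refine hYle.trans (le_trans ?_ hy)
    calc _ ≤ C * 1 * |x.im| := by gcongr
      _ = _ := by ring
  have hAC : |A| ≤ C := (Complex.abs_re_le_norm _).trans (H.norm_a_le x hx)
  have hBC : |B| ≤ C := (Complex.abs_re_le_norm _).trans (H.norm_b_le x hx)
  have hJle : |J| ≤ 2 * C ^ 2 * wt (x.re - μ) * |x.im| := by
    rw [hJ, abs_mul]
    calc |Y| * |A + B| ≤ (C * wt (x.re - μ) * |x.im|) * (C + C) := by
          gcongr; exact (abs_add_le _ _).trans (add_le_add hAC hBC)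
      _ = _ := by ring
  have hYsq : Y ^ 2 ≤ v ^ 2 / 4 := by rw [← sq_abs]; nlinarith [abs_nonneg Y]
  set N := 4 * C ^ 2 / v ^ 2 with hN
  have hNv : N * v ^ 2 = 4 * C ^ 2 := by rw [hN]; field_simp
  rcases le_total (t₂ - r) x.re with h | h
  · obtain ⟨hi, hdw⟩ := hright h
    have hNw : 0 ≤ N * wt (x.re - μ) * x.im := by positivity
    have hd0 : 0 ≤ d := hNw.trans hdw
    have fin : 0 < J → R * (1 - d ^ 2) - J * (2 * d) < 0 := by
      intro hJp
      by_contra! hcon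
      have h1 : 0 ≤ (R * (1 - d ^ 2) - J * (2 * d)) * (2 * d) := by positivity
      have h2 : 0 < J * ((2 * d) ^ 2 + (1 - d ^ 2) ^ 2) := by positivity
      linarith
    rcases le_total (t₂ + r) x.re with h' | h'
    · exfalso
      have hRv : v ^ 2 / 2 ≤ R := by
        have := mul_le_mul (show v ≤ -A by linarith [H.right_a x hx h'])
          (show v ≤ -B by linarith [H.right_b x hx (by linarith)]) hv.le (by
            linarith [H.right_a x hx h'])
        rw [hR]; linarith [sq_nonneg v]
      rw [abs_of_pos hi] at hJle
      refine re_im_ne_zero_of_far (by positivity) hRv hJle ?_ hd2 him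
      calc 2 * (2 * C ^ 2 * wt (x.re - μ) * x.im) = v ^ 2 * (N * wt (x.re - μ) * x.im) := by
            linear_combination -(wt (x.re - μ) * x.im) * hNv
        _ ≤ _ := by gcongr
    · apply fin
      obtain ⟨h1, h2⟩ := H.near_a x hx (abs_le.2 ⟨by linarith, by linarith⟩)
      have hA4 : A ≤ M / 4 := (le_abs_self A).trans ((Complex.abs_re_le_norm _).trans h2)
      have h3 : 0 < v * x.im ^ 2 := by positivity
      have hYn : Y < 0 := by
        by_contra! h0
        have : 0 ≤ Y * x.im := by positivity
        linarith
      exact mul_pos_of_neg_of_neg hYn (by linarith)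
  rcases le_total x.re (t₁ + r) with g | g
  · obtain ⟨hi, hdw⟩ := hleft g
    have hNw : 0 ≤ N * wt (x.re - μ) * (σ * x.im) := by positivity
    have hd0 : σ * d ≤ 0 := by linarith
    have hσ2 : σ * σ = 1 := by rcases hσ with rfl | rfl <;> norm_num
    have hxa : |x.im| = σ * x.im := by
      rcases hσ with rfl | rfl
      · rw [one_mul] at hi ⊢; exact abs_of_pos hi
      · rw [neg_one_mul] at hi ⊢; exact abs_of_neg (by linarith)
    have fin : σ * J < 0 → R * (1 - d ^ 2) - J * (2 * d) < 0 := by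
      intro hJp
      by_contra! hcon
      have h1 : (R * (1 - d ^ 2) - J * (2 * d)) * (2 * (σ * d)) ≤ 0 :=
        mul_nonpos_of_nonneg_of_nonpos hcon (by linarith)
      have h2 : σ * J * ((2 * d) ^ 2 + (1 - d ^ 2) ^ 2) < 0 := mul_neg_of_neg_of_pos hJp hpos
      have h3 : (R * (1 - d ^ 2) - J * (2 * d)) * (2 * (σ * d))
        = -(σ * J * ((2 * d) ^ 2 + (1 - d ^ 2) ^ 2)) := by linear_combination σ * hid
      linarith
    rcases le_total x.re (t₁ - r) with g' | g'
    · exfalso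
      have hRv : v ^ 2 / 2 ≤ R := by
        have : v * v ≤ A * B := mul_le_mul (H.left_a x hx (by linarith)) (H.left_b x hx g') hv.le (by
            linarith [H.left_a x hx (by linarith)])
        rw [hR]; linarith [sq_nonneg v]
      have hσJ : |-(σ * J)| ≤ 2 * C ^ 2 * wt (x.re - μ) * (σ * x.im) := by
        rw [abs_neg, abs_mul, ← hxa]
        rcases hσ with rfl | rfl <;> simpa using hJle
      refine re_im_ne_zero_of_far (d := -(σ * d)) (by positivity) hRv hσJ ?_ ?_ ?_
      · calc 2 * (2 * C ^ 2 * wt (x.re - μ) * (σ * x.im))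
            = v ^ 2 * (N * wt (x.re - μ) * (σ * x.im)) := by
              linear_combination -(wt (x.re - μ) * (σ * x.im)) * hNv
          _ ≤ _ := by gcongr; linarith
      · rw [neg_sq, mul_pow, pow_two σ, hσ2, one_mul]; exact hd2
      · linear_combination -σ * him + σ * J * d ^ 2 * hσ2
    · apply fin
      obtain ⟨h1, h2⟩ := H.near_b x hx (abs_le.2 ⟨by linarith, by linarith⟩)
      rw [hbY] at h1
      have hB4 : -(M / 4) ≤ B := by
        have := (neg_abs_le B)
        have := (Complex.abs_re_le_norm (b x)).trans h2
        linarith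
      have hx0 : x.im ≠ 0 := by rintro h0; simp [h0] at hi
      have h3 : 0 < v * x.im ^ 2 := by positivity
      have hYn : σ * Y < 0 := by
        by_contra! h0
        have : 0 ≤ σ * Y * (σ * x.im) := by positivity
        have e : σ * Y * (σ * x.im) = Y * x.im := by linear_combination Y * x.im * hσ2
        linarith
      have : σ * J = σ * Y * (A + B) := by rw [hJ]; ring
      rw [this]
      exact mul_neg_of_neg_of_pos hYn (by linarith)
  · have hAv := H.left_a x hx h
    have hBv := H.right_b x hx g
    have hRn : R < 0 := by
      have : A * B < 0 := mul_neg_of_pos_of_neg (by linarith) (by linarith)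
      linarith [sq_nonneg Y]
    exact re_neg_of_neg hRn hd2 him

end KleinPair

lemma wt_le_three_mul {x y : ℝ} (h : |x - y| ≤ 1) : wt x ≤ 3 * wt y := by
  have h1 := abs_le.1 h
  unfold wt
  rw [← div_eq_mul_inv, ← one_div, div_le_div_iff₀ (by positivity) (by positivity)]
  nlinarith [sq_nonneg (x - y), sq_nonneg (2 * x - y), sq_nonneg (x + y)]

namespace KleinPair

variable {a b : ℂ → ℂ} {t₁ t₂ μ M am ap η r v C σ : ℝ}

lemma min_le_norm_a (H : KleinPair a b t₁ t₂ μ M am ap η r v C) {x : ℂ} (hx : x ∈ strip η) {e : ℝ}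
    (hi : |x.re - t₂| ≤ r → e ≤ |x.im|) (he : 0 < e) : min v (v * e) ≤ ‖a x‖ := by
  have hv := H.v_pos
  rcases le_total x.re (t₂ - r) with h | h
  · exact (min_le_left _ _).trans ((H.left_a x hx h).trans (Complex.re_le_norm _))
  rcases le_total (t₂ + r) x.re with h' | h'
  · refine (min_le_left _ _).trans (le_trans ?_ (Complex.abs_re_le_norm _))
    rw [abs_of_nonpos (by linarith [H.right_a x hx h'])]
    linarith [H.right_a x hx h']
  · have hab : |x.re - t₂| ≤ r := abs_le.2 ⟨by linarith, by linarith⟩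
    have h1 := (H.near_a x hx hab).1
    have h2 := hi hab
    refine (min_le_right _ _).trans (le_trans ?_ (Complex.abs_im_le_norm _))
    have hp : 0 < |x.im| := he.trans_le h2
    have h3 : v * |x.im| * |x.im| ≤ |(a x).im| * |x.im| := by
      rw [← abs_mul, mul_assoc, abs_mul_abs_self]
      have := neg_abs_le ((a x).im * x.im)
      nlinarith
    have h4 := le_of_mul_le_mul_right h3 hp
    exact le_trans (by gcongr) h4

lemma min_le_norm_b (H : KleinPair a b t₁ t₂ μ M am ap η r v C) {x : ℂ} (hx : x ∈ strip η) {e : ℝ}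
    (hi : |x.re - t₁| ≤ r → e ≤ |x.im|) (he : 0 < e) : min v (v * e) ≤ ‖b x‖ := by
  have hv := H.v_pos
  rcases le_total x.re (t₁ - r) with h | h
  · exact (min_le_left _ _).trans ((H.left_b x hx h).trans (Complex.re_le_norm _))
  rcases le_total (t₁ + r) x.re with h' | h'
  · refine (min_le_left _ _).trans (le_trans ?_ (Complex.abs_re_le_norm _))
    rw [abs_of_nonpos (by linarith [H.right_b x hx h'])]
    linarith [H.right_b x hx h']
  · have hab : |x.re - t₁| ≤ r := abs_le.2 ⟨by linarith, by linarith⟩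
    have h1 := (H.near_b x hx hab).1
    have h2 := hi hab
    refine (min_le_right _ _).trans (le_trans ?_ (Complex.abs_im_le_norm _))
    have hp : 0 < |x.im| := he.trans_le h2
    have h3 : v * |x.im| * |x.im| ≤ |(b x).im| * |x.im| := by
      rw [← abs_mul, mul_assoc, abs_mul_abs_self]
      have := neg_abs_le ((b x).im * x.im)
      nlinarith
    have h4 := le_of_mul_le_mul_right h3 hp
    exact le_trans (by gcongr) h4

lemma norm_branchP_le (H : KleinPair a b t₁ t₂ μ M am ap η r v C) (hσ : σ = 1 ∨ σ = -1) {x : ℂ}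
    (hx : x ∈ strip η) (ha : a x ≠ 0) (hb : b x ≠ 0) : ‖branchP σ (a x) (b x)‖ ≤ C := by
  refine le_of_sq_le_sq ?_ H.C_pos.le
  rw [norm_branchP_sq hσ ha hb, pow_two]
  exact mul_le_mul (H.norm_a_le x hx) (H.norm_b_le x hx) (norm_nonneg _) H.C_pos.le

/-- A path passing the two turning points on prescribed sides, along which the phase is
monotone. -/
lemma exists_transportPath (H : KleinPair a b t₁ t₂ μ M am ap η r v C) (hσ : σ = 1 ∨ σ = -1) :
    ∃ g g' : ℝ → ℝ, ∃ δ C' : ℝ, (∀ s, |g s| ≤ η / 2) ∧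
      TransportPath (kleinDom σ t₁ t₂ η r) (fun x => σ * I * branchP σ (a x) (b x)) (kleinQ a b)
        (fun s => μ + s + g s * I) (fun s => 1 + g' s * I) δ C' := by
  have hη := H.η_pos
  have hr := H.r_pos
  have hv := H.v_pos
  have hC := H.C_pos
  have hM := H.M_pos
  have hgap := H.gap
  have hmid := H.mid
  obtain ⟨g, g', g₀, G⟩ := exists_profile (s₀ := (t₂ - t₁) / 2 - 2 * r) (N := 4 * C ^ 2 / v ^ 2)
    (ρ := min (1 / 2) (min (v / (2 * C)) (η / 2))) hσ (by linarith) (by positivity) (by positivity)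
  have hg₀ := G.g₀_pos
  have hgη : ∀ s, |g s| ≤ η / 2 := fun s =>
    (G.abs_le s).trans ((min_le_right _ _).trans (min_le_right _ _))
  have hgv : ∀ s, |g s| ≤ v / (2 * C) := fun s =>
    (G.abs_le s).trans ((min_le_right _ _).trans (min_le_left _ _))
  have hg' : ∀ s, |g' s| ≤ 1 / 2 := fun s => (G.abs_deriv_le s).trans (min_le_left _ _)
  set δ := min (min 1 r) (min (g₀ / 2) (η / 4)) with hδ
  have hδp : 0 < δ := by positivity
  have hδ1 : δ ≤ 1 := (min_le_left _ _).trans (min_le_left _ _)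
  have hδr : δ ≤ r := (min_le_left _ _).trans (min_le_right _ _)
  have hδg : δ ≤ g₀ / 2 := (min_le_right _ _).trans (min_le_left _ _)
  have hδη : δ ≤ η / 4 := (min_le_right _ _).trans (min_le_right _ _)
  set γ : ℝ → ℂ := fun s => μ + s + g s * I with hγ
  have γre : ∀ s, (γ s).re = μ + s := fun s => by simp [hγ]
  have γim : ∀ s, (γ s).im = g s := fun s => by simp [hγ]
  have hstrip : ∀ s, ∀ x ∈ Metric.ball (γ s) δ, x ∈ strip η ∧ |x.re - (μ + s)| < δ ∧
      |x.im - g s| < δ := by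
    intro s x hx
    rw [Metric.mem_ball, dist_eq_norm] at hx
    have h1 := (Complex.abs_re_le_norm (x - γ s)).trans_lt hx
    have h2 := (Complex.abs_im_le_norm (x - γ s)).trans_lt hx
    rw [Complex.sub_re, γre] at h1
    rw [Complex.sub_im, γim] at h2
    refine ⟨?_, h1, h2⟩
    have := abs_lt.1 h2
    have := abs_le.1 (hgη s)
    show |x.im| < η
    exact abs_lt.2 ⟨by linarith, by linarith⟩
  have hright : ∀ s, ∀ x ∈ Metric.ball (γ s) δ, t₂ - r ≤ x.re → g₀ / 2 < x.im := by
    intro s x hx h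
    obtain ⟨-, h1, h2⟩ := hstrip s x hx
    have h1 := abs_lt.1 h1
    have h2 := abs_lt.1 h2
    have := (G.right s (by linarith)).1
    linarith
  have hleft : ∀ s, ∀ x ∈ Metric.ball (γ s) δ, x.re ≤ t₁ + r → g₀ / 2 < σ * x.im := by
    intro s x hx h
    obtain ⟨-, h1, h2⟩ := hstrip s x hx
    have h1 := abs_lt.1 h1
    have h2 := abs_lt.1 h2
    have := (G.left s (by linarith)).1
    rcases hσ with rfl | rfl <;> linarith
  have hball : ∀ s, Metric.ball (γ s) δ ⊆ kleinDom σ t₁ t₂ η r := by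
    intro s x hx
    refine ⟨(hstrip s x hx).1, ?_, ?_⟩
    · rcases lt_or_ge x.re (t₂ - r) with h | h
      · exact Or.inr h
      · left; linarith [hright s x hx h]
    · rcases lt_or_ge (t₁ + r) x.re with h | h
      · exact Or.inr h
      · left; linarith [hleft s x hx h]
  set k := min v (v * (g₀ / 2)) with hk
  have hkp : 0 < k := by positivity
  have hka : ∀ s, ∀ x ∈ Metric.ball (γ s) δ, k ≤ ‖a x‖ := by
    intro s x hx
    refine H.min_le_norm_a (hstrip s x hx).1 (fun h => ?_) (by positivity)
    exact (hright s x hx (by linarith [(abs_le.1 h).1])).le.trans (le_abs_self _)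
  have hkb : ∀ s, ∀ x ∈ Metric.ball (γ s) δ, k ≤ ‖b x‖ := by
    intro s x hx
    refine H.min_le_norm_b (hstrip s x hx).1 (fun h => ?_) (by positivity)
    have h1 := hleft s x hx (by linarith [(abs_le.1 h).2])
    rcases hσ with rfl | rfl
    · exact (by linarith : g₀ / 2 ≤ x.im).trans (le_abs_self _)
    · exact (by linarith : g₀ / 2 ≤ -x.im).trans (neg_le_abs _)
  have hself : ∀ s, γ s ∈ Metric.ball (γ s) δ := fun s => Metric.mem_ball_self hδp
  have hσn : ‖(σ : ℂ)‖ = 1 := by rcases hσ with rfl | rfl <;> simp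
  have hcont : Continuous γ := by
    have : Continuous g := continuous_iff_continuousAt.2 fun s => (G.hasDerivAt s).continuousAt
    exact (continuous_const.add Complex.continuous_ofReal).add
      ((Complex.continuous_ofReal.comp this).mul continuous_const)
  have hdℓ : DifferentiableOn ℂ (fun x => σ * I * branchP σ (a x) (b x)) (kleinDom σ t₁ t₂ η r) :=
    (H.differentiableOn_branchP hσ).const_mul _
  have hlam : Continuous fun s => σ * I * branchP σ (a (γ s)) (b (γ s)) * (1 + g' s * I) := by
    have h1 := hdℓ.continuousOn.comp_continuous hcont fun s => hball s (hself s)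
    exact h1.mul (continuous_const.add
      ((Complex.continuous_ofReal.comp G.cont).mul continuous_const))
  have hre_ne : ∀ s, (σ * I * branchP σ (a (γ s)) (b (γ s)) * (1 + g' s * I)).re ≠ 0 := by
    intro s h0
    set L := σ * I * branchP σ (a (γ s)) (b (γ s)) * (1 + g' s * I) with hL
    have hs := hball s (hself s)
    have hsq := branchP_sq hσ (H.a_ne_zero hs) (H.b_ne_zero hσ hs)
    have e : a (γ s) * b (γ s) * (1 + g' s * I) ^ 2 = -L ^ 2 := by
      rw [hL, ← hsq]
      linear_combination ((branchP σ (a (γ s)) (b (γ s))) ^ 2 * (1 + g' s * I) ^ 2) *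
        (I ^ 2 * ofReal_sign_mul_self hσ + Complex.I_sq)
    have e2 : -L ^ 2 = ((L.im ^ 2 : ℝ) : ℂ) := by
      apply Complex.ext
      · simp [pow_two, h0]
      · simp [pow_two, h0]
    have h1 := H.re_neg_of_im_eq_zero hσ hs.1 (hg' s) (by
        rw [γim]
        calc C * |g s| ≤ C * (v / (2 * C)) := by gcongr; exact hgv s
          _ = v / 2 := by field_simp) (fun h => by
        rw [γre] at h
        obtain ⟨h1, h2⟩ := G.right s (by linarith)
        rw [γre, γim, add_sub_cancel_left]
        exact ⟨by linarith, h2⟩) (fun h => by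
        rw [γre] at h
        obtain ⟨h1, h2⟩ := G.left s (by linarith)
        rw [γre, γim, add_sub_cancel_left]
        exact ⟨by linarith, h2⟩) (by rw [e, e2, Complex.ofReal_im])
    rw [e, e2, Complex.ofReal_re] at h1
    linarith [sq_nonneg L.im]
  have hre0 : 0 < (σ * I * branchP σ (a (γ 0)) (b (γ 0)) * (1 + g' 0 * I)).re := by
    have hs := hball 0 (hself 0)
    have hA := H.left_a _ hs.1 (by rw [γre]; linarith)
    have hB := H.right_b _ hs.1 (by rw [γre]; linarith)
    rw [branchP_pos_neg hσ (by linarith) (by linarith)]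
    have e : ∀ X Y : ℂ, σ * I * (-(σ * I) * X) * Y = X * Y := fun X Y => by
      linear_combination (-X * Y * I ^ 2) * ofReal_sign_mul_self hσ - X * Y * Complex.I_sq
    rw [e]
    set w := (Complex.log (a (γ 0)) + Complex.log (-b (γ 0))) / 2 with hw
    have hwi : w.im = ((a (γ 0)).arg + (-b (γ 0)).arg) / 2 := by
      rw [hw]; simp [Complex.log_im]
    have ha1 := abs_lt.1 (Complex.abs_arg_lt_pi_div_two_iff.2
      (Or.inl (show 0 < (a (γ 0)).re by linarith)))
    have hb1 := abs_lt.1 (Complex.abs_arg_lt_pi_div_two_iff.2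
      (Or.inl (show 0 < (-b (γ 0)).re by rw [Complex.neg_re]; linarith)))
    have hcos : 0 < (Complex.exp w).re := by
      rw [Complex.exp_re]
      refine mul_pos (Real.exp_pos _) (Real.cos_pos_of_mem_Ioo ⟨?_, ?_⟩) <;> rw [hwi] <;> linarith
    rcases G.zero with h0 | h0
    · have hγ0 : γ 0 = (μ : ℝ) := by simp [hγ, h0]
      have hai : (a (γ 0)).im = 0 := by rw [hγ0]; exact H.real μ
      have hbi : (-b (γ 0)).im = 0 := by rw [Complex.neg_im, H.b_im, hai, neg_zero]
      have harg : w.im = 0 := by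
        rw [hwi, Complex.arg_eq_zero_iff.2 ⟨by linarith, hai⟩,
          Complex.arg_eq_zero_iff.2 ⟨by rw [Complex.neg_re]; linarith, hbi⟩]; simp
      have : (Complex.exp w).im = 0 := by rw [Complex.exp_im, harg]; simp
      simpa [Complex.mul_re, this] using hcos
    · simpa [h0] using hcos
  have hre : ∀ s, 0 < (σ * I * branchP σ (a (γ s)) (b (γ s)) * (1 + g' s * I)).re := by
    intro s
    by_contra! hneg
    obtain ⟨y, hy⟩ := mem_range_of_exists_le_of_exists_ge
      (Complex.continuous_re.comp hlam) ⟨s, hneg⟩ ⟨0, hre0.le⟩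
    exact hre_ne y hy
  refine ⟨g, g', δ, 1 + 1 / k + C + 3 * C / (2 * k) + 2, hgη, ⟨isOpen_kleinDom _ _ _ _ _, hδp, ?_,
    hball, fun s => ?_, ?_, hdℓ, H.differentiableOn_kleinQ hσ, fun x hx => ?_, fun s x hx => ?_,
    fun s => ?_, fun s x hx => ?_, fun s => ?_, fun s => (hre s).le⟩⟩
  · have : 0 ≤ 1 / k + C + 3 * C / (2 * k) + 2 := by positivity
    linarith
  · have h1 : HasDerivAt (fun s : ℝ => (s : ℂ)) 1 s := Complex.ofRealCLM.hasDerivAt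
    exact (h1.const_add _).add ((G.hasDerivAt s).ofReal_comp.mul_const I)
  · exact continuous_const.add ((Complex.continuous_ofReal.comp G.cont).mul continuous_const)
  · exact mul_ne_zero (mul_ne_zero (ofReal_sign_ne_zero hσ) I_ne_zero) branchP_ne_zero
  · have hd := hball s hx
    have h1 : k ≤ ‖branchP σ (a x) (b x)‖ := by
      refine le_of_sq_le_sq ?_ (norm_nonneg _)
      rw [norm_branchP_sq hσ (H.a_ne_zero hd) (H.b_ne_zero hσ hd), pow_two]
      exact mul_le_mul (hka s x hx) (hkb s x hx) hkp.le (norm_nonneg _)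
    rw [norm_inv, norm_mul, norm_mul, hσn, Complex.norm_I, one_mul, one_mul]
    have h2 : ‖branchP σ (a x) (b x)‖⁻¹ ≤ 1 / k := by rw [one_div]; gcongr
    have : 0 ≤ 1 + C + 3 * C / (2 * k) + 2 := by positivity
    linarith
  · have hd := hball s (hself s)
    rw [norm_mul, norm_mul, hσn, Complex.norm_I, one_mul, one_mul]
    have := H.norm_branchP_le hσ hd.1 (H.a_ne_zero hd) (H.b_ne_zero hσ hd)
    have : 0 ≤ 1 + 1 / k + 3 * C / (2 * k) + 2 := by positivity
    linarith
  · have hs := hstrip s x hx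
    have h1 := H.deriv_le x hs.1
    have h2 : wt (x.re - μ) ≤ 3 * wt s := wt_le_three_mul (by
      rw [show x.re - μ - s = x.re - (μ + s) by ring]; exact hs.2.1.le.trans hδ1)
    have ha : ‖(a x)⁻¹‖ ≤ 1 / k := by rw [norm_inv, one_div]; gcongr; exact hka s x hx
    have hb : ‖(b x)⁻¹‖ ≤ 1 / k := by rw [norm_inv, one_div]; gcongr; exact hkb s x hx
    have hws := wt_pos s
    rw [kleinQ, norm_div, norm_mul, Complex.norm_ofNat]
    calc ‖deriv a x‖ * ‖(a x)⁻¹ - (b x)⁻¹‖ / 4 ≤ (C * (3 * wt s)) * (1 / k + 1 / k) / 4 := by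
          gcongr
          · exact h1.trans (by gcongr)
          · exact (norm_sub_le _ _).trans (add_le_add ha hb)
      _ = 3 * C / (2 * k) * wt s := by field_simp; ring
      _ ≤ _ := by
          gcongr
          have : 0 ≤ 1 + 1 / k + C + 2 := by positivity
          linarith
  · have h1 : ‖(1 : ℂ) + g' s * I‖ ≤ 1 + 1 / 2 := by
      refine (norm_add_le _ _).trans ?_
      rw [norm_one, norm_mul, Complex.norm_I, mul_one, Complex.norm_real]
      gcongr; exact hg' s
    have : 0 ≤ 1 / k + C + 3 * C / (2 * k) := by positivity
    linarith

end KleinPair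

/-- On the real axis `starPrim` is an interval integral. -/
lemma starPrim_ofReal (μ s : ℝ) (f : ℂ → ℂ) :
    starPrim (μ : ℂ) f s = ∫ u in μ..s, f u := by
  have h := intervalIntegral.smul_integral_comp_add_mul (a := 0) (b := 1)
    (fun u : ℝ => f u) (s - μ) μ
  rw [mul_zero, add_zero, mul_one, add_sub_cancel] at h
  rw [← h, starPrim, ← intervalIntegral.integral_smul]
  refine intervalIntegral.integral_congr fun t _ => ?_
  simp only [Complex.real_smul]
  push_cast
  rw [mul_comm (t : ℂ)]

/-- Comparing a primitive along a path with its values on the real axis. -/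
lemma tendsto_starPrim_path {f : ℂ → ℂ} {U : Set ℂ} {μ K : ℝ} {κ : ℂ} {l : Filter ℝ} {g : ℝ → ℝ}
    (hU : IsOpen U) (hs : StarConvex ℝ (μ : ℂ) U) (hf : DifferentiableOn ℂ f U)
    (hg : ∀ s, |g s| ≤ K)
    (hmem : ∀ᶠ s : ℝ in l, ∀ τ ∈ Ioc (0 : ℝ) 1, (s : ℂ) + (τ * g s : ℝ) * I ∈ U)
    (hsmall : ∀ ε > 0, ∀ᶠ s : ℝ in l, ∀ τ ∈ Ioc (0 : ℝ) 1, ‖f (s + (τ * g s : ℝ) * I) - κ‖ ≤ ε)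
    (hbd : ∀ᶠ s : ℝ in l, Tendsto (fun τ : ℝ => starPrim μ f (s + (τ * g s : ℝ) * I)) (𝓝[>] 0)
      (𝓝 (starPrim μ f s))) {L : ℂ}
    (hlim : Tendsto (fun s : ℝ => starPrim μ f s - κ * s) l (𝓝 L)) :
    Tendsto (fun s : ℝ => starPrim μ f (s + g s * I) - κ * (s + g s * I)) l (𝓝 L) := by
  have hK : 0 ≤ K := (abs_nonneg _).trans (hg 0)
  have key : Tendsto (fun s : ℝ => starPrim μ f (s + g s * I) - κ * (s + g s * I) -
      (starPrim μ f s - κ * s)) l (𝓝 0) := by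
    rw [NormedAddGroup.tendsto_nhds_zero]
    intro ε hε
    filter_upwards [hmem, hbd, hsmall (ε / (2 * (K + 1))) (by positivity)] with s h1 h2 h3
    set φ : ℝ → ℂ := fun τ => starPrim μ f (s + (τ * g s : ℝ) * I) - κ * (s + (τ * g s : ℝ) * I)
      with hφ
    have hd : ∀ τ ∈ Ioc (0 : ℝ) 1, HasDerivAt φ
        ((f (s + (τ * g s : ℝ) * I) - κ) * (g s * I)) τ := by
      intro τ hτ
      have e : HasDerivAt (fun τ : ℝ => (s : ℂ) + (τ * g s : ℝ) * I) (g s * I) τ := by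
        have h0 : HasDerivAt (fun τ : ℝ => τ * g s) (g s) τ := by
          simpa using (hasDerivAt_id τ).mul_const (g s)
        exact (h0.ofReal_comp.mul_const I).const_add _
      have h4 := (hasDerivAt_starPrim hU hs hf (h1 τ hτ)).comp τ e
      exact (h4.sub (e.const_mul κ)).congr_deriv (by ring)
    have hb : ∀ τ ∈ Ioc (0 : ℝ) 1, ‖φ 1 - φ τ‖ ≤ ε / 2 := by
      intro τ hτ
      have h5 := (convex_Ioc (0 : ℝ) 1).norm_image_sub_le_of_norm_hasDerivWithin_le
        (fun x hx => (hd x hx).hasDerivWithinAt) (C := ε / (2 * (K + 1)) * K) (fun x hx => by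
          rw [norm_mul, norm_mul, Complex.norm_I, mul_one, Complex.norm_real]
          exact mul_le_mul (h3 x hx) (hg s) (norm_nonneg _) (by positivity)) hτ
          (show (1 : ℝ) ∈ Ioc (0 : ℝ) 1 by simp)
      refine h5.trans ?_
      have h6 : ‖(1 : ℝ) - τ‖ ≤ 1 := by
        rw [Real.norm_eq_abs, abs_le]; constructor <;> linarith [hτ.1, hτ.2]
      calc _ ≤ ε / (2 * (K + 1)) * (K + 1) * 1 := by gcongr; linarith
        _ = ε / 2 := by field_simp
    have hl : Tendsto (fun τ => ‖φ 1 - φ τ‖) (𝓝[>] 0) (𝓝 ‖φ 1 - (starPrim μ f s - κ * s)‖) := by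
      refine (tendsto_const_nhds.sub (h2.sub ?_)).norm
      have : Continuous fun τ : ℝ => κ * ((s : ℂ) + (τ * g s : ℝ) * I) := by fun_prop
      have h7 := this.tendsto 0
      simp only [zero_mul, Complex.ofReal_zero, add_zero] at h7
      exact h7.mono_left nhdsWithin_le_nhds
    have h8 : ‖φ 1 - (starPrim μ f s - κ * s)‖ ≤ ε / 2 := by
      refine le_of_tendsto hl ?_
      filter_upwards [Ioc_mem_nhdsGT (zero_lt_one' ℝ)] with τ hτ using hb τ hτ
    have h9 : φ 1 = starPrim μ f (s + g s * I) - κ * (s + g s * I) := by simp [hφ]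
    rw [← h9]
    linarith
  simpa using key.add hlim

/-- Boundary values of a primitive on the real axis. -/
lemma tendsto_starPrim_boundary {f : ℂ → ℂ} {U : Set ℂ} {μ s y C t₁ t₂ : ℝ}
    (hs : StarConvex ℝ (μ : ℂ) U) (hf : ContinuousOn f U)
    (hC : ∀ x ∈ U, ‖f x‖ ≤ C)
    (hmem : ∀ τ ∈ Ioc (0 : ℝ) 1, (s : ℂ) + (τ * y : ℝ) * I ∈ U)
    (hcont : ∀ u : ℝ, u ≠ t₁ → u ≠ t₂ → ContinuousAt f u) (hsμ : s ≠ μ) :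
    Tendsto (fun τ : ℝ => starPrim μ f (s + (τ * y : ℝ) * I)) (𝓝[>] 0) (𝓝 (starPrim μ f s)) := by
  have hseg : ∀ x ∈ U, ∀ t ∈ Icc (0 : ℝ) 1, (μ : ℂ) + t * (x - μ) ∈ U := by
    intro x hx t ht
    have h := hs hx (sub_nonneg.2 ht.2) ht.1 (by ring)
    have e : (1 - t) • (μ : ℂ) + t • x = μ + t * (x - μ) := by
      simp only [Complex.real_smul]; push_cast; ring
    rwa [e] at h
  have hI := Ioc_mem_nhdsGT (zero_lt_one' ℝ)
  refine intervalIntegral.tendsto_integral_filter_of_dominated_convergence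
    (fun _ => (|s - μ| + |y|) * C) ?_ ?_ intervalIntegrable_const ?_
  · filter_upwards [hI] with τ hτ
    refine ContinuousOn.aestronglyMeasurable ?_ measurableSet_uIoc
    refine continuousOn_const.mul (hf.comp (by fun_prop) fun t ht => ?_)
    rw [uIoc_of_le zero_le_one] at ht
    exact hseg _ (hmem τ hτ) t ⟨ht.1.le, ht.2⟩
  · filter_upwards [hI] with τ hτ
    refine ae_of_all _ fun t ht => ?_
    rw [uIoc_of_le zero_le_one] at ht
    rw [norm_mul]
    refine mul_le_mul ?_ (hC _ (hseg _ (hmem τ hτ) t ⟨ht.1.le, ht.2⟩)) (norm_nonneg _) (by positivity)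
    rw [show (s : ℂ) + (τ * y : ℝ) * I - μ = ((s - μ : ℝ) : ℂ) + (τ * y : ℝ) * I by push_cast; ring]
    refine (norm_add_le _ _).trans ?_
    rw [norm_mul, Complex.norm_I, mul_one, Complex.norm_real, Complex.norm_real, Real.norm_eq_abs,
      Real.norm_eq_abs, abs_mul, abs_of_pos hτ.1]
    gcongr
    exact mul_le_of_le_one_left (abs_nonneg _) hτ.2
  · have hz : s - μ ≠ 0 := sub_ne_zero.2 hsμ
    have hae : ∀ w : ℝ, ∀ᵐ t : ℝ, t ≠ (w - μ) / (s - μ) := fun w => by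
      simp [ae_iff, measure_singleton]
    filter_upwards [hae t₁, hae t₂] with t h1 h2 _
    have hne : ∀ w : ℝ, t ≠ (w - μ) / (s - μ) → μ + t * (s - μ) ≠ w := fun w hw h => hw (by
      rw [eq_div_iff hz]; linarith)
    have hc := hcont _ (hne _ h1) (hne _ h2)
    have hin : Continuous fun τ : ℝ => (s : ℂ) + (τ * y : ℝ) * I - μ := by fun_prop
    have h0 := hin.tendsto 0
    simp only [zero_mul, Complex.ofReal_zero, add_zero] at h0
    have h0' := h0.mono_left (nhdsWithin_le_nhds (s := Ioi 0))
    refine h0'.mul (Tendsto.comp ?_ (tendsto_const_nhds.add (tendsto_const_nhds.mul h0')))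
    convert hc using 2
    push_cast; rfl

lemma exp_half_log_add_log {x y : ℝ} (hx : 0 < x) (hy : 0 < y) :
    Complex.exp ((Complex.log x + Complex.log y) / 2) = (Real.sqrt (x * y) : ℝ) := by
  rw [← Complex.ofReal_log hx.le, ← Complex.ofReal_log hy.le]
  rw [← Real.exp_log (mul_pos hx hy), ← Real.exp_half, Real.log_mul hx.ne' hy.ne']
  push_cast; rfl

lemma continuousAt_branchP {σ : ℝ} {z w : ℂ} (hz : I * z ∈ Complex.slitPlane)
    (hw : I * σ * w ∈ Complex.slitPlane) :
    ContinuousAt (fun q : ℂ × ℂ => branchP σ q.1 q.2) (z, w) := by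
  have h1 : ContinuousAt (fun q : ℂ × ℂ => Complex.log (I * q.1)) (z, w) :=
    (continuousAt_const.mul continuousAt_fst).clog hz
  have h2 : ContinuousAt (fun q : ℂ × ℂ => Complex.log (I * σ * q.2)) (z, w) :=
    (continuousAt_const.mul continuousAt_snd).clog hw
  exact continuousAt_const.mul ((h1.add h2).div_const 2).cexp

lemma continuousAt_branchA {σ : ℝ} {z w : ℂ} (hz : I * z ∈ Complex.slitPlane)
    (hw : I * σ * w ∈ Complex.slitPlane) :
    ContinuousAt (fun q : ℂ × ℂ => branchA σ q.1 q.2) (z, w) := by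
  have h1 : ContinuousAt (fun q : ℂ × ℂ => Complex.log (I * q.1)) (z, w) :=
    (continuousAt_const.mul continuousAt_fst).clog hz
  have h2 : ContinuousAt (fun q : ℂ × ℂ => Complex.log (I * σ * q.2)) (z, w) :=
    (continuousAt_const.mul continuousAt_snd).clog hw
  exact continuousAt_const.mul ((h1.sub h2).div_const 4).cexp

lemma I_mul_mem_slitPlane {z : ℂ} (hz : z.re ≠ 0) : I * z ∈ Complex.slitPlane := by
  rw [Complex.mem_slitPlane_iff]
  right; simpa using hz

lemma I_mul_sign_mul_mem_slitPlane {σ : ℝ} (hσ : σ = 1 ∨ σ = -1) {z : ℂ} (hz : z.re ≠ 0) :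
    I * σ * z ∈ Complex.slitPlane := by
  rw [mul_assoc]
  apply I_mul_mem_slitPlane
  rcases hσ with rfl | rfl <;> simpa using hz

lemma exp_quarter_log_sub_log {x y : ℝ} (hx : 0 < x) (hy : 0 < y) :
    Complex.exp ((Complex.log x - Complex.log y) / 4) = (((x / y) ^ ((1 : ℝ) / 4) : ℝ) : ℂ) := by
  rw [← Complex.ofReal_log hx.le, ← Complex.ofReal_log hy.le,
    Real.rpow_def_of_pos (div_pos hx hy), Real.log_div hx.ne' hy.ne']
  push_cast
  congr 1; ring

/-- The filter of points of a strip going to `-∞`. -/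
def stripBot (η : ℝ) : Filter ℂ := comap Complex.re atBot ⊓ 𝓟 (strip η)

/-- The filter of points of a strip going to `+∞`. -/
def stripTop (η : ℝ) : Filter ℂ := comap Complex.re atTop ⊓ 𝓟 (strip η)

lemma eventually_stripBot {η : ℝ} {p : ℂ → Prop} :
    (∀ᶠ x in stripBot η, p x) ↔ ∃ R : ℝ, ∀ x ∈ strip η, x.re ≤ R → p x := by
  rw [stripBot, eventually_inf_principal, eventually_comap]
  simp only [eventually_atBot]
  constructor
  · rintro ⟨R, hR⟩
    exact ⟨R, fun x hx h => hR _ h x rfl hx⟩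
  · rintro ⟨R, hR⟩
    exact ⟨R, fun b hb x hx hs => hR x hs (by rw [hx]; exact hb)⟩

lemma eventually_stripTop {η : ℝ} {p : ℂ → Prop} :
    (∀ᶠ x in stripTop η, p x) ↔ ∃ R : ℝ, ∀ x ∈ strip η, R ≤ x.re → p x := by
  rw [stripTop, eventually_inf_principal, eventually_comap]
  simp only [eventually_atTop]
  constructor
  · rintro ⟨R, hR⟩
    exact ⟨R, fun x hx h => hR _ h x rfl hx⟩
  · rintro ⟨R, hR⟩
    exact ⟨R, fun b hb x hx hs => hR x hs (by rw [hx]; exact hb)⟩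

lemma tendsto_path_stripBot {η μ : ℝ} {g : ℝ → ℝ} (hg : ∀ s, |g s| < η) :
    Tendsto (fun s : ℝ => (μ : ℂ) + s + g s * I) atBot (stripBot η) := by
  refine tendsto_inf.2 ⟨tendsto_comap_iff.2 ?_, tendsto_principal.2 (Eventually.of_forall fun s => ?_)⟩
  · refine (tendsto_atBot_add_const_left atBot μ tendsto_id).congr fun s => ?_
    simp
  · show |_| < η
    simpa using hg s

lemma tendsto_path_stripTop {η μ : ℝ} {g : ℝ → ℝ} (hg : ∀ s, |g s| < η) :
    Tendsto (fun s : ℝ => (μ : ℂ) + s + g s * I) atTop (stripTop η) := by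
  refine tendsto_inf.2 ⟨tendsto_comap_iff.2 ?_, tendsto_principal.2 (Eventually.of_forall fun s => ?_)⟩
  · refine (tendsto_atTop_add_const_left atTop μ tendsto_id).congr fun s => ?_
    simp
  · show |_| < η
    simpa using hg s

namespace KleinPair

variable {a b : ℂ → ℂ} {t₁ t₂ μ M am ap η r v C σ : ℝ}

lemma tendsto_a_left (H : KleinPair a b t₁ t₂ μ M am ap η r v C) :
    Tendsto a (stripBot η) (𝓝 am) := by
  refine Metric.tendsto_nhds.2 fun ε hε => eventually_stripBot.2 ?_
  obtain ⟨R, hR⟩ := H.tendsto_left (ε / 2) (by positivity)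
  exact ⟨-R, fun x hx h => by rw [dist_eq_norm]; linarith [hR x hx h]⟩

lemma tendsto_a_right (H : KleinPair a b t₁ t₂ μ M am ap η r v C) :
    Tendsto a (stripTop η) (𝓝 ap) := by
  refine Metric.tendsto_nhds.2 fun ε hε => eventually_stripTop.2 ?_
  obtain ⟨R, hR⟩ := H.tendsto_right (ε / 2) (by positivity)
  exact ⟨R, fun x hx h => by rw [dist_eq_norm]; linarith [hR x hx h]⟩

lemma b_eq (H : KleinPair a b t₁ t₂ μ M am ap η r v C) : b = fun x => a x - M :=
  funext fun x => by rw [H.eq_add]; ring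

lemma tendsto_b_left (H : KleinPair a b t₁ t₂ μ M am ap η r v C) :
    Tendsto b (stripBot η) (𝓝 (am - M : ℝ)) := by
  rw [H.b_eq]; push_cast; exact H.tendsto_a_left.sub_const _

lemma tendsto_b_right (H : KleinPair a b t₁ t₂ μ M am ap η r v C) :
    Tendsto b (stripTop η) (𝓝 (ap - M : ℝ)) := by
  rw [H.b_eq]; push_cast; exact H.tendsto_a_right.sub_const _

lemma tendsto_branchP_left (H : KleinPair a b t₁ t₂ μ M am ap η r v C) (hσ : σ = 1 ∨ σ = -1) :
    Tendsto (fun x => branchP σ (a x) (b x)) (stripBot η)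
      (𝓝 (Real.sqrt (am * (am - M)) : ℝ)) := by
  have hM := H.M_pos
  have ham := H.am_gt
  have h := (continuousAt_branchP (σ := σ) (z := (am : ℝ)) (w := (am - M : ℝ))
    (I_mul_mem_slitPlane (by rw [Complex.ofReal_re]; linarith))
    (I_mul_sign_mul_mem_slitPlane hσ (by rw [Complex.ofReal_re]; linarith))).tendsto.comp
    (H.tendsto_a_left.prodMk_nhds H.tendsto_b_left)
  simp only at h
  rwa [branchP_pos_pos hσ (by rw [Complex.ofReal_re]; linarith) (by rw [Complex.ofReal_re]; linarith),
    exp_half_log_add_log (by linarith) (by linarith)] at h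

lemma tendsto_branchP_right (H : KleinPair a b t₁ t₂ μ M am ap η r v C) (hσ : σ = 1 ∨ σ = -1) :
    Tendsto (fun x => branchP σ (a x) (b x)) (stripTop η)
      (𝓝 (-σ * (Real.sqrt (ap * (ap - M)) : ℝ))) := by
  have hM := H.M_pos
  have hap := H.ap_neg
  have h := (continuousAt_branchP (σ := σ) (z := (ap : ℝ)) (w := (ap - M : ℝ))
    (I_mul_mem_slitPlane (by rw [Complex.ofReal_re]; linarith))
    (I_mul_sign_mul_mem_slitPlane hσ (by rw [Complex.ofReal_re]; linarith))).tendsto.comp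
    (H.tendsto_a_right.prodMk_nhds H.tendsto_b_right)
  simp only at h
  rwa [branchP_neg_neg hσ (by rw [Complex.ofReal_re]; linarith) (by rw [Complex.ofReal_re]; linarith),
    ← Complex.ofReal_neg ap, ← Complex.ofReal_neg (ap - M), exp_half_log_add_log (by linarith) (by linarith),
    neg_mul_neg] at h

lemma tendsto_branchA_left (H : KleinPair a b t₁ t₂ μ M am ap η r v C) (hσ : σ = 1 ∨ σ = -1) :
    Tendsto (fun x => branchA σ (a x) (b x)) (stripBot η)
      (𝓝 ((am / (am - M)) ^ ((1 : ℝ) / 4) : ℝ)) := by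
  have hM := H.M_pos
  have ham := H.am_gt
  have h := (continuousAt_branchA (σ := σ) (z := (am : ℝ)) (w := (am - M : ℝ))
    (I_mul_mem_slitPlane (by rw [Complex.ofReal_re]; linarith))
    (I_mul_sign_mul_mem_slitPlane hσ (by rw [Complex.ofReal_re]; linarith))).tendsto.comp
    (H.tendsto_a_left.prodMk_nhds H.tendsto_b_left)
  simp only at h
  rwa [branchA_pos_pos hσ (by rw [Complex.ofReal_re]; linarith) (by rw [Complex.ofReal_re]; linarith),
    exp_quarter_log_sub_log (by linarith) (by linarith)] at h

lemma tendsto_branchA_right (H : KleinPair a b t₁ t₂ μ M am ap η r v C) (hσ : σ = 1 ∨ σ = -1) :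
    Tendsto (fun x => branchA σ (a x) (b x)) (stripTop η)
      (𝓝 (Complex.exp (Real.pi / 4 * I * (σ - 1)) * ((ap / (ap - M)) ^ ((1 : ℝ) / 4) : ℝ))) := by
  have hM := H.M_pos
  have hap := H.ap_neg
  have h := (continuousAt_branchA (σ := σ) (z := (ap : ℝ)) (w := (ap - M : ℝ))
    (I_mul_mem_slitPlane (by rw [Complex.ofReal_re]; linarith))
    (I_mul_sign_mul_mem_slitPlane hσ (by rw [Complex.ofReal_re]; linarith))).tendsto.comp
    (H.tendsto_a_right.prodMk_nhds H.tendsto_b_right)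
  simp only at h
  rwa [branchA_neg_neg hσ (by rw [Complex.ofReal_re]; linarith) (by rw [Complex.ofReal_re]; linarith),
    ← Complex.ofReal_neg, ← Complex.ofReal_neg, exp_quarter_log_sub_log (by linarith) (by linarith),
    neg_div_neg_eq] at h

lemma a_ofReal (H : KleinPair a b t₁ t₂ μ M am ap η r v C) (s : ℝ) : a s = (a s).re := by
  apply Complex.ext <;> simp [H.real s]

lemma b_ofReal (H : KleinPair a b t₁ t₂ μ M am ap η r v C) (s : ℝ) : b s = (b s).re := by
  apply Complex.ext <;> simp [H.b_im, H.real s]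

lemma branchP_left (H : KleinPair a b t₁ t₂ μ M am ap η r v C) (hσ : σ = 1 ∨ σ = -1) {s : ℝ}
    (hs : s < t₁) :
    branchP σ (a s) (b s) = (Real.sqrt ((a s).re * (b s).re) : ℝ) := by
  have hb := H.pos_b s hs
  have ha : 0 < (a s).re := by rw [H.a_re]; linarith [H.M_pos]
  rw [branchP_pos_pos hσ ha hb, H.a_ofReal s, H.b_ofReal s]
  simp only [Complex.ofReal_re]
  exact exp_half_log_add_log ha hb

lemma branchP_middle (H : KleinPair a b t₁ t₂ μ M am ap η r v C) (hσ : σ = 1 ∨ σ = -1) {s : ℝ}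
    (hs : t₁ < s) (hs' : s < t₂) :
    branchP σ (a s) (b s) = -(σ * I) * (Real.sqrt (-((a s).re * (b s).re)) : ℝ) := by
  have hb := H.neg_b s hs
  have ha := H.pos_a s hs'
  rw [branchP_pos_neg hσ ha hb, H.a_ofReal s, H.b_ofReal s]
  simp only [Complex.ofReal_re]
  rw [← Complex.ofReal_neg, exp_half_log_add_log ha (neg_pos.2 hb), mul_neg]

lemma branchP_right (H : KleinPair a b t₁ t₂ μ M am ap η r v C) (hσ : σ = 1 ∨ σ = -1) {s : ℝ}
    (hs : t₂ < s) :
    branchP σ (a s) (b s) = -σ * (Real.sqrt ((a s).re * (b s).re) : ℝ) := by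
  have ha := H.neg_a s hs
  have hb : (b s).re < 0 := by linarith [H.M_pos, H.a_re s]
  rw [branchP_neg_neg hσ ha hb, H.a_ofReal s, H.b_ofReal s]
  simp only [Complex.ofReal_re]
  rw [← Complex.ofReal_neg (a s).re, ← Complex.ofReal_neg (b s).re,
    exp_half_log_add_log (neg_pos.2 ha) (neg_pos.2 hb),
    neg_mul_neg]

lemma re_a_ne_zero (H : KleinPair a b t₁ t₂ μ M am ap η r v C) {s : ℝ} (hs : s ≠ t₂) :
    (a s).re ≠ 0 := by
  rcases lt_or_gt_of_ne hs with h | h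
  · exact (H.pos_a s h).ne'
  · exact (H.neg_a s h).ne

lemma re_b_ne_zero (H : KleinPair a b t₁ t₂ μ M am ap η r v C) {s : ℝ} (hs : s ≠ t₁) :
    (b s).re ≠ 0 := by
  rcases lt_or_gt_of_ne hs with h | h
  · exact (H.pos_b s h).ne'
  · exact (H.neg_b s h).ne

lemma continuous_re_mul_re (H : KleinPair a b t₁ t₂ μ M am ap η r v C) :
    Continuous fun s : ℝ => (a s).re * (b s).re := by
  have ha : Continuous fun s : ℝ => a s :=
    H.diff_a.continuousOn.comp_continuous Complex.continuous_ofReal (ofReal_mem_strip H.η_pos)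
  have hb : Continuous fun s : ℝ => b s := by
    rw [H.b_eq]; exact ha.sub continuous_const
  exact (Complex.continuous_re.comp ha).mul (Complex.continuous_re.comp hb)

lemma continuousAt_branchP_ofReal (H : KleinPair a b t₁ t₂ μ M am ap η r v C)
    (hσ : σ = 1 ∨ σ = -1) {s : ℝ} (h1 : s ≠ t₁) (h2 : s ≠ t₂) :
    ContinuousAt (fun x => branchP σ (a x) (b x)) s := by
  have hs := ofReal_mem_strip H.η_pos s
  exact (continuousAt_branchP (I_mul_mem_slitPlane (H.re_a_ne_zero h2))
    (I_mul_sign_mul_mem_slitPlane hσ (H.re_b_ne_zero h1))).comp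
    (f := fun x : ℂ => (a x, b x))
    ((H.hasDerivAt_a hs).continuousAt.prodMk (H.hasDerivAt_b hs).continuousAt)

/-- The primitive of the momentum along the real axis at `-∞`. -/
lemma tendsto_starPrim_left (H : KleinPair a b t₁ t₂ μ M am ap η r v C) (hσ : σ = 1 ∨ σ = -1)
    {k : ℝ} (hint : IntegrableOn (fun s : ℝ => Real.sqrt ((a s).re * (b s).re) - k) (Iic t₁)) :
    Tendsto (fun s : ℝ => starPrim μ (fun x => branchP σ (a x) (b x)) s - (k : ℂ) * s) atBot
      (𝓝 (-((∫ s in Iic t₁, (Real.sqrt ((a s).re * (b s).re) - k) : ℝ) : ℂ) - k * t₁ +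
        σ * I * ((∫ s in t₁..μ, Real.sqrt (-((a s).re * (b s).re)) : ℝ) : ℂ))) := by
  have hr := H.r_pos
  have h1 := H.lt_mid
  have h2 := H.mid_lt
  have hlim := intervalIntegral_tendsto_integral_Iic t₁ hint tendsto_id
  have hlim' : Tendsto (fun s : ℝ =>
      ((∫ u in s..t₁, (Real.sqrt ((a u).re * (b u).re) - k) : ℝ) : ℂ)) atBot
      (𝓝 ((∫ s in Iic t₁, (Real.sqrt ((a s).re * (b s).re) - k) : ℝ) : ℂ)) :=
    (Complex.continuous_ofReal.tendsto _).comp hlim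
  refine ((hlim'.neg.sub_const ((k : ℂ) * t₁)).add_const _).congr' ?_
  filter_upwards [eventually_lt_atBot t₁] with s hs
  have hc1 : Continuous fun s : ℝ => Real.sqrt ((a s).re * (b s).re) := H.continuous_re_mul_re.sqrt
  have hc2 : Continuous fun s : ℝ => Real.sqrt (-((a s).re * (b s).re)) :=
    H.continuous_re_mul_re.neg.sqrt
  have e1 : EqOn (fun u : ℝ => branchP σ (a u) (b u))
      (fun u : ℝ => ((Real.sqrt ((a u).re * (b u).re) : ℝ) : ℂ)) (uIoo s t₁) := by
    intro u hu
    rw [uIoo_of_le hs.le] at hu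
    exact H.branchP_left hσ hu.2
  have e2 : EqOn (fun u : ℝ => branchP σ (a u) (b u))
      (fun u : ℝ => -(σ * I) * ((Real.sqrt (-((a u).re * (b u).re)) : ℝ) : ℂ)) (uIoo t₁ μ) := by
    intro u hu
    rw [uIoo_of_le (by linarith)] at hu
    exact H.branchP_middle hσ hu.1 (by linarith [hu.2])
  have i1 : IntervalIntegrable (fun u : ℝ => branchP σ (a u) (b u)) volume s t₁ :=
    ((Complex.continuous_ofReal.comp hc1).intervalIntegrable s t₁).congr_uIoo e1.symm
  have i2 : IntervalIntegrable (fun u : ℝ => branchP σ (a u) (b u)) volume t₁ μ :=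
    ((continuous_const.mul (Complex.continuous_ofReal.comp hc2)).intervalIntegrable t₁ μ).congr_uIoo
      e2.symm
  rw [starPrim_ofReal, intervalIntegral.integral_symm s μ, ← intervalIntegral.integral_add_adjacent_intervals i1 i2,
    intervalIntegral.integral_congr_uIoo e1, intervalIntegral.integral_congr_uIoo e2,
    intervalIntegral.integral_const_mul, intervalIntegral.integral_ofReal,
    intervalIntegral.integral_ofReal, intervalIntegral.integral_sub (hc1.intervalIntegrable _ _)
      intervalIntegrable_const, intervalIntegral.integral_const]
  simp only [smul_eq_mul]
  push_cast
  ring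

/-- The primitive of the momentum along the real axis at `+∞`. -/
lemma tendsto_starPrim_right (H : KleinPair a b t₁ t₂ μ M am ap η r v C) (hσ : σ = 1 ∨ σ = -1)
    {k : ℝ} (hint : IntegrableOn (fun s : ℝ => Real.sqrt ((a s).re * (b s).re) - k) (Ici t₂)) :
    Tendsto (fun s : ℝ => starPrim μ (fun x => branchP σ (a x) (b x)) s - (-σ * k : ℂ) * s) atTop
      (𝓝 (-σ * (((∫ s in Ici t₂, (Real.sqrt ((a s).re * (b s).re) - k) : ℝ) : ℂ) - k * t₂) -
        σ * I * ((∫ s in μ..t₂, Real.sqrt (-((a s).re * (b s).re)) : ℝ) : ℂ))) := by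
  have hr := H.r_pos
  have h1 := H.lt_mid
  have h2 := H.mid_lt
  have hlim := intervalIntegral_tendsto_integral_Ioi t₂ (hint.mono_set Ioi_subset_Ici_self) tendsto_id
  rw [← integral_Ici_eq_integral_Ioi] at hlim
  have hlim' : Tendsto (fun s : ℝ =>
      ((∫ u in t₂..s, (Real.sqrt ((a u).re * (b u).re) - k) : ℝ) : ℂ)) atTop
      (𝓝 ((∫ s in Ici t₂, (Real.sqrt ((a s).re * (b s).re) - k) : ℝ) : ℂ)) :=
    (Complex.continuous_ofReal.tendsto _).comp hlim
  refine (((hlim'.sub_const ((k : ℂ) * t₂)).const_mul (-σ : ℂ)).sub_const _).congr' ?_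
  filter_upwards [eventually_gt_atTop t₂] with s hs
  have hc1 : Continuous fun s : ℝ => Real.sqrt ((a s).re * (b s).re) := H.continuous_re_mul_re.sqrt
  have hc2 : Continuous fun s : ℝ => Real.sqrt (-((a s).re * (b s).re)) :=
    H.continuous_re_mul_re.neg.sqrt
  have e1 : EqOn (fun u : ℝ => branchP σ (a u) (b u))
      (fun u : ℝ => (-σ : ℂ) * ((Real.sqrt ((a u).re * (b u).re) : ℝ) : ℂ)) (uIoo t₂ s) := by
    intro u hu
    rw [uIoo_of_le hs.le] at hu
    exact H.branchP_right hσ hu.1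
  have e2 : EqOn (fun u : ℝ => branchP σ (a u) (b u))
      (fun u : ℝ => -(σ * I) * ((Real.sqrt (-((a u).re * (b u).re)) : ℝ) : ℂ)) (uIoo μ t₂) := by
    intro u hu
    rw [uIoo_of_le (by linarith)] at hu
    exact H.branchP_middle hσ (by linarith [hu.1]) hu.2
  have i1 : IntervalIntegrable (fun u : ℝ => branchP σ (a u) (b u)) volume t₂ s :=
    ((continuous_const.mul (Complex.continuous_ofReal.comp hc1)).intervalIntegrable t₂ s).congr_uIoo
      e1.symm
  have i2 : IntervalIntegrable (fun u : ℝ => branchP σ (a u) (b u)) volume μ t₂ :=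
    ((continuous_const.mul (Complex.continuous_ofReal.comp hc2)).intervalIntegrable μ t₂).congr_uIoo
      e2.symm
  rw [starPrim_ofReal, ← intervalIntegral.integral_add_adjacent_intervals i2 i1,
    intervalIntegral.integral_congr_uIoo e1, intervalIntegral.integral_congr_uIoo e2,
    intervalIntegral.integral_const_mul, intervalIntegral.integral_const_mul,
    intervalIntegral.integral_ofReal,
    intervalIntegral.integral_ofReal, intervalIntegral.integral_sub (hc1.intervalIntegrable _ _)
      intervalIntegrable_const, intervalIntegral.integral_const]
  simp only [smul_eq_mul]
  push_cast
  ring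

end KleinPair

namespace KleinPair

variable {a b : ℂ → ℂ} {t₁ t₂ μ M am ap η r v C σ : ℝ}

lemma tendsto_starPrim_of_eventually_mem (H : KleinPair a b t₁ t₂ μ M am ap η r v C)
    (hσ : σ = 1 ∨ σ = -1) {l : Filter ℝ} {κ L : ℂ} {g : ℝ → ℝ} (hg : ∀ s, |g s| ≤ η / 2)
    (hmem : ∀ᶠ s : ℝ in l, ∀ τ ∈ Ioc (0 : ℝ) 1,
      (s : ℂ) + (τ * g s : ℝ) * I ∈ kleinDom σ t₁ t₂ η r)
    (hne : ∀ᶠ s : ℝ in l, s ≠ μ)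
    (hsmall : ∀ ε > 0, ∀ᶠ s : ℝ in l, ∀ τ ∈ Ioc (0 : ℝ) 1,
      ‖branchP σ (a (s + (τ * g s : ℝ) * I)) (b (s + (τ * g s : ℝ) * I)) - κ‖ ≤ ε)
    (hlim : Tendsto (fun s : ℝ => starPrim μ (fun x => branchP σ (a x) (b x)) s - κ * s) l (𝓝 L)) :
    Tendsto (fun s : ℝ => starPrim μ (fun x => branchP σ (a x) (b x)) (s + g s * I) -
      κ * (s + g s * I)) l (𝓝 L) := by
  refine tendsto_starPrim_path (isOpen_kleinDom σ t₁ t₂ η r) H.starConvex_dom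
    (H.differentiableOn_branchP hσ) hg hmem hsmall ?_ hlim
  filter_upwards [hmem, hne] with s h1 h2
  exact tendsto_starPrim_boundary H.starConvex_dom (H.differentiableOn_branchP hσ).continuousOn
    (fun x hx => H.norm_branchP_le hσ hx.1 (H.a_ne_zero hx) (H.b_ne_zero hσ hx)) h1
    (fun u h1 h2 => H.continuousAt_branchP_ofReal hσ h1 h2) h2

lemma abs_scaled_lt (H : KleinPair a b t₁ t₂ μ M am ap η r v C) {y τ : ℝ} (hy : |y| ≤ η / 2)
    (hτ : τ ∈ Ioc (0 : ℝ) 1) (s : ℝ) : (s : ℂ) + (τ * y : ℝ) * I ∈ strip η := by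
  show |_| < η
  have h0 := H.η_pos
  have : |τ * y| ≤ 1 * (η / 2) := by
    rw [abs_mul, abs_of_pos hτ.1]
    exact mul_le_mul hτ.2 hy (abs_nonneg _) zero_le_one
  have e : ((s : ℂ) + (τ * y : ℝ) * I).im = τ * y := by simp
  rw [e]; linarith

lemma tendsto_starPrim_path_left (H : KleinPair a b t₁ t₂ μ M am ap η r v C)
    (hσ : σ = 1 ∨ σ = -1) {L : ℂ} {g : ℝ → ℝ} (hg : ∀ s, |g s| ≤ η / 2)
    (hmem : ∀ s : ℝ, (μ : ℂ) + s + g s * I ∈ kleinDom σ t₁ t₂ η r)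
    (hlim : Tendsto (fun s : ℝ => starPrim μ (fun x => branchP σ (a x) (b x)) s -
      ((Real.sqrt (am * (am - M)) : ℝ) : ℂ) * s) atBot (𝓝 L)) :
    Tendsto (fun s : ℝ => starPrim μ (fun x => branchP σ (a x) (b x)) (μ + s + g s * I) -
      ((Real.sqrt (am * (am - M)) : ℝ) : ℂ) * (μ + s + g s * I)) atBot (𝓝 L) := by
  have hr := H.r_pos
  have hgap := H.gap
  have key := H.tendsto_starPrim_of_eventually_mem hσ (g := fun u => g (u - μ)) (fun s => hg _)
    ?_ (eventually_ne_atBot μ) ?_ hlim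
  · refine (key.comp (tendsto_atBot_add_const_left atBot μ tendsto_id)).congr fun s => ?_
    simp
  · filter_upwards [eventually_lt_atBot t₁] with s hs τ hτ
    have h := (hmem (s - μ)).2.2
    have e1 : ((μ : ℂ) + (s - μ : ℝ) + g (s - μ) * I).im = g (s - μ) := by simp
    have e2 : ((μ : ℂ) + (s - μ : ℝ) + g (s - μ) * I).re = s := by simp
    rw [e1, e2] at h
    have h' : 0 < σ * g (s - μ) := h.resolve_right (by linarith)
    refine ⟨H.abs_scaled_lt (hg _) hτ s, Or.inr ?_, Or.inl ?_⟩
    · simp; linarith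
    · have : ((s : ℂ) + (τ * g (s - μ) : ℝ) * I).im = τ * g (s - μ) := by simp
      rw [this, mul_left_comm]
      exact mul_pos hτ.1 h'
  · intro ε hε
    obtain ⟨R, hR⟩ := eventually_stripBot.1
      (Metric.tendsto_nhds.1 (H.tendsto_branchP_left hσ) ε hε)
    filter_upwards [eventually_le_atBot R] with s hs τ hτ
    have := hR _ (H.abs_scaled_lt (hg (s - μ)) hτ s) (by simpa using hs)
    rw [dist_eq_norm] at this
    exact this.le

lemma tendsto_starPrim_path_right (H : KleinPair a b t₁ t₂ μ M am ap η r v C)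
    (hσ : σ = 1 ∨ σ = -1) {L : ℂ} {g : ℝ → ℝ} (hg : ∀ s, |g s| ≤ η / 2)
    (hmem : ∀ s : ℝ, (μ : ℂ) + s + g s * I ∈ kleinDom σ t₁ t₂ η r)
    (hlim : Tendsto (fun s : ℝ => starPrim μ (fun x => branchP σ (a x) (b x)) s -
      (-σ * (Real.sqrt (ap * (ap - M)) : ℝ) : ℂ) * s) atTop (𝓝 L)) :
    Tendsto (fun s : ℝ => starPrim μ (fun x => branchP σ (a x) (b x)) (μ + s + g s * I) -
      (-σ * (Real.sqrt (ap * (ap - M)) : ℝ) : ℂ) * (μ + s + g s * I)) atTop (𝓝 L) := by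
  have hr := H.r_pos
  have hgap := H.gap
  have key := H.tendsto_starPrim_of_eventually_mem hσ (g := fun u => g (u - μ)) (fun s => hg _)
    ?_ (eventually_ne_atTop μ) ?_ hlim
  · refine (key.comp (tendsto_atTop_add_const_left atTop μ tendsto_id)).congr fun s => ?_
    simp
  · filter_upwards [eventually_gt_atTop t₂] with s hs τ hτ
    have h := (hmem (s - μ)).2.1
    have e1 : ((μ : ℂ) + (s - μ : ℝ) + g (s - μ) * I).im = g (s - μ) := by simp
    have e2 : ((μ : ℂ) + (s - μ : ℝ) + g (s - μ) * I).re = s := by simp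
    rw [e1, e2] at h
    have h' : 0 < g (s - μ) := h.resolve_right (by linarith)
    refine ⟨H.abs_scaled_lt (hg _) hτ s, Or.inl ?_, Or.inr ?_⟩
    · have : ((s : ℂ) + (τ * g (s - μ) : ℝ) * I).im = τ * g (s - μ) := by simp
      rw [this]
      exact mul_pos hτ.1 h'
    · simp; linarith
  · intro ε hε
    obtain ⟨R, hR⟩ := eventually_stripTop.1
      (Metric.tendsto_nhds.1 (H.tendsto_branchP_right hσ) ε hε)
    filter_upwards [eventually_ge_atTop R] with s hs τ hτ
    have := hR _ (H.abs_scaled_lt (hg (s - μ)) hτ s) (by simpa using hs)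
    rw [dist_eq_norm] at this
    exact this.le

end KleinPair

lemma sqrt_mul_rpow_sq {x y : ℝ} (hx : 0 < x) (hy : 0 < y) :
    Real.sqrt (x * y) * ((x / y) ^ ((1 : ℝ) / 4)) ^ 2 = x ∧
      y * ((x / y) ^ ((1 : ℝ) / 4)) ^ 2 = Real.sqrt (x * y) := by
  have e : ((x / y) ^ ((1 : ℝ) / 4)) ^ 2 = Real.sqrt (x / y) := by
    rw [Real.sqrt_eq_rpow, ← Real.rpow_natCast, ← Real.rpow_mul (div_pos hx hy).le]
    norm_num
  have hsy := Real.mul_self_sqrt hy.le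
  have hy' := Real.sqrt_pos.2 hy
  rw [e, Real.sqrt_mul hx.le, Real.sqrt_div hx.le]
  constructor
  · field_simp
    exact Real.sq_sqrt hx.le
  · field_simp
    nlinarith

lemma HasDerivAt.eq_on_strip {η : ℝ} {f₁ f₂ u₁ u₂ v₁ v₂ : ℂ → ℂ}
    (hu1 : ∀ x ∈ strip η, HasDerivAt u₁ (f₁ x * u₂ x) x)
    (hu2 : ∀ x ∈ strip η, HasDerivAt u₂ (f₂ x * u₁ x) x)
    (hv1 : ∀ x ∈ strip η, HasDerivAt v₁ (f₁ x * v₂ x) x)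
    (hv2 : ∀ x ∈ strip η, HasDerivAt v₂ (f₂ x * v₁ x) x) {x y : ℂ}
    (hx : x ∈ strip η) (hy : y ∈ strip η) :
    u₁ x * v₂ x - u₂ x * v₁ x = u₁ y * v₂ y - u₂ y * v₁ y := by
  have hd : ∀ x ∈ strip η, HasDerivAt (fun x => u₁ x * v₂ x - u₂ x * v₁ x) 0 x := fun x hx => by
    refine (((hu1 x hx).mul (hv2 x hx)).sub ((hu2 x hx).mul (hv1 x hx))).congr_deriv ?_
    ring
  exact (isOpen_strip η).is_const_of_deriv_eq_zero (convex_strip η).isPreconnected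
    (f := fun x => u₁ x * v₂ x - u₂ x * v₁ x)
    (fun x hx => (hd x hx).differentiableAt.differentiableWithinAt)
    (fun x hx => (hd x hx).deriv) hx hy

namespace KleinPair

variable {a b : ℂ → ℂ} {t₁ t₂ μ M am ap η r v C σ : ℝ}

lemma norm_I_div_mul_le {h K : ℝ} (hh : 0 < h) {z : ℂ} (hz : ‖z‖ ≤ K) :
    ‖I / h * z‖ ≤ K / h := by
  rw [norm_mul, norm_div, Complex.norm_I, Complex.norm_real, Real.norm_of_nonneg hh.le,
    one_div, inv_mul_eq_div]
  gcongr

lemma tendsto_path_left (H : KleinPair a b t₁ t₂ μ M am ap η r v C) {h : ℝ} (hh : 0 < h)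
    {g : ℝ → ℝ} (hg : ∀ s, |g s| < η) {u₁ u₂ : ℂ → ℂ}
    (d1 : ∀ x ∈ strip η, HasDerivAt u₁ (I / h * a x * u₂ x) x)
    (d2 : ∀ x ∈ strip η, HasDerivAt u₂ (I / h * b x * u₁ x) x) {θ v₁ v₂ : ℂ}
    (hθ1 : I / h * am * v₂ = θ * v₁) (hθ2 : I / h * (am - M : ℝ) * v₁ = θ * v₂)
    (hl1 : Tendsto (fun s : ℝ => u₁ s * Complex.exp (-(θ * s))) atBot (𝓝 v₁))
    (hl2 : Tendsto (fun s : ℝ => u₂ s * Complex.exp (-(θ * s))) atBot (𝓝 v₂)) :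
    Tendsto (fun s : ℝ => u₁ (μ + s + g s * I) * Complex.exp (-(θ * (μ + s + g s * I)))) atBot
      (𝓝 v₁) ∧
    Tendsto (fun s : ℝ => u₂ (μ + s + g s * I) * Complex.exp (-(θ * (μ + s + g s * I)))) atBot
      (𝓝 v₂) := by
  have aux : ∀ {f : ℂ → ℂ} {f₀ : ℂ}, Tendsto f (stripBot η) (𝓝 f₀) → ∀ ε > 0, ∀ᶠ s : ℝ in atBot,
      ∀ t : ℝ, |t| < η → ‖I / h * f (s + t * I) - I / h * f₀‖ ≤ ε := by
    intro f f₀ hf ε hε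
    obtain ⟨R, hR⟩ := eventually_stripBot.1
      (Metric.tendsto_nhds.1 (hf.const_mul (I / (h : ℂ))) ε hε)
    filter_upwards [eventually_le_atBot R] with s hs t ht
    have := hR (s + t * I) (by simpa [strip] using ht) (by simpa using hs)
    rw [dist_eq_norm] at this
    exact this.le
  have key := tendsto_vertical_shift H.η_pos (div_pos H.C_pos hh).le
    (fun x hx => norm_I_div_mul_le hh (H.norm_a_le x hx))
    (fun x hx => norm_I_div_mul_le hh (H.norm_b_le x hx)) d1 d2 (aux H.tendsto_a_left)
    (aux H.tendsto_b_left) hθ1 hθ2 hl1 hl2 (g := fun s => g (s - μ)) (fun s => hg _)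
  have hs := tendsto_atBot_add_const_left atBot μ tendsto_id
  exact ⟨(key.1.comp hs).congr fun s => by simp, (key.2.comp hs).congr fun s => by simp⟩

lemma tendsto_path_right (H : KleinPair a b t₁ t₂ μ M am ap η r v C) {h : ℝ} (hh : 0 < h)
    {g : ℝ → ℝ} (hg : ∀ s, |g s| < η) {u₁ u₂ : ℂ → ℂ}
    (d1 : ∀ x ∈ strip η, HasDerivAt u₁ (I / h * a x * u₂ x) x)
    (d2 : ∀ x ∈ strip η, HasDerivAt u₂ (I / h * b x * u₁ x) x) {θ v₁ v₂ : ℂ}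
    (hθ1 : I / h * ap * v₂ = θ * v₁) (hθ2 : I / h * (ap - M : ℝ) * v₁ = θ * v₂)
    (hl1 : Tendsto (fun s : ℝ => u₁ s * Complex.exp (-(θ * s))) atTop (𝓝 v₁))
    (hl2 : Tendsto (fun s : ℝ => u₂ s * Complex.exp (-(θ * s))) atTop (𝓝 v₂)) :
    Tendsto (fun s : ℝ => u₁ (μ + s + g s * I) * Complex.exp (-(θ * (μ + s + g s * I)))) atTop
      (𝓝 v₁) ∧
    Tendsto (fun s : ℝ => u₂ (μ + s + g s * I) * Complex.exp (-(θ * (μ + s + g s * I)))) atTop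
      (𝓝 v₂) := by
  have aux : ∀ {f : ℂ → ℂ} {f₀ : ℂ}, Tendsto f (stripTop η) (𝓝 f₀) → ∀ ε > 0, ∀ᶠ s : ℝ in atTop,
      ∀ t : ℝ, |t| < η → ‖I / h * f (s + t * I) - I / h * f₀‖ ≤ ε := by
    intro f f₀ hf ε hε
    obtain ⟨R, hR⟩ := eventually_stripTop.1
      (Metric.tendsto_nhds.1 (hf.const_mul (I / (h : ℂ))) ε hε)
    filter_upwards [eventually_ge_atTop R] with s hs t ht
    have := hR (s + t * I) (by simpa [strip] using ht) (by simpa using hs)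
    rw [dist_eq_norm] at this
    exact this.le
  have key := tendsto_vertical_shift H.η_pos (div_pos H.C_pos hh).le
    (fun x hx => norm_I_div_mul_le hh (H.norm_a_le x hx))
    (fun x hx => norm_I_div_mul_le hh (H.norm_b_le x hx)) d1 d2 (aux H.tendsto_a_right)
    (aux H.tendsto_b_right) hθ1 hθ2 hl1 hl2 (g := fun s => g (s - μ)) (fun s => hg _)
  have hs := tendsto_atTop_add_const_left atTop μ tendsto_id
  exact ⟨(key.1.comp hs).congr fun s => by simp, (key.2.comp hs).congr fun s => by simp⟩

/-- The first-order system satisfied by the two amplitudes of a solution. -/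
lemma hasDerivAt_amplitudes (H : KleinPair a b t₁ t₂ μ M am ap η r v C) (hσ : σ = 1 ∨ σ = -1)
    {h : ℝ} (hh : 0 < h) {u₁ u₂ P : ℂ → ℂ} {L x : ℂ} (hx : x ∈ kleinDom σ t₁ t₂ η r)
    (d1 : HasDerivAt u₁ (I / h * a x * u₂ x) x) (d2 : HasDerivAt u₂ (I / h * b x * u₁ x) x)
    (hP : HasDerivAt P (branchP σ (a x) (b x)) x) {τ : ℝ} (hτ : τ = 1 ∨ τ = -1) :
    HasDerivAt (fun x => (u₁ x / branchA σ (a x) (b x) + τ * σ * branchA σ (a x) (b x) * u₂ x) / 2 *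
        Complex.exp (-(σ * I * (P x - L) / h)))
      (-((1 - τ) / h * (σ * I * branchP σ (a x) (b x)) *
        ((u₁ x / branchA σ (a x) (b x) + τ * σ * branchA σ (a x) (b x) * u₂ x) / 2 *
          Complex.exp (-(σ * I * (P x - L) / h)))) -
        kleinQ a b x * ((u₁ x / branchA σ (a x) (b x) - τ * σ * branchA σ (a x) (b x) * u₂ x) / 2 *
          Complex.exp (-(σ * I * (P x - L) / h)))) x := by
  have hA0 : branchA σ (a x) (b x) ≠ 0 := branchA_ne_zero
  have hA := H.hasDerivAt_branchA hσ hx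
  have ha0 := H.a_ne_zero hx
  have hb0 := H.b_ne_zero hσ hx
  have e1 : branchA σ (a x) (b x) ^ 2 * branchP σ (a x) (b x) = a x := branchA_sq_mul ha0
  have e2 : branchP σ (a x) (b x) ^ 2 = a x * b x := branchP_sq hσ ha0 hb0
  have e3 : branchP σ (a x) (b x) = branchA σ (a x) (b x) ^ 2 * b x := by
    have hP0 : branchP σ (a x) (b x) ≠ 0 := branchP_ne_zero
    apply mul_right_cancel₀ hP0
    linear_combination e2 - b x * e1
  have hh' : (h : ℂ) ≠ 0 := by exact_mod_cast hh.ne'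
  have hσ2 : (σ : ℂ) * σ = 1 := ofReal_sign_mul_self hσ
  have hτ2 : (τ : ℂ) * τ = 1 := ofReal_sign_mul_self hτ
  have hE : HasDerivAt (fun x => Complex.exp (-(σ * I * (P x - L) / h)))
      (Complex.exp (-(σ * I * (P x - L) / h)) * (-(σ * I * branchP σ (a x) (b x) / h))) x :=
    ((((hP.sub_const L).const_mul (σ * I)).div_const (h : ℂ)).neg).cexp
  refine ((((d1.div hA hA0).add ((hA.const_mul ((τ : ℂ) * σ)).mul d2)).div_const 2).mul
    hE).congr_deriv ?_
  simp only [Pi.add_apply, Pi.mul_apply, Pi.div_apply]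
  set A := branchA σ (a x) (b x)
  set p := branchP σ (a x) (b x)
  have ea : I / h * a x * u₂ x / A = I / h * p * A * u₂ x := by
    rw [← e1]; field_simp
  have eb : A * b x = p / A := by rw [e3]; field_simp
  have f1 : (I / h * a x * u₂ x * A - u₁ x * (kleinQ a b x * A)) / A ^ 2 =
      I / h * p * A * u₂ x - kleinQ a b x * (u₁ x / A) := by
    rw [← ea]; field_simp
  have f2 : τ * σ * (kleinQ a b x * A) * u₂ x + τ * σ * A * (I / h * b x * u₁ x) =
      τ * σ * (kleinQ a b x * A) * u₂ x + τ * σ * I / h * p * (u₁ x / A) := by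
    linear_combination (τ * σ * (I / h) * u₁ x) * eb
  rw [f1, f2]
  set X := u₁ x / A
  set e := Complex.exp (-(σ * I * (P x - L) / h))
  field_simp
  have hτs : (τ : ℂ) ^ 2 = 1 := by rw [pow_two]; exact hτ2
  have hσs : (σ : ℂ) ^ 2 = 1 := by rw [pow_two]; exact hσ2
  ring_nf
  simp only [hτs, hσs]
  ring
end KleinPair

namespace KleinPair

variable {a b : ℂ → ℂ} {t₁ t₂ μ M am ap η r v C σ : ℝ}

lemma exp_quarter_sign_sq (hσ : σ = 1 ∨ σ = -1) :
    Complex.exp (Real.pi / 4 * I * (σ - 1)) ^ 2 = σ := by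
  rw [← Complex.exp_nat_mul]
  rcases hσ with rfl | rfl
  · simp
  · rw [show ((2 : ℕ) : ℂ) * (Real.pi / 4 * I * (((-1 : ℝ) : ℂ) - 1)) = -(Real.pi * I) by
      push_cast; ring, Complex.exp_neg, Complex.exp_pi_mul_I]
    norm_num

/-- The amplitudes of the solution incoming from the left solve the transport system, and the
limit of the first one at `+∞` is a multiple of the Wronskian with the right solution. -/
lemma exists_transportSolution (H : KleinPair a b t₁ t₂ μ M am ap η r v C) (hσ : σ = 1 ∨ σ = -1)
    {h : ℝ} (hh : 0 < h) {g g' : ℝ → ℝ} {δ C' : ℝ} (hg : ∀ s, |g s| ≤ η / 2)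
    (T : TransportPath (kleinDom σ t₁ t₂ η r) (fun x => σ * I * branchP σ (a x) (b x)) (kleinQ a b)
      (fun s => μ + s + g s * I) (fun s => 1 + g' s * I) δ C') {P : ℂ → ℂ} {Lm Lp W : ℂ}
    (hP : ∀ x ∈ kleinDom σ t₁ t₂ η r, HasDerivAt P (branchP σ (a x) (b x)) x)
    (hPl : Tendsto (fun s : ℝ => P (μ + s + g s * I) -
      ((Real.sqrt (am * (am - M)) : ℝ) : ℂ) * (μ + s + g s * I)) atBot (𝓝 Lm))
    (hPr : Tendsto (fun s : ℝ => P (μ + s + g s * I) -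
      (-σ * (Real.sqrt (ap * (ap - M)) : ℝ) : ℂ) * (μ + s + g s * I)) atTop (𝓝 Lp))
    {ω₁ ω₂ ν₁ ν₂ : ℝ → ℂ}
    (hω1 : ∀ s : ℝ, HasDerivAt ω₁ (I / h * a s * ω₂ s) s)
    (hω2 : ∀ s : ℝ, HasDerivAt ω₂ (I / h * b s * ω₁ s) s)
    (hν1 : ∀ s : ℝ, HasDerivAt ν₁ (I / h * a s * ν₂ s) s)
    (hν2 : ∀ s : ℝ, HasDerivAt ν₂ (I / h * b s * ν₁ s) s)
    (hωl1 : Tendsto (fun s : ℝ => ω₁ s * Complex.exp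
      (-(σ * I / h * (Real.sqrt (am * (am - M)) : ℝ) * s))) atBot
      (𝓝 (((am / (am - M)) ^ ((1 : ℝ) / 4) : ℝ) : ℂ)))
    (hωl2 : Tendsto (fun s : ℝ => ω₂ s * Complex.exp
      (-(σ * I / h * (Real.sqrt (am * (am - M)) : ℝ) * s))) atBot
      (𝓝 (σ * (((am / (am - M)) ^ ((1 : ℝ) / 4) : ℝ) : ℂ)⁻¹)))
    (hνr1 : Tendsto (fun s : ℝ => ν₁ s * Complex.exp
      (-(I / h * (Real.sqrt (ap * (ap - M)) : ℝ) * s))) atTop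
      (𝓝 (((ap / (ap - M)) ^ ((1 : ℝ) / 4) : ℝ) : ℂ)))
    (hνr2 : Tendsto (fun s : ℝ => ν₂ s * Complex.exp
      (-(I / h * (Real.sqrt (ap * (ap - M)) : ℝ) * s))) atTop
      (𝓝 (-(((ap / (ap - M)) ^ ((1 : ℝ) / 4) : ℝ) : ℂ)⁻¹)))
    (hW : ∀ s : ℝ, ω₁ s * ν₂ s - ω₂ s * ν₁ s = W) :
    ∃ w₁ w₂, TransportSolution (fun x => σ * I * branchP σ (a x) (b x)) (kleinQ a b)
      (fun s => μ + s + g s * I) (fun s => 1 + g' s * I) h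
      (W * Complex.exp (-(σ * I * (Lp - Lm) / h)) /
        (-2 * Complex.exp (Real.pi / 4 * I * (σ - 1)))) w₁ w₂ := by
  have hM := H.M_pos
  have ham := H.am_gt
  have hap := H.ap_neg
  have hη := H.η_pos
  have hh' : (h : ℂ) ≠ 0 := by exact_mod_cast hh.ne'
  have hσ2 : (σ : ℂ) * σ = 1 := ofReal_sign_mul_self hσ
  have hξ2 := exp_quarter_sign_sq hσ
  have hξ0 : Complex.exp (Real.pi / 4 * I * (σ - 1)) ≠ 0 := Complex.exp_ne_zero _
  have hgη : ∀ s, |g s| < η := fun s => (hg s).trans_lt (by linarith)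
  have hAl := (H.tendsto_branchA_left hσ).comp (tendsto_path_stripBot (μ := μ) hgη)
  have hAr := (H.tendsto_branchA_right hσ).comp (tendsto_path_stripTop (μ := μ) hgη)
  set ξ := Complex.exp (Real.pi / 4 * I * (σ - 1)) with hξ
  set k := Real.sqrt (am * (am - M)) with hk
  set kp := Real.sqrt (ap * (ap - M)) with hkp
  set Am := (am / (am - M)) ^ ((1 : ℝ) / 4) with hAm
  set Ap := (ap / (ap - M)) ^ ((1 : ℝ) / 4) with hAp
  have hAm0 : 0 < Am := Real.rpow_pos_of_pos (div_pos (by linarith) (by linarith)) _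
  have hAp0 : 0 < Ap := Real.rpow_pos_of_pos (div_pos_of_neg_of_neg hap (by linarith)) _
  have hAm0' : (Am : ℂ) ≠ 0 := by exact_mod_cast hAm0.ne'
  have hAp0' : (Ap : ℂ) ≠ 0 := by exact_mod_cast hAp0.ne'
  obtain ⟨rm1, rm2⟩ := sqrt_mul_rpow_sq (x := am) (y := am - M) (by linarith) (by linarith)
  obtain ⟨rp1, rp2⟩ := sqrt_mul_rpow_sq (x := -ap) (y := -(ap - M)) (by linarith) (by linarith)
  rw [neg_mul_neg, neg_div_neg_eq] at rp1 rp2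
  rw [← hk, ← hAm] at rm1 rm2
  rw [← hkp, ← hAp] at rp1 rp2
  have rm1' : (k : ℂ) * (Am : ℂ) ^ 2 = am := by exact_mod_cast rm1
  have rm2' : ((am - M : ℝ) : ℂ) * (Am : ℂ) ^ 2 = k := by exact_mod_cast rm2
  have rp1' : (kp : ℂ) * (Ap : ℂ) ^ 2 = -ap := by exact_mod_cast rp1
  have rp2' : -((ap - M : ℝ) : ℂ) * (Ap : ℂ) ^ 2 = kp := by exact_mod_cast rp2
  have dfa : DifferentiableOn ℂ (fun x => I / h * a x) (strip η) := H.diff_a.const_mul _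
  have dfb : DifferentiableOn ℂ (fun x => I / h * b x) (strip η) := fun x hx =>
    ((H.hasDerivAt_b hx).const_mul (I / (h : ℂ))).differentiableAt.differentiableWithinAt
  have bda : ∀ x ∈ strip η, ‖I / h * a x‖ ≤ C / h :=
    fun x hx => norm_I_div_mul_le hh (H.norm_a_le x hx)
  have bdb : ∀ x ∈ strip η, ‖I / h * b x‖ ≤ C / h :=
    fun x hx => norm_I_div_mul_le hh (H.norm_b_le x hx)
  have hK := (div_pos H.C_pos hh).le
  obtain ⟨u₁, u₂, eu1, eu2, du1, du2⟩ := exists_holomorphic_extension hη dfa dfb hK bda bdb hω1 hω2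
  obtain ⟨n₁, n₂, en1, en2, dn1, dn2⟩ := exists_holomorphic_extension hη dfa dfb hK bda bdb hν1 hν2
  obtain ⟨ul1, ul2⟩ := H.tendsto_path_left hh hgη du1 du2 (θ := σ * I / h * k) (v₁ := Am)
    (v₂ := σ * (Am : ℂ)⁻¹) (by rw [← rm1']; field_simp)
    (by rw [← rm2']; field_simp; rw [pow_two (σ : ℂ), hσ2, mul_one])
    (hωl1.congr fun s => by rw [eu1]) (hωl2.congr fun s => by rw [eu2])
  obtain ⟨nr1, nr2⟩ := H.tendsto_path_right hh hgη dn1 dn2 (θ := I / h * kp) (v₁ := Ap)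
    (v₂ := -(Ap : ℂ)⁻¹) (by rw [← neg_neg (ap : ℂ), ← rp1']; field_simp)
    (by rw [← rp2']; field_simp) (hνr1.congr fun s => by rw [en1])
    (hνr2.congr fun s => by rw [en2])
  have hWs : ∀ x ∈ strip η, u₁ x * n₂ x - u₂ x * n₁ x = W := fun x hx => by
    rw [HasDerivAt.eq_on_strip du1 du2 dn1 dn2 hx (ofReal_mem_strip hη 0), eu1, eu2, en1, en2, hW]
  set γ : ℝ → ℂ := fun s => μ + s + g s * I with hγ
  set A : ℝ → ℂ := fun s => branchA σ (a (γ s)) (b (γ s)) with hA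
  have hA0 : ∀ s, A s ≠ 0 := fun s => branchA_ne_zero
  set e : ℝ → ℂ := fun s => Complex.exp (-(σ * I * (P (γ s) - Lm) / h)) with he
  set w₁ : ℝ → ℂ := fun s => (u₁ (γ s) / A s + σ * A s * u₂ (γ s)) / 2 * e s with hw₁
  set w₂ : ℝ → ℂ := fun s => (u₁ (γ s) / A s - σ * A s * u₂ (γ s)) / 2 * e s with hw₂
  have hdw1 : ∀ s, HasDerivAt w₁ (-(kleinQ a b (γ s) * (1 + g' s * I) * w₂ s)) s := fun s => by
    have hm := T.mem s
    have key := HasDerivAt.scomp s (H.hasDerivAt_amplitudes hσ hh (L := Lm) hm (du1 _ hm.1)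
      (du2 _ hm.1) (hP _ hm) (τ := 1) (Or.inl rfl)) (T.hasDerivAt s)
    refine (key.congr_deriv ?_).congr_of_eventuallyEq (Eventually.of_forall fun u => ?_)
    · simp only [hw₂, hA, he, hγ, smul_eq_mul]; push_cast; ring
    · simp only [hw₁, hA, he, hγ, Function.comp]; push_cast; ring
  have hdw2 : ∀ s, HasDerivAt w₂ (-(2 / h * (σ * I * branchP σ (a (γ s)) (b (γ s)) *
      (1 + g' s * I)) * w₂ s) - kleinQ a b (γ s) * (1 + g' s * I) * w₁ s) s := fun s => by
    have hm := T.mem s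
    have key := HasDerivAt.scomp s (H.hasDerivAt_amplitudes hσ hh (L := Lm) hm (du1 _ hm.1)
      (du2 _ hm.1) (hP _ hm) (τ := -1) (Or.inr rfl)) (T.hasDerivAt s)
    refine (key.congr_deriv ?_).congr_of_eventuallyEq (Eventually.of_forall fun u => ?_)
    · simp only [hw₁, hw₂, hA, he, hγ, smul_eq_mul]; push_cast; ring
    · simp only [hw₂, hA, he, hγ, Function.comp]; push_cast; ring
  -- behaviour at `-∞`
  have hel : Tendsto (fun s => e s * Complex.exp (σ * I / h * k * γ s)) atBot (𝓝 1) := by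
    have h1 : Tendsto (fun s => Complex.exp (-(σ * I / h) * ((P (γ s) - k * γ s) - Lm))) atBot
        (𝓝 1) := by
      have := ((hPl.sub_const Lm).const_mul (-(σ * I / h : ℂ))).cexp
      rwa [sub_self, mul_zero, Complex.exp_zero] at this
    refine h1.congr fun s => ?_
    rw [he, ← Complex.exp_add]
    congr 1; ring
  have hx1 : Tendsto (fun s => u₁ (γ s) / A s * e s) atBot (𝓝 1) := by
    have := (ul1.div hAl hAm0').mul hel
    rw [div_self hAm0', one_mul] at this
    refine this.congr fun s => ?_
    have : Complex.exp (-(σ * I / h * k * γ s)) * Complex.exp (σ * I / h * k * γ s) = 1 := by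
      rw [← Complex.exp_add, neg_add_cancel, Complex.exp_zero]
    simp only [Pi.div_apply, Function.comp]
    linear_combination (u₁ (γ s) / A s * e s) * this
  have hx2 : Tendsto (fun s => σ * A s * u₂ (γ s) * e s) atBot (𝓝 1) := by
    have := ((hAl.const_mul (σ : ℂ)).mul ul2).mul hel
    rw [show (σ : ℂ) * Am * (σ * (Am : ℂ)⁻¹) * 1 = 1 by
      field_simp; rw [pow_two, hσ2]] at this
    refine this.congr fun s => ?_
    have : Complex.exp (-(σ * I / h * k * γ s)) * Complex.exp (σ * I / h * k * γ s) = 1 := by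
      rw [← Complex.exp_add, neg_add_cancel, Complex.exp_zero]
    simp only [Function.comp]
    linear_combination (σ * A s * u₂ (γ s) * e s) * this
  have hwl1 : Tendsto w₁ atBot (𝓝 1) := by
    have := (hx1.add hx2).div_const 2
    rw [show ((1 : ℂ) + 1) / 2 = 1 by norm_num] at this
    exact this.congr fun s => by simp only [hw₁]; ring
  have hwl2 : Tendsto w₂ atBot (𝓝 0) := by
    have := (hx1.sub hx2).div_const 2
    rw [show ((1 : ℂ) - 1) / 2 = 0 by norm_num] at this
    exact this.congr fun s => by simp only [hw₂]; ring
  refine ⟨w₁, w₂, hdw1, hdw2, hwl1, hwl2, ?_⟩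
  -- behaviour at `+∞`
  have hbdd : ∃ K, ∀ s, ‖w₂ s‖ ≤ K := by
    refine ⟨Real.sqrt ((‖(1 : ℂ)‖ ^ 2 + ‖(0 : ℂ)‖ ^ 2 + 0 ^ 2) * Real.exp (3 * C' ^ 2 * Real.pi)),
      fun s => Real.le_sqrt_of_sq_le ?_⟩
    have := transport_energy_le (e := fun _ => 0) (sq_nonneg C') hdw1
      (lam := fun s => 2 / h * (σ * I * branchP σ (a (γ s)) (b (γ s)) * (1 + g' s * I))) (η := 0)
      (fun s => by simpa using hdw2 s) (fun s => by
        have := T.re_nonneg s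
        rw [show (2 / h : ℂ) = ((2 / h : ℝ) : ℂ) by push_cast; rfl, Complex.re_ofReal_mul]
        exact mul_nonneg (by positivity) this)
      T.norm_coupling_le (fun s => by simp) hwl1 hwl2 s
    linarith [sq_nonneg ‖w₁ s‖]
  obtain ⟨K, hKb⟩ := hbdd
  set N₁ : ℝ → ℂ := fun s => n₁ (γ s) * Complex.exp (-(I / h * kp * γ s)) with hN₁
  set N₂ : ℝ → ℂ := fun s => n₂ (γ s) * Complex.exp (-(I / h * kp * γ s)) with hN₂
  have hrel : ∀ s, (A s * N₂ s - σ * N₁ s / A s) * w₁ s =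
      W * (e s * Complex.exp (-(I / h * kp * γ s))) - (A s * N₂ s + σ * N₁ s / A s) * w₂ s := by
    intro s
    have h1 := hWs _ (T.mem s).1
    have h0 := hA0 s
    simp only [hw₁, hw₂, hN₁, hN₂]
    rw [← h1]
    field_simp
    have hσs : (σ : ℂ) ^ 2 = 1 := by rw [pow_two]; exact hσ2
    ring_nf
    simp only [hσs]
    ring
  have her : Tendsto (fun s => e s * Complex.exp (-(I / h * kp * γ s))) atTop
      (𝓝 (Complex.exp (-(σ * I * (Lp - Lm) / h)))) := by
    have h1 := ((hPr.sub_const Lm).const_mul (-(σ * I / h : ℂ))).cexp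
    rw [show -(σ * I / h : ℂ) * (Lp - Lm) = -(σ * I * (Lp - Lm) / h) by ring] at h1
    refine h1.congr fun s => ?_
    rw [he, ← Complex.exp_add]
    congr 1
    linear_combination (-(I / h * kp * γ s)) * hσ2
  have hσξ : (σ : ℂ) / ξ = ξ := by rw [← hξ2, pow_two]; field_simp
  have ht1 : Tendsto (fun s => A s * N₂ s) atTop (𝓝 (-ξ)) := by
    have := hAr.mul nr2
    rwa [show ξ * Ap * -(Ap : ℂ)⁻¹ = -ξ by field_simp] at this
  have ht2 : Tendsto (fun s => σ * N₁ s / A s) atTop (𝓝 ξ) := by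
    have := (nr1.const_mul (σ : ℂ)).div hAr (mul_ne_zero hξ0 hAp0')
    rwa [mul_div_mul_right _ _ hAp0', hσξ] at this
  have hc1 : Tendsto (fun s => A s * N₂ s - σ * N₁ s / A s) atTop (𝓝 (-2 * ξ)) := by
    have := ht1.sub ht2
    rwa [show -ξ - ξ = -2 * ξ by ring] at this
  have hc2 : Tendsto (fun s => (A s * N₂ s + σ * N₁ s / A s) * w₂ s) atTop (𝓝 0) := by
    have := ht1.add ht2
    rw [neg_add_cancel] at this
    refine squeeze_zero_norm (a := fun s => ‖A s * N₂ s + σ * N₁ s / A s‖ * K) (fun s => ?_) ?_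
    · rw [norm_mul]
      exact mul_le_mul_of_nonneg_left (hKb s) (norm_nonneg _)
    · have := this.norm.mul_const K
      rwa [norm_zero, zero_mul] at this
  have h20 : -2 * ξ ≠ 0 := mul_ne_zero (by norm_num) hξ0
  have hfin := ((her.const_mul W).sub hc2).div hc1 h20
  rw [sub_zero] at hfin
  refine hfin.congr' ?_
  filter_upwards [hc1.eventually_ne h20] with s hs
  simp only [Pi.div_apply]
  rw [← hrel s, mul_div_cancel_left₀ _ hs]

end KleinPair

lemma norm_Qsym_le {m c E W D : ℝ} {V : ℂ → ℂ} {t : ℝ} (hc : 0 < c) (hW : 0 < Esym m c E W)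
    (hD : |(V t).re - W| ≤ D) :
    ‖Qsym m c E W V t‖ ≤ (D + 2 * |W - E|) / (c ^ 2 * Real.sqrt (Esym m c E W)) *
      |(V t).re - W| := by
  have hs := Real.sqrt_pos.2 hW
  have hc2 : 0 < c ^ 2 := by positivity
  set X := (-(m ^ 2 * c ^ 4) + ((V t).re - E) ^ 2) / c ^ 2 with hX
  have h1 : |Real.sqrt X - Real.sqrt (Esym m c E W)| * Real.sqrt (Esym m c E W) ≤
      |X - Esym m c E W| := by
    rcases le_total 0 X with h0 | h0
    · have e : X - Esym m c E W = (Real.sqrt X - Real.sqrt (Esym m c E W)) *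
          (Real.sqrt X + Real.sqrt (Esym m c E W)) := by
        linear_combination Real.sq_sqrt hW.le - Real.sq_sqrt h0
      rw [e, abs_mul]
      refine mul_le_mul_of_nonneg_left ?_ (abs_nonneg _)
      exact (le_add_of_nonneg_left (Real.sqrt_nonneg X)).trans (le_abs_self _)
    · rw [Real.sqrt_eq_zero_of_nonpos h0, zero_sub, abs_neg, abs_of_pos hs,
        Real.mul_self_sqrt hW.le, abs_sub_comm]
      exact (by linarith : Esym m c E W ≤ Esym m c E W - X).trans (le_abs_self _)
  have h2 : X - Esym m c E W = ((V t).re - W) * (((V t).re - W) + 2 * (W - E)) / c ^ 2 := by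
    rw [hX, Esym]; field_simp; ring
  have h3 : |((V t).re - W) + 2 * (W - E)| ≤ D + 2 * |W - E| := by
    refine (abs_add_le _ _).trans (add_le_add hD ?_)
    rw [abs_mul, abs_two]
  rw [h2, abs_div, abs_mul, abs_of_pos hc2] at h1
  have hQ : Qsym m c E W V t = Real.sqrt X - Real.sqrt (Esym m c E W) := rfl
  rw [hQ, Real.norm_eq_abs, div_mul_eq_mul_div, le_div_iff₀ (by positivity)]
  calc _ = c ^ 2 * (|Real.sqrt X - Real.sqrt (Esym m c E W)| * Real.sqrt (Esym m c E W)) := by ring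
    _ ≤ c ^ 2 * (|(V t).re - W| * |((V t).re - W) + 2 * (W - E)| / c ^ 2) := by gcongr
    _ = |((V t).re - W) + 2 * (W - E)| * |(V t).re - W| := by field_simp
    _ ≤ _ := by gcongr

lemma Qsym_isBigO {m c E W δ K : ℝ} {V : ℂ → ℂ} {l : Filter ℝ} (hc : 0 < c)
    (hW : 0 < Esym m c E W) (hδ : 1 < δ)
    (hV : ∀ᶠ s : ℝ in l, ‖V s - W‖ ≤ K * (1 + ‖(s : ℂ)‖ ^ 2) ^ (-(δ / 2))) :
    (fun s => Qsym m c E W V s) =O[l] fun s : ℝ => (1 + ‖s‖ ^ 2) ^ (-δ / 2) := by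
  set B := (|K| + 2 * |W - E|) / (c ^ 2 * Real.sqrt (Esym m c E W)) with hB
  have hB0 : 0 ≤ B := by positivity
  refine Asymptotics.IsBigO.of_bound (B * |K|) ?_
  filter_upwards [hV] with s hs
  have hpos : 0 < (1 + ‖s‖ ^ 2 : ℝ) ^ (-δ / 2) := by positivity
  rw [Complex.norm_real, ← neg_div] at hs
  have h1 : |(V s).re - W| ≤ |K| * (1 + ‖s‖ ^ 2) ^ (-δ / 2) := by
    refine le_trans ?_ (hs.trans (mul_le_mul_of_nonneg_right (le_abs_self K) hpos.le))
    simpa using Complex.abs_re_le_norm (V s - W)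
  have h2 : (1 + ‖s‖ ^ 2 : ℝ) ^ (-δ / 2) ≤ 1 :=
    Real.rpow_le_one_of_one_le_of_nonpos (by nlinarith [sq_nonneg ‖s‖]) (by linarith)
  have h3 : |(V s).re - W| ≤ |K| :=
    h1.trans (mul_le_of_le_one_right (abs_nonneg K) h2)
  rw [Real.norm_of_nonneg hpos.le]
  calc _ ≤ B * |(V s).re - W| := norm_Qsym_le hc hW h3
    _ ≤ B * (|K| * (1 + ‖s‖ ^ 2) ^ (-δ / 2)) := by gcongr
    _ = _ := by ring

lemma AssumptionA.continuous_ofReal {V : ℂ → ℂ} {Vm Vp : ℝ} (hA : AssumptionA V Vm Vp) :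
    Continuous fun s : ℝ => V s := by
  obtain ⟨ε, hε, η, hη, -, -, hV, -⟩ := hA.sector
  refine hV.continuousOn.comp_continuous Complex.continuous_ofReal fun s => ?_
  show |(s : ℂ).im| < _
  simp only [Complex.ofReal_im, Complex.ofReal_re, abs_zero]
  positivity

lemma AssumptionA.integrableOn_Qsym {V : ℂ → ℂ} {Vm Vp m c E : ℝ} (hA : AssumptionA V Vm Vp)
    (hc : 0 < c) (h1 : 0 < Esym m c E Vm) (h2 : 0 < Esym m c E Vp) (t₁ t₂ : ℝ) :
    IntegrableOn (fun s => Qsym m c E Vm V s) (Iic t₁) ∧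
      IntegrableOn (fun s => Qsym m c E Vp V s) (Ici t₂) := by
  have hcV := hA.continuous_ofReal
  have hcQ : ∀ W, Continuous fun s => Qsym m c E W V s := fun W => by
    have : Continuous fun s : ℝ => (V s).re := Complex.continuous_re.comp hcV
    unfold Qsym
    fun_prop
  obtain ⟨ε, hε, η, hη, δ, hδ, hV, ⟨K₁, R₁, hR₁⟩, K₂, R₂, hR₂⟩ := hA.sector
  have hmem : ∀ s : ℝ, (s : ℂ) ∈ Sector ε η := fun s => by
    show |(s : ℂ).im| < _
    simp only [Complex.ofReal_im, Complex.ofReal_re, abs_zero]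
    positivity
  have hi : Integrable fun s : ℝ => (1 + ‖s‖ ^ 2 : ℝ) ^ (-δ / 2) :=
    integrable_rpow_neg_one_add_norm_sq (by simpa using hδ)
  constructor
  · refine ((hcQ Vm).locallyIntegrable.locallyIntegrableOn _).integrableOn_of_isBigO_atBot
      (Qsym_isBigO hc h1 hδ (K := K₂) ?_) (hi.integrableAtFilter _)
    filter_upwards [eventually_le_atBot (-R₂)] with s hs
    exact hR₂ s (hmem s) (by simpa using hs)
  · refine ((hcQ Vp).locallyIntegrable.locallyIntegrableOn _).integrableOn_of_isBigO_atTop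
      (Qsym_isBigO hc h2 hδ (K := K₁) ?_) (hi.integrableAtFilter _)
    filter_upwards [eventually_ge_atTop R₁] with s hs
    exact hR₁ s (hmem s) (by simpa using hs)

lemma IsDiracSolution.hasDerivAt {h m c E : ℝ} {V : ℂ → ℂ} {u : ℝ → ℂ × ℂ}
    (H : IsDiracSolution h m c V E u) (hh : 0 < h) (hc : 0 < c) (s : ℝ) :
    HasDerivAt (fun x => (u x).1) (I / h * ((E - V s + m * c ^ 2) / c) * (u s).2) s ∧
      HasDerivAt (fun x => (u x).2) (I / h * ((E - V s - m * c ^ 2) / c) * (u s).1) s := by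
  have hh' : (h : ℂ) ≠ 0 := by exact_mod_cast hh.ne'
  have hc' : (c : ℂ) ≠ 0 := by exact_mod_cast hc.ne'
  have hI : I * I = -1 := Complex.I_mul_I
  constructor
  · refine (H.diff1 s).hasDerivAt.congr_deriv ?_
    have := H.eq2 s
    apply mul_left_cancel₀ (mul_ne_zero hh' hc')
    field_simp
    linear_combination I * this + (h * c * deriv (fun y : ℝ => (u y).1) s) * hI
  · refine (H.diff2 s).hasDerivAt.congr_deriv ?_
    have := H.eq1 s
    apply mul_left_cancel₀ (mul_ne_zero hh' hc')
    field_simp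
    linear_combination I * this + (h * c * deriv (fun y : ℝ => (u y).2) s) * hI

lemma PhiF_of_pos {m c l : ℝ} (hc : 0 < c) (hl : 0 < l) :
    PhiF m c l = c * Real.sqrt ((l + m * c ^ 2) / c * ((l + m * c ^ 2) / c - 2 * (m * c))) := by
  rw [PhiF, Real.sign_of_pos hl, one_mul, show l ^ 2 - m ^ 2 * c ^ 4 =
    c ^ 2 * ((l + m * c ^ 2) / c * ((l + m * c ^ 2) / c - 2 * (m * c))) by field_simp; ring,
    Real.sqrt_mul (sq_nonneg c), Real.sqrt_sq hc.le]

lemma PhiF_of_neg {m c l : ℝ} (hc : 0 < c) (hl : l < 0) :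
    PhiF m c l = -(c * Real.sqrt ((l + m * c ^ 2) / c * ((l + m * c ^ 2) / c - 2 * (m * c)))) := by
  rw [PhiF, Real.sign_of_neg hl, show l ^ 2 - m ^ 2 * c ^ 4 =
    c ^ 2 * ((l + m * c ^ 2) / c * ((l + m * c ^ 2) / c - 2 * (m * c))) by field_simp; ring,
    Real.sqrt_mul (sq_nonneg c), Real.sqrt_sq hc.le, neg_one_mul]

lemma AmpF_eq {m c l : ℝ} (hc : 0 < c) :
    AmpF m c l =
      ((l + m * c ^ 2) / c / ((l + m * c ^ 2) / c - 2 * (m * c))) ^ ((1 : ℝ) / 4) := by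
  rw [AmpF, show (l + m * c ^ 2) / c - 2 * (m * c) = (l - m * c ^ 2) / c by field_simp; ring,
    div_div_div_cancel_right₀ hc.ne']

lemma Esym_eq {m c E W : ℝ} (hc : 0 < c) :
    Esym m c E W =
      (E - W + m * c ^ 2) / c * ((E - W + m * c ^ 2) / c - 2 * (m * c)) := by
  rw [Esym]; field_simp; ring

/-- The Jost condition in terms of the momentum `κ`, where `Φ(E - V₀) = c * κ`. -/
lemma JostCond.tendsto {h m c E V0 s s' κ : ℝ} {l : Filter ℝ} {u : ℝ → ℂ × ℂ}
    (H : JostCond h m c E V0 s s' l u) (hc : 0 < c) (hκ : PhiF m c (E - V0) = c * κ) :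
    Tendsto (fun x : ℝ => (u x).1 * Complex.exp (-(s * I / h * κ * x))) l
        (𝓝 (AmpF m c (E - V0) : ℂ)) ∧
      Tendsto (fun x : ℝ => (u x).2 * Complex.exp (-(s * I / h * κ * x))) l
        (𝓝 (s' * (AmpF m c (E - V0) : ℂ)⁻¹)) := by
  have hc' : (c : ℂ) ≠ 0 := by exact_mod_cast hc.ne'
  have e : (s : ℂ) * I / (h * c) * (PhiF m c (E - V0) : ℝ) = s * I / h * κ := by
    rw [hκ, Complex.ofReal_mul, ← mul_assoc, div_mul_eq_mul_div, mul_div_mul_right _ _ hc']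
  obtain ⟨h1, h2⟩ := H
  rw [e] at h1 h2
  exact ⟨h1, h2⟩

/-- The Wronskian of two solutions with opposite Jost behaviour is constant, equal to `-2`. -/
lemma wron_eq_neg_two {h m c E V0 : ℝ} {V : ℂ → ℂ} {u v : ℝ → ℂ × ℂ} (hh : 0 < h) (hc : 0 < c)
    (hA0 : 0 < AmpF m c (E - V0)) (Hu : IsDiracSolution h m c V E u)
    (Hv : IsDiracSolution h m c V E v) (ju : JostCond h m c E V0 1 1 atTop u)
    (jv : JostCond h m c E V0 (-1) (-1) atTop v) (x : ℝ) : Wron (u x) (v x) = -2 := by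
  have hd : ∀ s, HasDerivAt (fun s => Wron (u s) (v s)) 0 s := fun s => by
    refine (((Hu.hasDerivAt hh hc s).1.mul (Hv.hasDerivAt hh hc s).2).sub
      ((Hu.hasDerivAt hh hc s).2.mul (Hv.hasDerivAt hh hc s).1)).congr_deriv ?_
    ring
  have hconst : ∀ s, Wron (u s) (v s) = Wron (u x) (v x) := fun s =>
    is_const_of_deriv_eq_zero (fun s => (hd s).differentiableAt) (fun s => (hd s).deriv) s x
  have hA0' : (AmpF m c (E - V0) : ℂ) ≠ 0 := by exact_mod_cast hA0.ne'
  have hlim := (ju.1.mul jv.2).sub (ju.2.mul jv.1)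
  refine tendsto_nhds_unique (l := atTop) (f := fun _ : ℝ => Wron (u x) (v x))
    tendsto_const_nhds ((hlim.congr fun s => ?_).trans (le_of_eq ?_))
  · rw [← hconst s, Wron]
    set θ := I / ((h : ℂ) * c) * (PhiF m c (E - V0) : ℂ) * s with hθ
    have e1 : ((1 : ℝ) : ℂ) * I / ((h : ℂ) * c) * (PhiF m c (E - V0) : ℂ) * s = θ := by
      rw [hθ]; push_cast; ring
    have e2 : ((-1 : ℝ) : ℂ) * I / ((h : ℂ) * c) * (PhiF m c (E - V0) : ℂ) * s = -θ := by
      rw [hθ]; push_cast; ring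
    have e3 : Complex.exp (-θ) * Complex.exp θ = 1 := by
      rw [← Complex.exp_add, neg_add_cancel, Complex.exp_zero]
    simp only [e1, e2, neg_neg]
    linear_combination ((u s).1 * (v s).2 - (u s).2 * (v s).1) * e3
  · congr 1
    push_cast
    field_simp
    norm_num

/-- The Wronskian of a left and a right Jost solution, up to its exponential factor, is
`1 + hφ` with `φ` a classical analytic symbol. -/
lemma exists_wronskian_symbol {m c Vm Vp E t₁ t₂ σ : ℝ} {V : ℂ → ℂ}
    (hA : AssumptionA V Vm Vp) (hm : 0 < m) (hc : 0 < c)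
    (hE1 : Vm + m * c ^ 2 < E) (hE2 : E < Vp - m * c ^ 2) (ht12 : t₁ < t₂)
    (hzeros : ∀ x : ℝ, m ^ 2 * c ^ 4 - ((V x).re - E) ^ 2 = 0 ↔ x = t₁ ∨ x = t₂)
    (hsimp1 : deriv (fun x : ℝ => m ^ 2 * c ^ 4 - ((V x).re - E) ^ 2) t₁ ≠ 0)
    (hsimp2 : deriv (fun x : ℝ => m ^ 2 * c ^ 4 - ((V x).re - E) ^ 2) t₂ ≠ 0)
    (hσ : σ = 1 ∨ σ = -1) {ωl ωr : ℝ → ℝ → ℂ × ℂ}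
    (hl : ∀ h : ℝ, 0 < h → IsDiracSolution h m c V E (ωl h))
    (hr : ∀ h : ℝ, 0 < h → IsDiracSolution h m c V E (ωr h))
    (jl : ∀ h : ℝ, 0 < h → JostCond h m c E Vm σ σ atBot (ωl h))
    (jr : ∀ h : ℝ, 0 < h → JostCond h m c E Vp (-1) (-1) atTop (ωr h)) {W : ℝ → ℂ}
    (hW : ∀ h : ℝ, 0 < h → ∀ x, Wron (ωl h x) (ωr h x) = W h) :
    ∃ φ : ℝ → ℂ, IsCAS φ ∧ ∃ h₁ > 0, ∀ h : ℝ, 0 < h → h < h₁ →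
      W h = -2 * Complex.exp (Real.pi / 4 * I * (σ - 1)) * (1 + h * φ h) *
        Complex.exp ((1 / (h : ℂ)) *
          (σ * (I * ((((∫ t in Set.Iic t₁, Qsym m c E Vm V t)
              + Real.sqrt (Esym m c E Vm) * t₁ : ℝ)) : ℂ))
           + I * ((((-∫ t in Set.Ici t₂, Qsym m c E Vp V t)
              + Real.sqrt (Esym m c E Vp) * t₂ : ℝ)) : ℂ)
           + ((SAct m c E V t₁ t₂ : ℝ) : ℂ))) := by
  have hmc : 0 < m * c ^ 2 := by positivity
  have hσ2 : (σ : ℂ) * σ = 1 := ofReal_sign_mul_self hσ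
  have hreal := hA.real_on_real
  obtain ⟨η₀, C₀, H₀⟩ := hA.exists_stripPotential ((t₁ + t₂) / 2)
  obtain ⟨X1, X2⟩ := H₀.crossings hreal hmc (by ring : m ^ 2 * c ^ 4 = (m * c ^ 2) ^ 2) hE1 hE2
    ht12 hzeros hsimp1 hsimp2
  obtain ⟨η, r, v, C, H⟩ := H₀.exists_kleinPair hreal hm hc rfl ht12 hE1 hE2 X1 X2
  obtain ⟨g, g', δ, C', hg, T⟩ := H.exists_transportPath hσ
  have hP := fun x (hx : x ∈ kleinDom σ t₁ t₂ η r) =>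
    hasDerivAt_starPrim (isOpen_kleinDom σ t₁ t₂ η r) H.starConvex_dom
      (H.differentiableOn_branchP hσ) hx
  have hEm : 0 < Esym m c E Vm := by
    rw [Esym_eq hc]
    exact mul_pos (by linarith [H.am_gt, H.M_pos]) (by linarith [H.am_gt])
  have hEp : 0 < Esym m c E Vp := by
    rw [Esym_eq hc]
    exact mul_pos_of_neg_of_neg H.ap_neg (by linarith [H.ap_neg, H.M_pos])
  have hprod : ∀ s : ℝ, ((E - V s + m * c ^ 2) / c : ℂ).re * ((E - V s - m * c ^ 2) / c : ℂ).re =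
      (-(m ^ 2 * c ^ 4) + ((V s).re - E) ^ 2) / c ^ 2 := by
    intro s
    have e : (m * c ^ 2 : ℂ) = ((m * c ^ 2 : ℝ) : ℂ) := by push_cast; rfl
    rw [e, Complex.div_ofReal_re, Complex.div_ofReal_re]
    simp only [Complex.sub_re, Complex.add_re, Complex.ofReal_re]
    field_simp
    ring
  have hprod' : ∀ s : ℝ, -(((E - V s + m * c ^ 2) / c : ℂ).re *
      ((E - V s - m * c ^ 2) / c : ℂ).re) = (m ^ 2 * c ^ 4 - ((V s).re - E) ^ 2) / c ^ 2 := by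
    intro s; rw [hprod]; ring
  obtain ⟨iQm, iQp⟩ := hA.integrableOn_Qsym hc hEm hEp t₁ t₂
  have eQm : (fun s : ℝ => Real.sqrt (((E - V s + m * c ^ 2) / c : ℂ).re *
      ((E - V s - m * c ^ 2) / c : ℂ).re) - Real.sqrt (Esym m c E Vm)) = Qsym m c E Vm V := by
    funext s; rw [hprod]; rfl
  have eQp : (fun s : ℝ => Real.sqrt (((E - V s + m * c ^ 2) / c : ℂ).re *
      ((E - V s - m * c ^ 2) / c : ℂ).re) - Real.sqrt (Esym m c E Vp)) = Qsym m c E Vp V := by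
    funext s; rw [hprod]; rfl
  have hLm := H.tendsto_starPrim_left hσ (k := Real.sqrt (Esym m c E Vm)) (by rw [eQm]; exact iQm)
  have hLp := H.tendsto_starPrim_right hσ (k := Real.sqrt (Esym m c E Vp)) (by rw [eQp]; exact iQp)
  rw [eQm] at hLm
  rw [eQp] at hLp
  simp only [hprod'] at hLm hLp
  rw [Esym_eq hc] at hLm hLp
  have hPl := H.tendsto_starPrim_path_left hσ hg (fun s => T.mem s) hLm
  have hPr := H.tendsto_starPrim_path_right hσ hg (fun s => T.mem s) hLp
  have hS : (SAct m c E V t₁ t₂ : ℝ) =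
      (∫ t in t₁..(t₁ + t₂) / 2, Real.sqrt ((m ^ 2 * c ^ 4 - ((V t).re - E) ^ 2) / c ^ 2)) +
      ∫ t in (t₁ + t₂) / 2..t₂, Real.sqrt ((m ^ 2 * c ^ 4 - ((V t).re - E) ^ 2) / c ^ 2) := by
    have hcont : Continuous fun t : ℝ =>
        Real.sqrt ((m ^ 2 * c ^ 4 - ((V t).re - E) ^ 2) / c ^ 2) := by
      have : Continuous fun s : ℝ => (V s).re := Complex.continuous_re.comp hA.continuous_ofReal
      fun_prop
    exact (intervalIntegral.integral_add_adjacent_intervals (hcont.intervalIntegrable _ _)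
      (hcont.intervalIntegrable _ _)).symm
  have Jl := fun h hh => (jl h hh).tendsto hc
    (PhiF_of_pos (m := m) hc (by linarith : 0 < E - Vm))
  have Jr := fun h hh => (jr h hh).tendsto (κ := -√((E - Vp + m * c ^ 2) / c *
    ((E - Vp + m * c ^ 2) / c - 2 * (m * c)))) hc
    ((PhiF_of_neg (m := m) hc (by linarith : E - Vp < 0)).trans (mul_neg _ _).symm)
  simp only [AmpF_eq hc, Complex.ofReal_neg, Complex.ofReal_one, neg_mul, one_mul, neg_div,
    mul_neg, neg_neg] at Jl Jr
  obtain ⟨φ, hφ, h₁, hh₁, hφh⟩ := T.exists_symbol one_pos fun h hh _ =>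
    H.exists_transportSolution hσ hh hg T (W := W h) hP hPl hPr
      (fun s => ((hl h hh).hasDerivAt hh hc s).1) (fun s => ((hl h hh).hasDerivAt hh hc s).2)
      (fun s => ((hr h hh).hasDerivAt hh hc s).1) (fun s => ((hr h hh).hasDerivAt hh hc s).2)
      (Jl h hh).1 (Jl h hh).2 (Jr h hh).1 (Jr h hh).2 (hW h hh)
  refine ⟨φ, hφ, h₁, hh₁, fun h hh hlt => ?_⟩
  rw [← hφh h hh hlt]
  have hξ0 : Complex.exp (Real.pi / 4 * I * (σ - 1)) ≠ 0 := Complex.exp_ne_zero _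
  rw [mul_div_cancel₀ _ (mul_ne_zero (by norm_num) hξ0), mul_assoc, ← Complex.exp_add, hS,
    Esym_eq hc, Esym_eq hc]
  have hzero : ∀ z : ℂ, z = 0 → W h = W h * Complex.exp z := fun z hz => by
    rw [hz, Complex.exp_zero, mul_one]
  apply hzero
  push_cast
  generalize ((∫ t in Set.Iic t₁, Qsym m c E Vm V t : ℝ) : ℂ) = a
  generalize ((∫ t in Set.Ici t₂, Qsym m c E Vp V t : ℝ) : ℂ) = b
  generalize (Real.sqrt ((E - Vm + m * c ^ 2) / c *
    ((E - Vm + m * c ^ 2) / c - 2 * (m * c))) : ℂ) = p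
  generalize (Real.sqrt ((E - Vp + m * c ^ 2) / c *
    ((E - Vp + m * c ^ 2) / c - 2 * (m * c))) : ℂ) = q
  linear_combination (I * (b - q * t₂) / h + I * I *
    ((∫ t in t₁..(t₁ + t₂) / 2, Real.sqrt ((m ^ 2 * c ^ 4 - ((V t).re - E) ^ 2) / c ^ 2) : ℝ) +
      (∫ t in (t₁ + t₂) / 2..t₂, Real.sqrt ((m ^ 2 * c ^ 4 - ((V t).re - E) ^ 2) / c ^ 2) : ℝ))
        / h) * hσ2 +
    ((∫ t in t₁..(t₁ + t₂) / 2, Real.sqrt ((m ^ 2 * c ^ 4 - ((V t).re - E) ^ 2) / c ^ 2) : ℝ) +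
      (∫ t in (t₁ + t₂) / 2..t₂, Real.sqrt ((m ^ 2 * c ^ 4 - ((V t).re - E) ^ 2) / c ^ 2) : ℝ))
        / h * Complex.I_mul_I

/-- **Transfer coefficients in the Klein paradox case** (Section 5).  Under
assumption (A), `m > 0`, `E` in region III, and exactly two simple real zeros
`t₁ < t₂` of `m²c⁴ − (V(x)−E)²`, the transfer matrix coefficients
`t = W(ω_in^−, ω_in^+)/W(ω_out^+, ω_in^+)` and
`r = W(ω_out^−, ω_in^+)/W(ω_out^+, ω_in^+)` satisfy
`t(E,h) = (1+hφ(h)) exp{(1/h)(z(t₁,−∞) + z(t₂,+∞) + S(E))}` and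
`r(E,h) = −i(1+hφ'(h)) exp{(1/h)(−z(t₁,−∞) + z(t₂,+∞) + S(E))}`. -/
theorem transfer_coefficients_klein
    (m c Vm Vp E : ℝ) (V : ℂ → ℂ)
    (hA : AssumptionA V Vm Vp) (hm : 0 < m) (hc : 0 < c)
    (hE1 : Vm + m * c ^ 2 < E) (hE2 : E < Vp - m * c ^ 2)
    (t₁ t₂ : ℝ) (ht12 : t₁ < t₂)
    (hzeros : ∀ x : ℝ, m ^ 2 * c ^ 4 - ((V x).re - E) ^ 2 = 0 ↔ x = t₁ ∨ x = t₂)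
    (hsimp1 : deriv (fun x : ℝ => m ^ 2 * c ^ 4 - ((V x).re - E) ^ 2) t₁ ≠ 0)
    (hsimp2 : deriv (fun x : ℝ => m ^ 2 * c ^ 4 - ((V x).re - E) ^ 2) t₂ ≠ 0)
    (ωinm ωinp ωoutp ωoutm : ℝ → ℝ → ℂ × ℂ)
    (hsol : ∀ h : ℝ, 0 < h →
      IsDiracSolution h m c V E (ωinm h) ∧ IsDiracSolution h m c V E (ωinp h) ∧
      IsDiracSolution h m c V E (ωoutp h) ∧ IsDiracSolution h m c V E (ωoutm h))
    (hjost : ∀ h : ℝ, 0 < h →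
      JostCond h m c E Vm 1 1 atBot (ωinm h) ∧
      JostCond h m c E Vp (-1) (-1) atTop (ωinp h) ∧
      JostCond h m c E Vp 1 1 atTop (ωoutp h) ∧
      JostCond h m c E Vm (-1) (-1) atBot (ωoutm h))
    (tc rc : ℝ → ℂ)
    -- the transfer matrix coefficients, as Wronskian quotients
    (htc : ∀ h : ℝ, 0 < h → ∀ x : ℝ,
      tc h = Wron (ωinm h x) (ωinp h x) / Wron (ωoutp h x) (ωinp h x))
    (hrc : ∀ h : ℝ, 0 < h → ∀ x : ℝ,
      rc h = Wron (ωoutm h x) (ωinp h x) / Wron (ωoutp h x) (ωinp h x)) :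
    ∃ φ φ' : ℝ → ℂ, IsCAS φ ∧ IsCAS φ' ∧
      ∃ h₀ > (0 : ℝ), ∀ h : ℝ, 0 < h → h < h₀ →
        tc h = (1 + (h : ℂ) * φ h)
          * Complex.exp ((1 / (h : ℂ)) *
            (Complex.I * ((((∫ t in Set.Iic t₁, Qsym m c E Vm V t)
                + Real.sqrt (Esym m c E Vm) * t₁ : ℝ)) : ℂ)
             + Complex.I * ((((-∫ t in Set.Ici t₂, Qsym m c E Vp V t)
                + Real.sqrt (Esym m c E Vp) * t₂ : ℝ)) : ℂ)
             + ((SAct m c E V t₁ t₂ : ℝ) : ℂ))) ∧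
        rc h = -Complex.I * (1 + (h : ℂ) * φ' h)
          * Complex.exp ((1 / (h : ℂ)) *
            (-(Complex.I * ((((∫ t in Set.Iic t₁, Qsym m c E Vm V t)
                + Real.sqrt (Esym m c E Vm) * t₁ : ℝ)) : ℂ))
             + Complex.I * ((((-∫ t in Set.Ici t₂, Qsym m c E Vp V t)
                + Real.sqrt (Esym m c E Vp) * t₂ : ℝ)) : ℂ)
             + ((SAct m c E V t₁ t₂ : ℝ) : ℂ))) := by
  have hmc : 0 < m * c ^ 2 := by positivity
  have hA0 : 0 < AmpF m c (E - Vp) :=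
    Real.rpow_pos_of_pos (div_pos_of_neg_of_neg (by linarith) (by linarith)) _
  have hden : ∀ h : ℝ, 0 < h → ∀ x, Wron (ωoutp h x) (ωinp h x) = -2 := fun h hh =>
    wron_eq_neg_two hh hc hA0 (hsol h hh).2.2.1 (hsol h hh).2.1 (hjost h hh).2.2.1
      (hjost h hh).2.1
  obtain ⟨φ, hφ, h₁, hh₁, H₁⟩ := exists_wronskian_symbol (W := fun h => -2 * tc h) hA hm hc hE1 hE2
    ht12 hzeros hsimp1 hsimp2 (Or.inl rfl) (fun h hh => (hsol h hh).1)
    (fun h hh => (hsol h hh).2.1) (fun h hh => (hjost h hh).1) (fun h hh => (hjost h hh).2.1)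
    (fun h hh x => by rw [htc h hh x, hden h hh x]; field_simp)
  obtain ⟨φ', hφ', h₂, hh₂, H₂⟩ := exists_wronskian_symbol (W := fun h => -2 * rc h) hA hm hc hE1
    hE2 ht12 hzeros hsimp1 hsimp2 (Or.inr rfl) (fun h hh => (hsol h hh).2.2.2)
    (fun h hh => (hsol h hh).2.1) (fun h hh => (hjost h hh).2.2.2)
    (fun h hh => (hjost h hh).2.1) (fun h hh x => by rw [hrc h hh x, hden h hh x]; field_simp)
  refine ⟨φ, φ', hφ, hφ', min h₁ h₂, lt_min hh₁ hh₂, fun h hh hlt => ⟨?_, ?_⟩⟩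
  · have := H₁ h hh (hlt.trans_le (min_le_left _ _))
    rw [Complex.ofReal_one, sub_self, mul_zero, Complex.exp_zero, one_mul] at this
    linear_combination (-1 / 2 : ℂ) * this
  · have := H₂ h hh (hlt.trans_le (min_le_right _ _))
    rw [Complex.ofReal_neg, Complex.ofReal_one, neg_one_mul,
      show (Real.pi / 4 * I * (-1 - 1) : ℂ) = -(Real.pi / 2 * I) by ring,
      exp_neg_half_pi_mul_I] at this
    linear_combination (-1 / 2 : ℂ) * this
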